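/- (Local well-posedness of quasilinear parabolic evolution equations in weighted L_p-spaces; Köhne–Prüss–Wilke.) Let 1<p<∞, μ∈(1/p,1], let V_μ ⊆ X_{γ,μ} be open and nonempty, let (A,F): V_μ → B(X_1,X_0) × X_0 be locally Lipschitz continuous, and let u_0 ∈ V_μ be such that A(u_0) ∈ MR_p(X_0). Then there exist T = T(u_0) > 0 and ε = ε(u_0) > 0 such that the closed ball B̄_{X_{γ,μ}}(u_0,ε) is contained in V_μ, and such that for every initial value u_1 ∈ B̄_{X_{γ,μ}}(u_0,ε) the quasilinear problem u̇(t)+A(u(t))u(t)=F(u(t)) (a.e. t ∈ (0,T)), u(0)=u_1, has a unique solution u(·,u_1) ∈ E_{1,μ}(0,T) ∩ C([0,T];V_μ). Furthermore there is a constant c = c(u_0) > 0 such that ‖u(·,u_1) − u(·,u_2)‖_{E_{1,μ}(0,T)} ≤ c ‖u_1 − u_2‖_{X_{γ,μ}} for all u_1, u_2 ∈ B̄_{X_{γ,μ}}(u_0,ε). -/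

import Mathlib

open MeasureTheory Set

noncomputable section

/-- Membership in the weighted space `L_{p,μ}(s;X)`: `f` is (a.e.) strongly measurable on `s`
and `t ↦ t^(1-μ) f t` is `p`-integrable on `s`. -/
def MemWLp {X : Type*} [NormedAddCommGroup X] (p μ : ℝ) (s : Set ℝ) (f : ℝ → X) : Prop :=
  AEStronglyMeasurable f (volume.restrict s) ∧
    IntegrableOn (fun t : ℝ => (t ^ (1 - μ) * ‖f t‖) ^ p) s

/-- The norm of the weighted space `L_{p,μ}(s;X)`. -/
def wLpNorm {X : Type*} [NormedAddCommGroup X] (p μ : ℝ) (s : Set ℝ) (f : ℝ → X) : ℝ :=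
  (∫ t in s, (t ^ (1 - μ) * ‖f t‖) ^ p) ^ (1 / p)

/-- `g` is the weak (distributional) derivative of `u` on the open set `s ⊆ ℝ`;
in particular `u, g ∈ L_{1,loc}(s;X)`. -/
def IsWeakDeriv {X : Type*} [NormedAddCommGroup X] [NormedSpace ℂ X]
    (s : Set ℝ) (u g : ℝ → X) : Prop :=
  LocallyIntegrableOn u s ∧ LocallyIntegrableOn g s ∧
    ∀ φ : ℝ → ℝ, ContDiff ℝ (⊤ : ℕ∞) φ → HasCompactSupport φ → tsupport φ ⊆ s →
      (∫ t in s, deriv φ t • u t) = -∫ t in s, φ t • g t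

/-- `v : s → X` has trace `x` at `t = 0`: it has a representative `w` which is continuous
on `{0} ∪ s` with `w 0 = x`. -/
def HasTrace {X : Type*} [NormedAddCommGroup X] (s : Set ℝ) (v : ℝ → X) (x : X) : Prop :=
  ∃ w : ℝ → X, ContinuousOn w (insert 0 s) ∧
    (∀ᵐ t ∂(volume.restrict s), w t = v t) ∧ w 0 = x

variable {X₀ X₁ : Type*} [NormedAddCommGroup X₀] [NormedSpace ℂ X₀] [CompleteSpace X₀]
  [NormedAddCommGroup X₁] [NormedSpace ℂ X₁] [CompleteSpace X₁]

/-- The graph norm of `A` (with respect to the embedding `ι : X₁ → X₀`) is equivalent to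
the norm of `X₁`. -/
def GraphNormEquiv (ι A : X₁ →L[ℂ] X₀) : Prop :=
  ∃ c₁ > (0 : ℝ), ∃ c₂ > (0 : ℝ), ∀ x : X₁,
    c₁ * ‖x‖ ≤ ‖ι x‖ + ‖A x‖ ∧ ‖ι x‖ + ‖A x‖ ≤ c₂ * ‖x‖

/-- Membership (of the pair `(u, u')`, `u'` being the weak derivative of `u`) in the maximal
regularity class `E_{1,μ}(s) = W^1_{p,μ}(s;X₀) ∩ L_{p,μ}(s;X₁)`, where `ι : X₁ → X₀` is the
embedding. -/
def MemE (p μ : ℝ) (s : Set ℝ) (ι : X₁ →L[ℂ] X₀) (u : ℝ → X₁) (u' : ℝ → X₀) : Prop :=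
  MemWLp p μ s u ∧ MemWLp p μ s (fun t => ι (u t)) ∧ MemWLp p μ s u' ∧
    IsWeakDeriv s (fun t => ι (u t)) u'

/-- The norm of the maximal regularity class `E_{1,μ}(s)`. -/
def eNorm (p μ : ℝ) (s : Set ℝ) (u : ℝ → X₁) (u' : ℝ → X₀) : ℝ :=
  (wLpNorm p μ s u ^ p + wLpNorm p μ s u' ^ p) ^ (1 / p)

/-- `(u, u')` (with `u'` the weak derivative of `u`) solves the linear problem
`u̇ + A u = f` a.e. on `s`, `u(0) = x`, in the class `E_{1,μ}(s)`. -/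
def IsLinSol (p μ : ℝ) (s : Set ℝ) (ι A : X₁ →L[ℂ] X₀) (f : ℝ → X₀) (x : X₀)
    (u : ℝ → X₁) (u' : ℝ → X₀) : Prop :=
  MemE p μ s ι u u' ∧
    (∀ᵐ t ∂(volume.restrict s), u' t + A (u t) = f t) ∧
    HasTrace s (fun t => ι (u t)) x

/-- `A` has maximal `L_{p,μ}`-regularity, `A ∈ MR_{p,μ}(X₀)`: for every
`f ∈ L_{p,μ}(ℝ₊;X₀)` there is a solution `u ∈ W^1_{p,μ}(ℝ₊;X₀) ∩ L_{p,μ}(ℝ₊;X₁)` of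
`u̇ + A u = f`, `u(0) = 0`, and it is unique (up to a.e. equality). -/
def MRw (p μ : ℝ) (ι A : X₁ →L[ℂ] X₀) : Prop :=
  ∀ f : ℝ → X₀, MemWLp p μ (Set.Ioi 0) f →
    (∃ u u', IsLinSol p μ (Set.Ioi 0) ι A f 0 u u') ∧
    ∀ u₁ u₁' u₂ u₂', IsLinSol p μ (Set.Ioi 0) ι A f 0 u₁ u₁' →
      IsLinSol p μ (Set.Ioi 0) ι A f 0 u₂ u₂' →
      ∀ᵐ t ∂(volume.restrict (Set.Ioi 0)), u₁ t = u₂ t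

/-- `x` belongs to the trace space `X_{γ,μ} = {u(0) : u ∈ E_{1,μ}}`. -/
def InTrace (p μ : ℝ) (ι : X₁ →L[ℂ] X₀) (x : X₀) : Prop :=
  ∃ u u', MemE p μ (Set.Ioi 0) ι u u' ∧ HasTrace (Set.Ioi 0) (fun t => ι (u t)) x

/-- The trace norm `‖x‖_{X_{γ,μ}} = inf {‖u‖_{E_{1,μ}} : u ∈ E_{1,μ}, u(0) = x}`. -/
def traceNorm (p μ : ℝ) (ι : X₁ →L[ℂ] X₀) (x : X₀) : ℝ :=
  sInf {r : ℝ | ∃ u u', MemE p μ (Set.Ioi 0) ι u u' ∧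
    HasTrace (Set.Ioi 0) (fun t => ι (u t)) x ∧ r = eNorm p μ (Set.Ioi 0) u u'}

/-- `(u, u')` is a solution on `[0,T]` of the quasilinear problem
`u̇ + A(u) u = F(u)` a.e. on `(0,T)`, `u(0) = x`, in the class
`E_{1,μ}(0,T) ∩ C([0,T]; V)`: membership in `E_{1,μ}(0,T)`, the equation a.e., and a
representative `w` which satisfies `w 0 = x`, takes values in `V` on `[0,T]` and is
continuous on `[0,T]` with respect to the trace norm of `X_{γ,μ}`. -/
def IsQLSol (p μ T : ℝ) (ι : X₁ →L[ℂ] X₀) (A : X₀ → X₁ →L[ℂ] X₀) (F : X₀ → X₀)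
    (V : Set X₀) (x : X₀) (u : ℝ → X₁) (u' : ℝ → X₀) : Prop :=
  MemE p μ (Set.Ioo 0 T) ι u u' ∧
  (∀ᵐ t ∂(volume.restrict (Set.Ioo 0 T)), u' t + A (ι (u t)) (u t) = F (ι (u t))) ∧
  ∃ w : ℝ → X₀,
    (∀ᵐ t ∂(volume.restrict (Set.Ioo 0 T)), w t = ι (u t)) ∧
    w 0 = x ∧ (∀ t ∈ Set.Icc 0 T, w t ∈ V) ∧
    ∀ t ∈ Set.Icc 0 T, ∀ ε > (0 : ℝ), ∃ δ > (0 : ℝ), ∀ t' ∈ Set.Icc 0 T, |t' - t| < δ →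
      traceNorm p μ ι (w t' - w t) < ε

/-- `V` is an open subset of the trace space `X_{γ,μ}` (with respect to the trace norm). -/
def TraceOpen (p μ : ℝ) (ι : X₁ →L[ℂ] X₀) (V : Set X₀) : Prop :=
  (∀ x ∈ V, InTrace p μ ι x) ∧
  ∀ x ∈ V, ∃ r > (0 : ℝ), ∀ y, InTrace p μ ι y → traceNorm p μ ι (y - x) < r → y ∈ V

/-- `(A, F) : V → B(X₁,X₀) × X₀` is locally Lipschitz continuous with respect to the trace
norm of `X_{γ,μ}` on `V`. -/
def LocLip (p μ : ℝ) (ι : X₁ →L[ℂ] X₀) (A : X₀ → X₁ →L[ℂ] X₀) (F : X₀ → X₀)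
    (V : Set X₀) : Prop :=
  ∀ x ∈ V, ∃ ε > (0 : ℝ), ∃ L > (0 : ℝ), ∀ y ∈ V, ∀ z ∈ V,
    traceNorm p μ ι (y - x) ≤ ε → traceNorm p μ ι (z - x) ≤ ε →
    ‖A y - A z‖ ≤ L * traceNorm p μ ι (y - z) ∧
    ‖F y - F z‖ ≤ L * traceNorm p μ ι (y - z)

set_option linter.unusedSectionVars false

section PartOne

open Filter Topology

variable {E E' : Type*} [NormedAddCommGroup E] [NormedSpace ℝ E]
  [NormedAddCommGroup E'] [NormedSpace ℝ E']

def WM (p α : ℝ) (s : Set ℝ) (f : ℝ → E) : Prop :=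
  MemLp (fun t : ℝ => t ^ α • f t) (ENNReal.ofReal p) (volume.restrict s)

def WN (p α : ℝ) (s : Set ℝ) (f : ℝ → E) : ℝ :=
  (eLpNorm (fun t : ℝ => t ^ α • f t) (ENNReal.ofReal p) (volume.restrict s)).toReal

variable {p α : ℝ} {s s' : Set ℝ} {f g : ℝ → E}

theorem one_le_ofReal {p : ℝ} (hp : 1 < p) : 1 ≤ ENNReal.ofReal p := by
  rw [← ENNReal.ofReal_one]; exact ENNReal.ofReal_le_ofReal hp.le

theorem WM.add (hf : WM p α s f) (hg : WM p α s g) : WM p α s (fun t => f t + g t) := by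
  have := MemLp.add hf hg
  refine (memLp_congr_ae (Eventually.of_forall fun t => ?_)).1 this
  simp [smul_add]

theorem WM.sub (hf : WM p α s f) (hg : WM p α s g) : WM p α s (fun t => f t - g t) := by
  have := MemLp.sub hf hg
  refine (memLp_congr_ae (Eventually.of_forall fun t => ?_)).1 this
  simp [smul_sub]

theorem WM.neg (hf : WM p α s f) : WM p α s (fun t => - f t) := by
  have := MemLp.neg hf
  refine (memLp_congr_ae (Eventually.of_forall fun t => ?_)).1 this
  simp

theorem WM.zero : WM p α s (fun _ => (0 : E)) := by
  simp [WM]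

theorem WM.clm (A : E →L[ℝ] E') (hf : WM p α s f) : WM p α s (fun t => A (f t)) := by
  have := A.comp_memLp' hf
  refine (memLp_congr_ae (Eventually.of_forall fun t => ?_)).1 this
  simp

theorem WM.mono (h : s' ⊆ s) (hf : WM p α s f) : WM p α s' f :=
  MemLp.mono_measure (Measure.restrict_mono h le_rfl) hf

theorem WM.congr (h : ∀ᵐ t ∂(volume.restrict s), f t = g t) (hf : WM p α s f) : WM p α s g := by
  refine (memLp_congr_ae (h.mono fun t ht => ?_)).1 hf
  simp [ht]

theorem WN_congr (h : ∀ᵐ t ∂(volume.restrict s), f t = g t) : WN p α s f = WN p α s g := by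
  unfold WN
  rw [eLpNorm_congr_ae (h.mono fun t ht => ?_)]
  simp [ht]

theorem WN_nonneg : 0 ≤ WN p α s f := ENNReal.toReal_nonneg

theorem WN_zero : WN p α s (fun _ => (0 : E)) = 0 := by simp [WN]

theorem WN_neg : WN p α s (fun t => - f t) = WN p α s f := by
  unfold WN
  rw [← eLpNorm_neg]
  congr 2
  ext t; simp

theorem WN_add_le (hp : 1 < p) (hf : WM p α s f) (hg : WM p α s g) :
    WN p α s (fun t => f t + g t) ≤ WN p α s f + WN p α s g := by
  unfold WN
  rw [← ENNReal.toReal_add hf.2.ne hg.2.ne]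
  refine ENNReal.toReal_mono (by simpa using ⟨hf.2.ne, hg.2.ne⟩) ?_
  have := eLpNorm_add_le hf.1 hg.1 (one_le_ofReal hp)
  refine le_trans (le_of_eq ?_) this
  congr 1; ext t; simp

theorem WN_sub_le (hp : 1 < p) (hf : WM p α s f) (hg : WM p α s g) :
    WN p α s (fun t => f t - g t) ≤ WN p α s f + WN p α s g := by
  have := WN_add_le hp hf hg.neg
  rw [WN_neg] at this
  simpa [sub_eq_add_neg] using this

theorem WN_mono (h : s' ⊆ s) (hf : WM p α s f) : WN p α s' f ≤ WN p α s f :=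
  ENNReal.toReal_mono hf.2.ne (eLpNorm_mono_measure _ (Measure.restrict_mono h le_rfl))

/-- domination -/
theorem WN_le_of_bound {g : ℝ → E'} (hg : WM p α s g) (c : ℝ) (hc : 0 ≤ c)
    (h : ∀ᵐ t ∂(volume.restrict s), ‖f t‖ ≤ c * ‖g t‖) : WN p α s f ≤ c * WN p α s g := by
  unfold WN
  have h1 := eLpNorm_le_mul_eLpNorm_of_ae_le_mul (μ := volume.restrict s)
    (f := fun t : ℝ => t ^ α • f t) (g := fun t : ℝ => t ^ α • g t) (c := c)
    (h.mono fun t ht => by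
      rw [norm_smul, norm_smul]
      calc _ ≤ ‖t ^ α‖ * (c * ‖g t‖) := by gcongr
        _ = _ := by ring) (ENNReal.ofReal p)
  refine (ENNReal.toReal_mono (ENNReal.mul_ne_top (by simp) hg.2.ne) h1).trans (le_of_eq ?_)
  rw [ENNReal.toReal_mul, ENNReal.toReal_ofReal hc]

theorem meas_pow (α : ℝ) : Measurable (fun t : ℝ => t ^ α) := by fun_prop

theorem WM.of_bound {g : ℝ → E'} (hg : WM p α s g) (c : ℝ)
    (hf : AEStronglyMeasurable f (volume.restrict s))
    (h : ∀ᵐ t ∂(volume.restrict s), ‖f t‖ ≤ c * ‖g t‖) : WM p α s f := by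
  refine MemLp.of_le_mul (c := c) hg ((meas_pow α).aestronglyMeasurable.smul hf)
    (h.mono fun t ht => by
      rw [norm_smul, norm_smul]
      calc _ ≤ ‖t ^ α‖ * (c * ‖g t‖) := by gcongr
        _ = _ := by ring)

theorem WN_clm_le (A : E →L[ℝ] E') (hf : WM p α s f) :
    WN p α s (fun t => A (f t)) ≤ ‖A‖ * WN p α s f :=
  WN_le_of_bound hf _ (norm_nonneg _) (Eventually.of_forall fun _ => A.le_opNorm _)

theorem WM.aesm (hs : MeasurableSet s) (hs0 : s ⊆ Ioi 0) (hf : WM p α s f) :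
    AEStronglyMeasurable f (volume.restrict s) := by
  have h : AEStronglyMeasurable (fun t : ℝ => t ^ (-α) • (t ^ α • f t)) (volume.restrict s) :=
    (meas_pow (-α)).aestronglyMeasurable.smul hf.1
  refine h.congr ?_
  filter_upwards [ae_restrict_mem hs] with t ht
  have : 0 < t := hs0 ht
  rw [smul_smul, ← Real.rpow_add this]; simp

theorem WN_eq_zero (hp : 1 < p) (hs : MeasurableSet s) (hs0 : s ⊆ Ioi 0) (hf : WM p α s f)
    (h : WN p α s f = 0) : ∀ᵐ t ∂(volume.restrict s), f t = 0 := by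
  unfold WN at h
  rw [ENNReal.toReal_eq_zero_iff] at h
  have h := h.resolve_right hf.2.ne
  rw [eLpNorm_eq_zero_iff hf.1 (by simp; linarith)] at h
  filter_upwards [h, ae_restrict_mem hs] with t h1 ht
  have : 0 < t := hs0 ht
  simp only [Pi.zero_apply, smul_eq_zero] at h1
  exact h1.resolve_left (Real.rpow_pos_of_pos this _).ne'

theorem WM.indicator (hs : MeasurableSet s) (h : s ⊆ s') (hf : WM p α s f) :
    WM p α s' (s.indicator f) := by
  unfold WM
  have h1 : (fun t : ℝ => t ^ α • s.indicator f t) = s.indicator (fun t : ℝ => t ^ α • f t) := by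
    ext t; by_cases ht : t ∈ s <;> simp [ht]
  rw [h1, memLp_indicator_iff_restrict hs, Measure.restrict_restrict hs,
    inter_eq_self_of_subset_left h]
  exact hf

theorem WN_indicator (hs : MeasurableSet s) (h : s ⊆ s') :
    WN p α s' (s.indicator f) = WN p α s f := by
  unfold WN
  have h1 : (fun t : ℝ => t ^ α • s.indicator f t) = s.indicator (fun t : ℝ => t ^ α • f t) := by
    ext t; by_cases ht : t ∈ s <;> simp [ht]
  rw [h1, eLpNorm_indicator_eq_eLpNorm_restrict hs, Measure.restrict_restrict hs,
    inter_eq_self_of_subset_left h]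

theorem indicator_ae (hs : MeasurableSet s) :
    ∀ᵐ t ∂(volume.restrict s), s.indicator f t = f t := by
  filter_upwards [ae_restrict_mem hs] with t ht
  simp [ht]

theorem lintegral_rpow_Ioo {c T : ℝ} (hc : -1 < c) (hT : 0 < T) :
    ∫⁻ t in Ioo 0 T, ENNReal.ofReal (t ^ c) = ENNReal.ofReal (T ^ (c + 1) / (c + 1)) := by
  have hi : IntegrableOn (fun t : ℝ => t ^ c) (Ioo 0 T) :=
    (intervalIntegral.integrableOn_Ioo_rpow_iff hT).2 hc
  rw [← ofReal_integral_eq_lintegral_ofReal hi]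
  · rw [← integral_Ioc_eq_integral_Ioo, ← intervalIntegral.integral_of_le hT.le,
      integral_rpow (Or.inl hc)]
    rw [Real.zero_rpow (by linarith), sub_zero]
  · filter_upwards [ae_restrict_mem measurableSet_Ioo] with t ht
    exact Real.rpow_nonneg ht.1.le _

/-- Hölder estimate with explicit rate -/
theorem holder_lint (hp : 1 < p) {b : ℝ} (hb : b < 1 - 1 / p) :
    ∃ c : ℝ, 0 ≤ c ∧ ∀ T : ℝ, 0 < T → ∀ g : ℝ → ENNReal, AEMeasurable g (volume.restrict (Ioo 0 T)) →
      (∫⁻ t in Ioo 0 T, g t) ^ p ≤ ENNReal.ofReal (c * T ^ ((1 - 1 / p - b) * p)) *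
        ∫⁻ t in Ioo 0 T, ENNReal.ofReal (t ^ (b * p)) * g t ^ p := by
  set q : ℝ := p / (p - 1) with hq
  have hpq : p.HolderConjugate q := Real.HolderConjugate.conjExponent hp
  have hp0 : 0 < p := by linarith
  have hq0 : 0 < q := hpq.symm.pos
  have h1q : 1 / q = 1 - 1 / p := by
    have := hpq.inv_add_inv_eq_one
    rw [one_div, one_div]; linarith
  have hbq : -1 < -b * q := by
    rw [← h1q, lt_div_iff₀ hq0] at hb; linarith
  have hd : 0 < -b * q + 1 := by linarith
  refine ⟨(1 / (-b * q + 1)) ^ (p / q), by positivity, fun T hT g hg => ?_⟩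
  have key := ENNReal.lintegral_mul_le_Lp_mul_Lq (volume.restrict (Ioo 0 T)) hpq.symm
    (f := fun t : ℝ => ENNReal.ofReal (t ^ (-b))) (g := fun t : ℝ => ENNReal.ofReal (t ^ b) * g t)
    (by fun_prop) (by fun_prop)
  have e1 : ∫⁻ t in Ioo 0 T, g t = ∫⁻ t in Ioo 0 T,
      ((fun t : ℝ => ENNReal.ofReal (t ^ (-b))) * fun t : ℝ => ENNReal.ofReal (t ^ b) * g t) t := by
    refine setLIntegral_congr_fun measurableSet_Ioo fun t ht => ?_
    have : 0 < t := ht.1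
    simp only [Pi.mul_apply]
    rw [← mul_assoc, ← ENNReal.ofReal_mul (by positivity), ← Real.rpow_add this]
    simp
  have e2 : ∫⁻ t in Ioo 0 T, ENNReal.ofReal (t ^ (-b)) ^ q
      = ENNReal.ofReal (T ^ (-b * q + 1) / (-b * q + 1)) := by
    rw [← lintegral_rpow_Ioo hbq hT]
    refine setLIntegral_congr_fun measurableSet_Ioo fun t ht => ?_
    have : 0 < t := ht.1
    rw [ENNReal.ofReal_rpow_of_nonneg (by positivity) hq0.le, ← Real.rpow_mul this.le]
  have e3 : ∫⁻ t in Ioo 0 T, (ENNReal.ofReal (t ^ b) * g t) ^ p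
      = ∫⁻ t in Ioo 0 T, ENNReal.ofReal (t ^ (b * p)) * g t ^ p := by
    refine setLIntegral_congr_fun measurableSet_Ioo fun t ht => ?_
    have : 0 < t := ht.1
    rw [ENNReal.mul_rpow_of_nonneg _ _ hp0.le,
      ENNReal.ofReal_rpow_of_nonneg (by positivity) hp0.le, ← Real.rpow_mul this.le]
  rw [← e1, e2, e3] at key
  calc _ ≤ _ := ENNReal.rpow_le_rpow key hp0.le
    _ = _ := by
      rw [ENNReal.mul_rpow_of_nonneg _ _ hp0.le, ← ENNReal.rpow_mul, ← ENNReal.rpow_mul,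
        ENNReal.ofReal_rpow_of_nonneg (by positivity) (by positivity)]
      congr 1
      · congr 1
        rw [Real.div_rpow (by positivity) hd.le, ← Real.rpow_mul hT.le,
          Real.div_rpow zero_le_one hd.le, Real.one_rpow]
        have : (-b * q + 1) * (1 / q * p) = (1 - 1 / p - b) * p := by
          rw [← h1q]; field_simp; ring
        rw [this, show 1 / q * p = p / q by ring]
        ring
      · rw [one_div_mul_cancel hp0.ne', ENNReal.rpow_one]

theorem eLpNorm_pow_eq (hp : 1 < p) (hs : MeasurableSet s) (hs0 : s ⊆ Ioi 0) :
    eLpNorm (fun t : ℝ => t ^ α • f t) (ENNReal.ofReal p) (volume.restrict s) ^ p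
      = ∫⁻ t in s, ENNReal.ofReal (t ^ (α * p)) * ‖f t‖ₑ ^ p := by
  have hp0 : 0 < p := by linarith
  rw [eLpNorm_eq_lintegral_rpow_enorm_toReal (by simpa using hp0) (by simp),
    ENNReal.toReal_ofReal hp0.le, ← ENNReal.rpow_mul, one_div_mul_cancel hp0.ne', ENNReal.rpow_one]
  refine setLIntegral_congr_fun hs fun t ht => ?_
  have : 0 < t := hs0 ht
  rw [enorm_smul, ENNReal.mul_rpow_of_nonneg _ _ hp0.le,
    Real.enorm_of_nonneg (by positivity),
    ENNReal.ofReal_rpow_of_nonneg (by positivity) hp0.le, ← Real.rpow_mul this.le]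

theorem WN_pow_eq (hp : 1 < p) (hs : MeasurableSet s) (hs0 : s ⊆ Ioi 0) (hf : WM p α s f) :
    ENNReal.ofReal (WN p α s f ^ p)
      = ∫⁻ t in s, ENNReal.ofReal (t ^ (α * p)) * ‖f t‖ₑ ^ p := by
  have hp0 : 0 < p := by linarith
  rw [← eLpNorm_pow_eq hp hs hs0, ← ENNReal.ofReal_rpow_of_nonneg WN_nonneg hp0.le]
  unfold WN
  rw [ENNReal.ofReal_toReal hf.2.ne]

theorem WM_of_lintegral (hp : 1 < p) (hs : MeasurableSet s) (hs0 : s ⊆ Ioi 0)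
    (hf : AEStronglyMeasurable f (volume.restrict s)) {c : ℝ} (hc : 0 ≤ c)
    (h : ∫⁻ t in s, ENNReal.ofReal (t ^ (α * p)) * ‖f t‖ₑ ^ p ≤ ENNReal.ofReal (c ^ p)) :
    WM p α s f ∧ WN p α s f ≤ c := by
  have hp0 : 0 < p := by linarith
  rw [← eLpNorm_pow_eq hp hs hs0, ← ENNReal.ofReal_rpow_of_nonneg hc hp0.le,
    ENNReal.rpow_le_rpow_iff hp0] at h
  exact ⟨⟨(meas_pow α).aestronglyMeasurable.smul hf, h.trans_lt (by simp)⟩,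
    ENNReal.toReal_le_of_le_ofReal hc h⟩

/-- Hölder -/
theorem WM.holder (hp : 1 < p) (hα : α < 1 - 1 / p) {T : ℝ} (hT : 0 < T) :
    ∃ c : ℝ, 0 ≤ c ∧ ∀ f : ℝ → E, WM p α (Ioo 0 T) f →
      IntegrableOn f (Ioo 0 T) ∧ ∫ t in Ioo 0 T, ‖f t‖ ≤ c * WN p α (Ioo 0 T) f := by
  have hp0 : 0 < p := by linarith
  obtain ⟨c, hc, h⟩ := holder_lint hp hα
  refine ⟨(c * T ^ ((1 - 1 / p - α) * p)) ^ (1 / p), by positivity, fun f hf => ?_⟩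
  have hm := hf.aesm measurableSet_Ioo (fun t ht => ht.1)
  have h1 := h T hT (fun t => ‖f t‖ₑ) hm.enorm
  rw [← WN_pow_eq hp measurableSet_Ioo (fun t ht => ht.1) hf, ← ENNReal.ofReal_mul (by positivity)]
    at h1
  have h2 : (∫⁻ t in Ioo 0 T, ‖f t‖ₑ) ≤ ENNReal.ofReal ((c * T ^ ((1 - 1 / p - α) * p)) ^ (1 / p)
      * WN p α (Ioo 0 T) f) := by
    have h3 := ENNReal.rpow_le_rpow h1 (z := 1 / p) (by positivity)
    rw [← ENNReal.rpow_mul, mul_one_div_cancel hp0.ne', ENNReal.rpow_one] at h3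
    refine h3.trans (le_of_eq ?_)
    have := WN_nonneg (p := p) (α := α) (s := Ioo 0 T) (f := f)
    rw [ENNReal.ofReal_rpow_of_nonneg (by positivity) (by positivity),
      Real.mul_rpow (by positivity) (by positivity), ← Real.rpow_mul this,
      mul_one_div_cancel hp0.ne', Real.rpow_one]
  refine ⟨⟨hm, h2.trans_lt (by simp)⟩, ?_⟩
  rw [integral_norm_eq_lintegral_enorm hm]
  have := WN_nonneg (p := p) (α := α) (s := Ioo 0 T) (f := f)
  exact ENNReal.toReal_le_of_le_ofReal (by positivity) h2

theorem memWLp_iff {X : Type*} [NormedAddCommGroup X] [NormedSpace ℝ X] {f : ℝ → X} {p μ : ℝ}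
    (hp : 1 < p) (hs : MeasurableSet s) (hs0 : s ⊆ Ioi 0) :
    MemWLp p μ s f ↔ WM p (1 - μ) s f := by
  have hp0 : 0 < p := by linarith
  have key : ∀ hm : AEStronglyMeasurable f (volume.restrict s),
      (IntegrableOn (fun t : ℝ => (t ^ (1 - μ) * ‖f t‖) ^ p) s ↔ WM p (1 - μ) s f) := by
    intro hm
    have h1 : AEStronglyMeasurable (fun t : ℝ => t ^ (1 - μ) • f t) (volume.restrict s) :=
      (meas_pow _).aestronglyMeasurable.smul hm
    unfold WM IntegrableOn
    rw [← integrable_norm_rpow_iff h1 (by simpa using hp0) (by simp), ENNReal.toReal_ofReal hp0.le]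
    refine integrable_congr ?_
    filter_upwards [ae_restrict_mem hs] with t ht
    have : 0 < t := hs0 ht
    rw [norm_smul, Real.norm_of_nonneg (by positivity)]
  constructor
  · rintro ⟨h1, h2⟩; exact (key h1).1 h2
  · intro h; have := h.aesm hs hs0; exact ⟨this, (key this).2 h⟩

theorem wLpNorm_eq {X : Type*} [NormedAddCommGroup X] [NormedSpace ℝ X] {f : ℝ → X} {p μ : ℝ}
    (hp : 1 < p) (hs : MeasurableSet s) (hs0 : s ⊆ Ioi 0) (hf : WM p (1 - μ) s f) :
    wLpNorm p μ s f = WN p (1 - μ) s f := by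
  have hp0 : 0 < p := by linarith
  unfold wLpNorm WN
  rw [hf.eLpNorm_eq_integral_rpow_norm (by simpa using hp0) (by simp),
    ENNReal.toReal_ofReal hp0.le, ENNReal.toReal_ofReal, one_div]
  · congr 1
    refine setIntegral_congr_fun hs fun t ht => ?_
    have : 0 < t := hs0 ht
    rw [norm_smul, Real.norm_of_nonneg (by positivity)]
  · positivity

end PartOne

set_option linter.unusedSectionVars false

section PartTwo

open Filter Topology

variable {E : Type*} [NormedAddCommGroup E] [NormedSpace ℝ E] [CompleteSpace E]

structure Ini (s : Set ℝ) : Prop where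
  isOpen : IsOpen s
  pos : s ⊆ Ioi 0
  down : ∀ t ∈ s, Ioc 0 t ⊆ s
  nonempty : s.Nonempty

theorem Ini.Ioi : Ini (Set.Ioi (0 : ℝ)) :=
  ⟨isOpen_Ioi, subset_rfl, fun _ _ _ h => h.1, ⟨1, by simp⟩⟩

theorem Ini.Ioo {T : ℝ} (hT : 0 < T) : Ini (Set.Ioo (0 : ℝ) T) :=
  ⟨isOpen_Ioo, fun _ h => h.1, fun _ ht _ h => ⟨h.1, h.2.trans_lt ht.2⟩, ⟨T / 2, by simp; linarith⟩⟩

theorem ii_Ioo {g : ℝ → E} {t : ℝ} (ht : 0 ≤ t) :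
    ∫ r in (0 : ℝ)..t, g r = ∫ r in Ioo 0 t, g r := by
  rw [intervalIntegral.integral_of_le ht, integral_Ioc_eq_integral_Ioo]

theorem ii_of_Ioo {g : ℝ → E} {t : ℝ} (ht : 0 ≤ t) (h : IntegrableOn g (Ioo 0 t)) :
    IntervalIntegrable g volume 0 t := by
  rw [intervalIntegrable_iff_integrableOn_Ioo_of_le ht]; exact h

theorem cont_prim {g : ℝ → E} {b : ℝ} (hb : 0 ≤ b) (h : IntegrableOn g (Ioo 0 b)) :
    ContinuousOn (fun t => ∫ r in (0 : ℝ)..t, g r) (Icc 0 b) := by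
  have := intervalIntegral.continuousOn_primitive_interval' (ii_of_Ioo hb h) (a := 0) (by simp)
  rwa [uIcc_of_le hb] at this

theorem ibp {φ φ' : ℝ → ℝ} {g : ℝ → E} {b : ℝ} (hb : 0 ≤ b) (hφ' : IntegrableOn φ' (Ioo 0 b))
    (hφ : ∀ t ∈ Icc 0 b, φ t = φ 0 + ∫ r in (0 : ℝ)..t, φ' r) (hg : IntegrableOn g (Ioo 0 b)) :
    IntegrableOn (fun t => φ' t • ∫ r in (0 : ℝ)..t, g r) (Ioo 0 b) ∧
    IntegrableOn (fun t => φ t • g t) (Ioo 0 b) ∧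
    φ b • (∫ r in (0 : ℝ)..b, g r) =
      ∫ t in (0 : ℝ)..b, (φ' t • (∫ r in (0 : ℝ)..t, g r) + φ t • g t) := by
  have hφc : ContinuousOn φ (Icc 0 b) :=
    ((continuousOn_const (c := φ 0)).add (cont_prim hb hφ')).congr fun t ht => hφ t ht
  have hWc := cont_prim hb hg
  have i1 : IntegrableOn (fun t => φ' t • ∫ r in (0 : ℝ)..t, g r) (Ioo 0 b) := by
    obtain ⟨C, hC⟩ := isCompact_Icc.exists_bound_of_continuousOn hWc
    refine Integrable.smul_bdd hφ' C ?_ ?_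
    · exact (hWc.mono Ioo_subset_Icc_self).aestronglyMeasurable measurableSet_Ioo
    · filter_upwards [ae_restrict_mem measurableSet_Ioo] with t ht
      exact hC t (Ioo_subset_Icc_self ht)
  have i2 : IntegrableOn (fun t => φ t • g t) (Ioo 0 b) := by
    obtain ⟨C, hC⟩ := isCompact_Icc.exists_bound_of_continuousOn hφc
    refine Integrable.bdd_smul hg C ?_ ?_
    · exact (hφc.mono Ioo_subset_Icc_self).aestronglyMeasurable measurableSet_Ioo
    · filter_upwards [ae_restrict_mem measurableSet_Ioo] with t ht
      exact hC t (Ioo_subset_Icc_self ht)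
  refine ⟨i1, i2, ?_⟩
  have hint : Integrable (fun z : ℝ × ℝ => {z : ℝ × ℝ | z.2 < z.1}.indicator
      (fun z => φ' z.1 • g z.2) z) ((volume.restrict (Ioo 0 b)).prod (volume.restrict (Ioo 0 b))) :=
    (Integrable.smul_prod hφ' hg).indicator (measurableSet_lt measurable_snd measurable_fst)
  have sw := integral_integral_swap (f := fun t r => {z : ℝ × ℝ | z.2 < z.1}.indicator
      (fun z => φ' z.1 • g z.2) (t, r)) hint
  have e1 : ∀ t ∈ Ioo 0 b, (∫ r in Ioo 0 b, {z : ℝ × ℝ | z.2 < z.1}.indicator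
      (fun z => φ' z.1 • g z.2) (t, r)) = φ' t • ∫ r in (0 : ℝ)..t, g r := by
    intro t ht
    have : (fun r => {z : ℝ × ℝ | z.2 < z.1}.indicator (fun z => φ' z.1 • g z.2) (t, r))
        = (Iio t).indicator (fun r => φ' t • g r) := by
      ext r; simp [indicator]
    rw [this, setIntegral_indicator measurableSet_Iio, integral_smul, ii_Ioo ht.1.le]
    congr 3
    ext r; simp only [mem_inter_iff, mem_Ioo, mem_Iio]
    constructor
    · rintro ⟨⟨h1, h2⟩, h3⟩; exact ⟨h1, h3⟩
    · rintro ⟨h1, h3⟩; exact ⟨⟨h1, h3.trans ht.2⟩, h3⟩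
  have e2 : ∀ r ∈ Ioo 0 b, (∫ t in Ioo 0 b, {z : ℝ × ℝ | z.2 < z.1}.indicator
      (fun z => φ' z.1 • g z.2) (t, r)) = φ b • g r - φ r • g r := by
    intro r hr
    have : (fun t => {z : ℝ × ℝ | z.2 < z.1}.indicator (fun z => φ' z.1 • g z.2) (t, r))
        = (Ioi r).indicator (fun t => φ' t • g r) := by
      ext t; simp [indicator]
    rw [this, setIntegral_indicator measurableSet_Ioi, integral_smul_const, ← sub_smul]
    congr 1
    have h1 : Ioo 0 b ∩ Ioi r = Ioo r b := by
      ext t; simp only [mem_inter_iff, mem_Ioo, mem_Ioi]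
      constructor
      · rintro ⟨⟨h1, h2⟩, h3⟩; exact ⟨h3, h2⟩
      · rintro ⟨h1, h3⟩; exact ⟨⟨hr.1.trans h1, h3⟩, h1⟩
    rw [h1, ← integral_Ioc_eq_integral_Ioo, ← intervalIntegral.integral_of_le hr.2.le,
      hφ b ⟨hb, le_rfl⟩, hφ r ⟨hr.1.le, hr.2.le⟩]
    have i := ii_of_Ioo hb hφ'
    have i3 : IntervalIntegrable φ' volume 0 r := i.mono_set (by
      rw [uIcc_of_le hr.1.le, uIcc_of_le hb]; exact Icc_subset_Icc le_rfl hr.2.le)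
    rw [← intervalIntegral.integral_interval_sub_left i i3]
    ring
  rw [setIntegral_congr_fun measurableSet_Ioo e1, setIntegral_congr_fun measurableSet_Ioo e2,
    integral_sub (f := fun t => φ b • g t) (hg.smul (φ b)) i2, integral_smul] at sw
  rw [ii_Ioo hb, ii_Ioo hb, integral_add i1 i2, sw]
  abel

theorem Ini.cpt {s K : Set ℝ} (hs : Ini s) (hK : IsCompact K) (hKs : K ⊆ s) :
    ∃ a b : ℝ, 0 < a ∧ a < b ∧ b ∈ s ∧ K ⊆ Set.Ioo a b := by
  have hK' : ∃ K', IsCompact K' ∧ K ⊆ K' ∧ K' ⊆ s ∧ K'.Nonempty := by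
    obtain ⟨x, hx⟩ := hs.nonempty
    exact ⟨insert x K, hK.insert x, subset_insert _ _, insert_subset hx hKs, ⟨x, by simp⟩⟩
  obtain ⟨K', hK1, hK2, hK3, hK4⟩ := hK'
  obtain ⟨m, hm, hm'⟩ := hK1.exists_isLeast hK4
  obtain ⟨M, hM, hM'⟩ := hK1.exists_isGreatest hK4
  have hm0 : 0 < m := hs.pos (hK3 hm)
  obtain ⟨ε, hε, hb⟩ := Metric.isOpen_iff.1 hs.isOpen M (hK3 hM)
  have hmM : m ≤ M := hm' hM
  refine ⟨m / 2, M + ε / 2, by linarith, by linarith, hb ?_, fun t ht => ⟨?_, ?_⟩⟩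
  · rw [Metric.mem_ball, Real.dist_eq, abs_lt]; constructor <;> linarith
  · have := hm' (hK2 ht); linarith
  · have := hM' (hK2 ht); linarith

/-- integral form implies weak derivative -/
theorem weak_of_int {s : Set ℝ} (hs : Ini s) {u g : ℝ → E} {x : E}
    (hg : ∀ t ∈ s, IntegrableOn g (Ioo 0 t))
    (hu : ∀ᵐ t ∂(volume.restrict s), u t = x + ∫ r in (0 : ℝ)..t, g r)
    (φ : ℝ → ℝ) (h1 : ContDiff ℝ (⊤ : ℕ∞) φ) (h2 : HasCompactSupport φ) (h3 : tsupport φ ⊆ s) :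
    (∫ t in s, deriv φ t • u t) = -∫ t in s, φ t • g t := by
  obtain ⟨a, b, ha, hab, hb, hK⟩ := hs.cpt h2 h3
  have hb0 : 0 < b := ha.trans hab
  have hsub : Ioo 0 b ⊆ s := fun t ht => hs.down b hb ⟨ht.1, ht.2.le⟩
  have hz : ∀ t, t ∉ Ioo a b → φ t = 0 ∧ deriv φ t = 0 := by
    intro t ht
    have : t ∉ tsupport φ := fun h => ht (hK h)
    refine ⟨image_eq_zero_of_notMem_tsupport this, ?_⟩
    by_contra h
    exact this (support_deriv_subset (f := φ) h)
  have hdc : Continuous (deriv φ) := h1.continuous_deriv (by simp)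
  have hd : ∀ t, HasDerivAt φ (deriv φ t) t := fun t =>
    (h1.differentiable (by simp)).differentiableAt.hasDerivAt
  have hF : ∀ t, φ t = φ 0 + ∫ r in (0 : ℝ)..t, deriv φ r := by
    intro t
    rw [intervalIntegral.integral_eq_sub_of_hasDerivAt (fun r _ => hd r)
      (hdc.intervalIntegrable _ _)]; ring
  have hdi : IntegrableOn (deriv φ) (Ioo 0 b) := by
    rw [← intervalIntegrable_iff_integrableOn_Ioo_of_le hb0.le]; exact hdc.intervalIntegrable _ _
  obtain ⟨i1, i2, e⟩ := ibp hb0.le hdi (fun t _ => hF t) (hg b hb)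
  have h0 : φ 0 = 0 := (hz 0 (by simp; intro; linarith)).1
  have hbz : φ b = 0 := (hz b (by simp)).1
  rw [hbz, zero_smul, ii_Ioo hb0.le, integral_add i1 i2] at e
  have hz' : ∀ t, t ∈ s \ Ioo 0 b → t ∉ Ioo a b := fun t ht h => ht.2 ⟨ha.trans h.1, h.2⟩
  rw [setIntegral_eq_of_subset_of_forall_sdiff_eq_zero (f := fun t => deriv φ t • u t)
      hs.isOpen.measurableSet hsub (fun t ht => by rw [(hz t (hz' t ht)).2, zero_smul]),
    setIntegral_eq_of_subset_of_forall_sdiff_eq_zero (f := fun t => φ t • g t)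
      hs.isOpen.measurableSet hsub (fun t ht => by rw [(hz t (hz' t ht)).1, zero_smul])]
  have : ∫ t in Ioo 0 b, deriv φ t • u t
      = ∫ t in Ioo 0 b, (deriv φ t • x + deriv φ t • ∫ r in (0 : ℝ)..t, g r) := by
    refine integral_congr_ae ?_
    filter_upwards [ae_restrict_of_ae_restrict_of_subset hsub hu] with t ht
    rw [ht, smul_add]
  rw [this, integral_add (hdi.smul_const x) i1, integral_smul_const, ← ii_Ioo hb0.le]
  have : ∫ r in (0 : ℝ)..b, deriv φ r = 0 := by
    have := hF b; rw [h0, hbz] at this; simpa using this.symm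
  rw [this, zero_smul, zero_add]
  exact eq_neg_of_add_eq_zero_left e.symm

/-- du Bois-Reymond -/
theorem dbr {s : Set ℝ} (hs : Ini s) {v : ℝ → E} (hv : LocallyIntegrableOn v s)
    (h : ∀ φ : ℝ → ℝ, ContDiff ℝ (⊤ : ℕ∞) φ → HasCompactSupport φ → tsupport φ ⊆ s →
      (∫ t in s, deriv φ t • v t) = 0) : ∃ c : E, ∀ᵐ t ∂(volume.restrict s), v t = c := by
  obtain ⟨x, hx⟩ := hs.nonempty
  obtain ⟨ε, hε, hball⟩ := Metric.isOpen_iff.1 hs.isOpen x hx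
  let B : ContDiffBump x := ⟨ε / 4, ε / 2, by linarith, by linarith⟩
  set ψ := B.normed volume with hψ
  have hψ1 : ContDiff ℝ (⊤ : ℕ∞) ψ := B.contDiff_normed
  have hψ2 : HasCompactSupport ψ := B.hasCompactSupport_normed
  have hψ3 : tsupport ψ ⊆ s := by
    rw [B.tsupport_normed_eq]
    exact (Metric.closedBall_subset_ball (by change ε / 2 < ε; linarith)).trans hball
  have hψ4 : ∫ t, ψ t = 1 := B.integral_normed
  have gen : ∀ χ : ℝ → ℝ, ContDiff ℝ (⊤ : ℕ∞) χ → HasCompactSupport χ → tsupport χ ⊆ s →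
      ∀ w : ℝ → E, LocallyIntegrableOn w s → Integrable (fun t => χ t • w t) ∧
      (∫ t, χ t • w t) = ∫ t in s, χ t • w t := by
    intro χ c1 c2 c3 w hw
    have hz : ∀ t, t ∉ tsupport χ → χ t • w t = 0 := fun t ht => by
      rw [image_eq_zero_of_notMem_tsupport ht, zero_smul]
    constructor
    · rw [← integrableOn_iff_integrable_of_support_subset (s := tsupport χ)
        (fun t ht => by by_contra h; exact ht (hz t h))]
      exact (hw.integrableOn_compact_subset c3 c2).continuousOn_smul
        c1.continuous.continuousOn c2
    · rw [setIntegral_eq_integral_of_forall_compl_eq_zero]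
      exact fun t ht => hz t (fun h => ht (c3 h))
  refine ⟨∫ t in s, ψ t • v t, ?_⟩
  set c := ∫ t in s, ψ t • v t with hc
  have hcl : LocallyIntegrableOn (fun _ : ℝ => c) s := (locallyIntegrable_const c).locallyIntegrableOn s
  have := hs.isOpen.ae_eq_zero_of_integral_contDiff_smul_eq_zero (μ := volume)
    (f := fun t => v t - c) (hv.sub hcl) ?_
  · rw [ae_restrict_iff' hs.isOpen.measurableSet]
    filter_upwards [this] with t ht hts
    exact sub_eq_zero.1 (ht hts)
  intro χ c1 c2 c3
  obtain ⟨a, b, ha, hab, hb, hK⟩ := hs.cpt (K := tsupport χ ∪ tsupport ψ) (c2.isCompact.union hψ2.isCompact) (union_subset c3 hψ3)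
  set d := ∫ t, χ t with hd
  have hcont : Continuous (fun t => χ t - d * ψ t) :=
    c1.continuous.sub (continuous_const.mul hψ1.continuous)
  set φ : ℝ → ℝ := fun t => ∫ r in a..t, (χ r - d * ψ r) with hφ
  have hder : ∀ t, HasDerivAt φ (χ t - d * ψ t) t := fun t =>
    intervalIntegral.integral_hasDerivAt_right (hcont.intervalIntegrable _ _)
      (hcont.stronglyMeasurableAtFilter _ _) hcont.continuousAt
  have hder' : deriv φ = fun t => χ t - d * ψ t := funext fun t => (hder t).deriv
  have hzero : ∀ t, t ∉ Ioo a b → χ t - d * ψ t = 0 := by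
    intro t ht
    rw [image_eq_zero_of_notMem_tsupport (f := χ) (fun h => ht (hK (Or.inl h))),
      image_eq_zero_of_notMem_tsupport (f := ψ) (fun h => ht (hK (Or.inr h)))]
    ring
  have hφs : ContDiff ℝ (⊤ : ℕ∞) φ := by
    rw [contDiff_infty_iff_deriv]
    refine ⟨fun t => (hder t).differentiableAt, ?_⟩
    rw [hder']
    exact c1.sub (contDiff_const.mul hψ1)
  have hint : Integrable (fun t => χ t - d * ψ t) :=
    (c1.continuous.integrable_of_hasCompactSupport c2).sub
      ((hψ1.continuous.integrable_of_hasCompactSupport hψ2).const_mul d)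
  have htot : φ b = 0 := by
    simp only [hφ]
    rw [intervalIntegral.integral_of_le hab.le, integral_Ioc_eq_integral_Ioo,
      setIntegral_eq_integral_of_forall_compl_eq_zero hzero,
      integral_sub (c1.continuous.integrable_of_hasCompactSupport c2)
      ((hψ1.continuous.integrable_of_hasCompactSupport hψ2).const_mul d), integral_const_mul, hψ4]
    simp [hd]
  have hφz : ∀ t, t ∉ Icc a b → φ t = 0 := by
    intro t ht
    by_cases h : t < a
    · simp only [hφ]
      rw [intervalIntegral.integral_congr (g := fun _ => (0 : ℝ)), intervalIntegral.integral_zero]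
      intro r hr
      rw [uIcc_of_ge h.le] at hr
      exact hzero r (fun h' => absurd hr.2 (not_le.2 h'.1))
    · have hbt : b < t := by
        by_contra h'; exact ht ⟨not_lt.1 h, not_lt.1 h'⟩
      have : φ t = φ b + ∫ r in b..t, (χ r - d * ψ r) := by
        simp only [hφ]
        rw [intervalIntegral.integral_add_adjacent_intervals] <;> exact hcont.intervalIntegrable _ _
      rw [this, htot, zero_add, intervalIntegral.integral_congr (g := fun _ => (0 : ℝ)),
        intervalIntegral.integral_zero]
      intro r hr
      rw [uIcc_of_le hbt.le] at hr
      exact hzero r (fun h' => absurd hr.1 (not_le.2 h'.2))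
  have hsup : tsupport φ ⊆ Icc a b :=
    closure_minimal (fun t ht => by by_contra h; exact ht (hφz t h)) isClosed_Icc
  have key := h φ hφs (HasCompactSupport.of_support_subset_isCompact isCompact_Icc
    (subset_closure.trans hsup)) (hsup.trans fun t ht => hs.down b hb ⟨ha.trans_le ht.1, ht.2⟩)
  obtain ⟨j1, k1⟩ := gen χ c1 c2 c3 v hv
  obtain ⟨j2, k2⟩ := gen ψ hψ1 hψ2 hψ3 v hv
  rw [hder'] at key
  have e : (fun t => (χ t - d * ψ t) • v t) = fun t => χ t • v t - d • (ψ t • v t) := by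
    ext t; rw [sub_smul, mul_smul]
  rw [e, integral_sub (g := fun t => d • (ψ t • v t)) j1.integrableOn (j2.integrableOn.smul d), integral_smul, ← k1, ← hc] at key
  have : ∫ t, χ t • (v t - c) = (∫ t, χ t • v t) - ∫ t, χ t • c := by
    simp_rw [smul_sub]
    exact integral_sub j1 ((c1.continuous.integrable_of_hasCompactSupport c2).smul_const c)
  rw [this, integral_smul_const]
  exact key

theorem locint_prim {s : Set ℝ} (hs : Ini s) {g : ℝ → E}
    (hg : ∀ t ∈ s, IntegrableOn g (Ioo 0 t)) : ContinuousOn (fun t => ∫ r in (0 : ℝ)..t, g r) (insert 0 s) := by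
  intro t ht
  have : ∃ b ∈ s, t < b := by
    rcases ht with rfl | ht
    · obtain ⟨b, hb⟩ := hs.nonempty; exact ⟨b, hb, hs.pos hb⟩
    · obtain ⟨a, b, ha, hab, hb, hK⟩ := hs.cpt (K := {t}) isCompact_singleton (by simpa using ht)
      exact ⟨b, hb, (hK rfl).2⟩
  obtain ⟨b, hb, htb⟩ := this
  have hb0 : 0 < b := hs.pos hb
  have ht0 : 0 ≤ t := by
    rcases ht with rfl | ht
    · rfl
    · exact (hs.pos ht).le
  refine ((cont_prim hb0.le (hg b hb)) t ⟨ht0, htb.le⟩).mono_of_mem_nhdsWithin ?_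
  refine mem_nhdsWithin.2 ⟨Iio b, isOpen_Iio, htb, ?_⟩
  rintro r ⟨h1, h2⟩
  refine ⟨?_, le_of_lt h1⟩
  rcases h2 with rfl | h2
  · rfl
  · exact (hs.pos h2).le

theorem locint_of {s : Set ℝ} (hs : Ini s) {g : ℝ → E}
    (hg : ∀ t ∈ s, IntegrableOn g (Ioo 0 t)) : LocallyIntegrableOn g s := by
  rw [locallyIntegrableOn_iff (hs.isOpen.isLocallyClosed)]
  intro K hK1 hK2
  obtain ⟨a, b, ha, hab, hb, hK⟩ := hs.cpt hK2 hK1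
  exact (hg b hb).mono_set (hK.trans (Ioo_subset_Ioo_left ha.le))

/-- weak derivative implies integral form -/
theorem int_of_weak {s : Set ℝ} (hs : Ini s) {u g : ℝ → E}
    (hu : LocallyIntegrableOn u s)
    (hg : ∀ t ∈ s, IntegrableOn g (Ioo 0 t))
    (h : ∀ φ : ℝ → ℝ, ContDiff ℝ (⊤ : ℕ∞) φ → HasCompactSupport φ → tsupport φ ⊆ s →
      (∫ t in s, deriv φ t • u t) = -∫ t in s, φ t • g t) :
    ∃ x, ∀ᵐ t ∂(volume.restrict s), u t = x + ∫ r in (0 : ℝ)..t, g r := by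
  set W : ℝ → E := fun t => ∫ r in (0 : ℝ)..t, g r with hW
  have hWl : LocallyIntegrableOn W s :=
    ((locint_prim hs hg).mono (subset_insert _ _)).locallyIntegrableOn hs.isOpen.measurableSet
  obtain ⟨c, hc⟩ := dbr hs (v := fun t => u t - W t) (hu.sub hWl) (by
    intro φ h1 h2 h3
    have e := weak_of_int hs (u := W) (x := 0) hg (by simp [hW]) φ h1 h2 h3
    have hd : ContDiff ℝ (⊤ : ℕ∞) (deriv φ) := (contDiff_infty_iff_deriv.1 h1).2
    have hi : ∀ w : ℝ → E, LocallyIntegrableOn w s → IntegrableOn (fun t => deriv φ t • w t) s := by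
      intro w hw
      have : Integrable (fun t => deriv φ t • w t) := by
        rw [← integrableOn_iff_integrable_of_support_subset (s := tsupport φ)]
        · exact (hw.integrableOn_compact_subset h3 h2).continuousOn_smul
            hd.continuous.continuousOn h2
        · intro t ht
          exact support_deriv_subset (f := φ) (fun h => ht (by simp [h]))
      exact this.integrableOn
    simp_rw [smul_sub]
    rw [integral_sub (hi u hu) (hi W hWl), h φ h1 h2 h3, e, sub_self])
  exact ⟨c, hc.mono fun t ht => by rw [← ht]; simp [hW]⟩

end PartTwo

section PartThree

open Filter Topology

variable {E : Type*} [NormedAddCommGroup E] [NormedSpace ℝ E] [CompleteSpace E]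
variable {E0 E1 : Type*} [NormedAddCommGroup E0] [NormedSpace ℝ E0] [CompleteSpace E0]
  [NormedAddCommGroup E1] [NormedSpace ℝ E1] [CompleteSpace E1]

variable {p α : ℝ} {s : Set ℝ}

theorem WM.intOn {f : ℝ → E} (hp : 1 < p) (hα : α < 1 - 1 / p) (hs : Ini s) (hf : WM p α s f)
    {t : ℝ} (ht : t ∈ s) : IntegrableOn f (Ioo 0 t) := by
  obtain ⟨c, hc, h⟩ := WM.holder (E := E) hp hα (hs.pos ht)
  exact (h f (hf.mono fun r hr => hs.down t ht ⟨hr.1, hr.2.le⟩)).1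

theorem prim_congr {f g : ℝ → E} (hs : Ini s) (h : ∀ᵐ t ∂(volume.restrict s), f t = g t)
    {t : ℝ} (ht : t ∈ s) : ∫ r in (0 : ℝ)..t, f r = ∫ r in (0 : ℝ)..t, g r := by
  rw [ii_Ioo (hs.pos ht).le, ii_Ioo (hs.pos ht).le]
  refine integral_congr_ae (ae_restrict_of_ae_restrict_of_subset ?_ h)
  exact fun r hr => hs.down t ht ⟨hr.1, hr.2.le⟩

def Sol (ι A : E1 →L[ℝ] E0) (s : Set ℝ) (f : ℝ → E0) (u : ℝ → E1) : Prop :=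
  ∀ᵐ t ∂(volume.restrict s), ι (u t) = ∫ r in (0 : ℝ)..t, (f r - A (u r))

variable {ι A : E1 →L[ℝ] E0} {f g : ℝ → E0} {u v : ℝ → E1}

theorem Sol.congr (hs : Ini s) (hf : ∀ᵐ t ∂(volume.restrict s), f t = g t)
    (hu : ∀ᵐ t ∂(volume.restrict s), u t = v t) (h : Sol ι A s f u) : Sol ι A s g v := by
  have e : ∀ᵐ t ∂(volume.restrict s), f t - A (u t) = g t - A (v t) := by
    filter_upwards [hf, hu] with t h1 h2; rw [h1, h2]
  filter_upwards [h, hu, ae_restrict_mem hs.isOpen.measurableSet] with t h1 h2 ht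
  rw [← h2, h1, prim_congr hs e ht]

theorem Sol.mono {s' : Set ℝ} (hs : s' ⊆ s) (h : Sol ι A s f u) : Sol ι A s' f u :=
  ae_restrict_of_ae_restrict_of_subset hs h

theorem Sol.sub (hp : 1 < p) (hα : α < 1 - 1 / p) (hs : Ini s) (hf : WM p α s f)
    (hu : WM p α s u) (hg : WM p α s g) (hv : WM p α s v)
    (h1 : Sol ι A s f u) (h2 : Sol ι A s g v) :
    Sol ι A s (fun t => f t - g t) (fun t => u t - v t) := by
  filter_upwards [h1, h2, ae_restrict_mem hs.isOpen.measurableSet] with t h1 h2 ht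
  rw [map_sub, h1, h2, ← intervalIntegral.integral_sub
    (ii_of_Ioo (hs.pos ht).le ((hf.sub (hu.clm A)).intOn hp hα hs ht))
    (ii_of_Ioo (hs.pos ht).le ((hg.sub (hv.clm A)).intOn hp hα hs ht))]
  congr 1; ext r; rw [map_sub]; abel

theorem Sol.add (hp : 1 < p) (hα : α < 1 - 1 / p) (hs : Ini s) (hf : WM p α s f)
    (hu : WM p α s u) (hg : WM p α s g) (hv : WM p α s v)
    (h1 : Sol ι A s f u) (h2 : Sol ι A s g v) :
    Sol ι A s (fun t => f t + g t) (fun t => u t + v t) := by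
  filter_upwards [h1, h2, ae_restrict_mem hs.isOpen.measurableSet] with t h1 h2 ht
  rw [map_add, h1, h2, ← intervalIntegral.integral_add
    (ii_of_Ioo (hs.pos ht).le ((hf.sub (hu.clm A)).intOn hp hα hs ht))
    (ii_of_Ioo (hs.pos ht).le ((hg.sub (hv.clm A)).intOn hp hα hs ht))]
  congr 1; ext r; rw [map_add]; abel

theorem Sol.smul (c : ℝ) (h1 : Sol ι A s f u) :
    Sol ι A s (fun t => c • f t) (fun t => c • u t) := by
  filter_upwards [h1] with t h1
  rw [map_smul, h1, ← intervalIntegral.integral_smul]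
  congr 1; ext r; rw [map_smul, smul_sub]

/-- convergence of primitives -/
theorem prim_tendsto {F : ℕ → ℝ → E} {G : ℝ → E} (hp : 1 < p) (hα : α < 1 - 1 / p) (hs : Ini s)
    (hF : ∀ n, WM p α s (F n)) (hG : WM p α s G)
    (h : Tendsto (fun n => WN p α s (fun t => F n t - G t)) atTop (𝓝 0)) {t : ℝ} (ht : t ∈ s) :
    Tendsto (fun n => ∫ r in (0 : ℝ)..t, F n r) atTop (𝓝 (∫ r in (0 : ℝ)..t, G r)) := by
  obtain ⟨c, hc, hh⟩ := WM.holder (E := E) hp hα (hs.pos ht)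
  have hsub : Ioo 0 t ⊆ s := fun r hr => hs.down t ht ⟨hr.1, hr.2.le⟩
  rw [tendsto_iff_norm_sub_tendsto_zero]
  refine squeeze_zero (fun _ => norm_nonneg _) (g := fun n => c * WN p α s (fun t => F n t - G t))
    (fun n => ?_) (by simpa using h.const_mul c)
  rw [← intervalIntegral.integral_sub
    (ii_of_Ioo (hs.pos ht).le ((hF n).intOn hp hα hs ht))
    (ii_of_Ioo (hs.pos ht).le (hG.intOn hp hα hs ht)), ii_Ioo (hs.pos ht).le]
  refine (norm_integral_le_integral_norm _).trans ?_
  refine ((hh _ (((hF n).sub hG).mono hsub)).2).trans ?_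
  gcongr
  exact WN_mono hsub ((hF n).sub hG)

theorem ae_subseq {F : ℕ → ℝ → E} {G : ℝ → E} (hp : 1 < p) (hs : Ini s)
    (hF : ∀ n, WM p α s (F n)) (hG : WM p α s G)
    (h : Tendsto (fun n => WN p α s (fun t => F n t - G t)) atTop (𝓝 0)) :
    ∃ ns : ℕ → ℕ, StrictMono ns ∧ ∀ᵐ t ∂(volume.restrict s),
      Tendsto (fun k => F (ns k) t) atTop (𝓝 (G t)) := by
  have h1 : TendstoInMeasure (volume.restrict s) (fun n (t : ℝ) => t ^ α • F n t) atTop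
      (fun t : ℝ => t ^ α • G t) := by
    refine tendstoInMeasure_of_tendsto_eLpNorm (p := ENNReal.ofReal p) (by simp; linarith)
      (fun n => (hF n).1) hG.1 ?_
    have h2 := ENNReal.tendsto_ofReal h
    rw [ENNReal.ofReal_zero] at h2
    refine h2.congr fun n => ?_
    unfold WN
    rw [ENNReal.ofReal_toReal ((hF n).sub hG).2.ne]
    congr 1
    ext t; simp [smul_sub]
  obtain ⟨ns, hns, h3⟩ := h1.exists_seq_tendsto_ae
  refine ⟨ns, hns, ?_⟩
  filter_upwards [h3, ae_restrict_mem hs.isOpen.measurableSet] with t h4 ht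
  have ht0 : 0 < t := hs.pos ht
  have := h4.const_smul (t ^ (-α))
  simpa [smul_smul, ← Real.rpow_add ht0] using this

theorem sol_limit {f' : ℕ → ℝ → E0} {u' : ℕ → ℝ → E1} (hp : 1 < p) (hα : α < 1 - 1 / p)
    (hs : Ini s) (hf' : ∀ n, WM p α s (f' n)) (hu' : ∀ n, WM p α s (u' n))
    (hf : WM p α s f) (hu : WM p α s u) (hS : ∀ n, Sol ι A s (f' n) (u' n))
    (h1 : Tendsto (fun n => WN p α s (fun t => f' n t - f t)) atTop (𝓝 0))
    (h2 : Tendsto (fun n => WN p α s (fun t => u' n t - u t)) atTop (𝓝 0)) : Sol ι A s f u := by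
  obtain ⟨ns, hns, h3⟩ := ae_subseq hp hs hu' hu h2
  have h4 : Tendsto (fun n => WN p α s (fun t => (f' n t - A (u' n t)) - (f t - A (u t))))
      atTop (𝓝 0) := by
    refine squeeze_zero (fun _ => WN_nonneg) (g := fun n => WN p α s (fun t => f' n t - f t) +
      ‖A‖ * WN p α s (fun t => u' n t - u t)) (fun n => ?_) (by simpa using h1.add (h2.const_mul ‖A‖))
    have e : (fun t => (f' n t - A (u' n t)) - (f t - A (u t)))
        = fun t => (f' n t - f t) - A (u' n t - u t) := by
      ext t; rw [map_sub]; abel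
    rw [e]
    refine (WN_sub_le hp ((hf' n).sub hf) (((hu' n).sub hu).clm A)).trans ?_
    gcongr
    exact WN_clm_le A ((hu' n).sub hu)
  filter_upwards [h3, ae_restrict_mem hs.isOpen.measurableSet, ae_all_iff.2 hS] with t h5 ht h6
  have l1 := (ι.continuous.tendsto _).comp h5
  have l2 := (prim_tendsto hp hα hs (fun n => (hf' n).sub ((hu' n).clm A)) (hf.sub (hu.clm A)) h4
    ht).comp hns.tendsto_atTop
  refine tendsto_nhds_unique l1 (l2.congr fun k => ?_)
  simp only [Function.comp_apply]
  exact (h6 (ns k)).symm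

theorem wm0_iff {f : ℝ → E} : WM p 0 s f ↔ MemLp f (ENNReal.ofReal p) (volume.restrict s) := by
  simp [WM]

theorem wn0_eq {f : ℝ → E} : WN p 0 s f =
    (eLpNorm f (ENNReal.ofReal p) (volume.restrict s)).toReal := by
  simp [WN]

theorem wn0_Lp (F G : Lp E (ENNReal.ofReal p) (volume.restrict s)) :
    WN p 0 s (fun t => F t - G t) = ‖F - G‖ := by
  rw [wn0_eq, Lp.norm_def]
  congr 1
  refine eLpNorm_congr_ae ?_
  filter_upwards [Lp.coeFn_sub F G] with t ht
  rw [ht]; rfl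

theorem closed_graph (hp : 1 < p)
    (hEx : ∀ f : ℝ → E0, WM p 0 (Ioi 0) f → ∃ u : ℝ → E1, WM p 0 (Ioi 0) u ∧ Sol ι A (Ioi 0) f u)
    (hUn : ∀ u : ℝ → E1, WM p 0 (Ioi 0) u → Sol ι A (Ioi 0) (fun _ => 0) u →
      ∀ᵐ t ∂(volume.restrict (Ioi 0)), u t = 0) :
    ∃ C : ℝ, 0 ≤ C ∧ ∀ (f : ℝ → E0) (u : ℝ → E1), WM p 0 (Ioi 0) f → WM p 0 (Ioi 0) u →
      Sol ι A (Ioi 0) f u → WN p 0 (Ioi 0) u ≤ C * WN p 0 (Ioi 0) f := by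
  have hα : (0 : ℝ) < 1 - 1 / p := by
    rw [sub_pos, div_lt_one (by linarith)]; exact hp
  haveI : Fact (1 ≤ ENNReal.ofReal p) := ⟨one_le_ofReal hp⟩
  let m := volume.restrict (Ioi (0 : ℝ))
  have wm0 : ∀ F : Lp E0 (ENNReal.ofReal p) m, WM p 0 (Ioi 0) F := fun F => wm0_iff.2 (Lp.memLp F)
  have wm1 : ∀ F : Lp E1 (ENNReal.ofReal p) m, WM p 0 (Ioi 0) F := fun F => wm0_iff.2 (Lp.memLp F)
  let G : Submodule ℝ (Lp E0 (ENNReal.ofReal p) m × Lp E1 (ENNReal.ofReal p) m) :=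
    { carrier := {z | Sol ι A (Ioi 0) z.1 z.2}
      add_mem' := by
        intro a b ha hb
        refine (Sol.add hp hα Ini.Ioi (wm0 _) (wm1 _) (wm0 _) (wm1 _) ha hb).congr Ini.Ioi ?_ ?_
        · exact (Lp.coeFn_add a.1 b.1).mono fun t ht => ht.symm
        · exact (Lp.coeFn_add a.2 b.2).mono fun t ht => ht.symm
      zero_mem' := by
        have : Sol ι A (Ioi 0) (fun _ => 0) (fun _ => 0) := by
          refine Eventually.of_forall fun t => by simp
        refine this.congr Ini.Ioi ?_ ?_
        · exact (Lp.coeFn_zero E0 (ENNReal.ofReal p) m).mono fun t ht => ht.symm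
        · exact (Lp.coeFn_zero E1 (ENNReal.ofReal p) m).mono fun t ht => ht.symm
      smul_mem' := by
        intro c a ha
        refine (Sol.smul c ha).congr Ini.Ioi ?_ ?_
        · exact (Lp.coeFn_smul c a.1).mono fun t ht => ht.symm
        · exact (Lp.coeFn_smul c a.2).mono fun t ht => ht.symm }
  have hG : IsClosed (G : Set (Lp E0 (ENNReal.ofReal p) m × Lp E1 (ENNReal.ofReal p) m)) := by
    refine IsSeqClosed.isClosed fun z w hz hzw => ?_
    refine sol_limit hp hα Ini.Ioi (f' := fun n => (z n).1) (u' := fun n => (z n).2)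
      (fun n => wm0 _) (fun n => wm1 _) (wm0 _) (wm1 _) hz ?_ ?_
    · simp_rw [wn0_Lp]
      exact tendsto_iff_norm_sub_tendsto_zero.1 ((continuous_fst.tendsto _).comp hzw)
    · simp_rw [wn0_Lp]
      exact tendsto_iff_norm_sub_tendsto_zero.1 ((continuous_snd.tendsto _).comp hzw)
  haveI : CompleteSpace G := hG.completeSpace_coe
  let P : G →L[ℝ] Lp E0 (ENNReal.ofReal p) m :=
    (ContinuousLinearMap.fst ℝ _ _).comp G.subtypeL
  have hinj : P.ker = ⊥ := by
    rw [LinearMap.ker_eq_bot']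
    rintro ⟨⟨F, U⟩, hz⟩ h
    have hF : F = 0 := h
    subst hF
    have h2 : Sol ι A (Ioi 0) (fun _ => 0) U :=
      Sol.congr Ini.Ioi (Lp.coeFn_zero E0 (ENNReal.ofReal p) m) (Eventually.of_forall fun _ => rfl) hz
    have h3 := hUn U (wm1 U) h2
    have h4 : U = 0 := by
      rw [Lp.eq_zero_iff_ae_eq_zero]; exact h3
    subst h4; rfl
  have hsurj : P.range = ⊤ := by
    rw [LinearMap.range_eq_top]
    intro F
    obtain ⟨u, hu, hS⟩ := hEx F (wm0 F)
    refine ⟨⟨⟨F, (wm0_iff.1 hu).toLp u⟩, ?_⟩, rfl⟩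
    exact hS.congr Ini.Ioi (Eventually.of_forall fun _ => rfl)
      ((MemLp.coeFn_toLp (wm0_iff.1 hu)).mono fun t ht => ht.symm)
  let e := ContinuousLinearEquiv.ofBijective P hinj hsurj
  refine ⟨‖(e.symm : Lp E0 (ENNReal.ofReal p) m →L[ℝ] G)‖, norm_nonneg _, fun f u hf hu hS => ?_⟩
  let z : G := ⟨((wm0_iff.1 hf).toLp f, (wm0_iff.1 hu).toLp u), hS.congr Ini.Ioi
      ((MemLp.coeFn_toLp (wm0_iff.1 hf)).mono fun t ht => ht.symm)
      ((MemLp.coeFn_toLp (wm0_iff.1 hu)).mono fun t ht => ht.symm)⟩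
  have h1 : e.symm ((wm0_iff.1 hf).toLp f) = z := by
    rw [ContinuousLinearEquiv.symm_apply_eq]; rfl
  have h2 := (e.symm : Lp E0 (ENNReal.ofReal p) m →L[ℝ] G).le_opNorm ((wm0_iff.1 hf).toLp f)
  rw [ContinuousLinearEquiv.coe_coe, h1, Lp.norm_toLp, ← wn0_eq] at h2
  refine le_trans ?_ h2
  have h3 : WN p 0 (Ioi 0) u = ‖(wm0_iff.1 hu).toLp u‖ := by rw [Lp.norm_toLp, wn0_eq]
  rw [h3]
  exact norm_snd_le z.1

end PartThree

section PartFour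

open Filter Topology

variable {E : Type*} [NormedAddCommGroup E] [NormedSpace ℝ E] [CompleteSpace E]
variable {E0 E1 : Type*} [NormedAddCommGroup E0] [NormedSpace ℝ E0] [CompleteSpace E0]
  [NormedAddCommGroup E1] [NormedSpace ℝ E1] [CompleteSpace E1]

variable {p α : ℝ} {s : Set ℝ}
variable {ι A : E1 →L[ℝ] E0} {f g : ℝ → E0} {u v : ℝ → E1}

structure MRh (p : ℝ) (ι A : E1 →L[ℝ] E0) : Prop where
  ex : ∀ f : ℝ → E0, WM p 0 (Ioi 0) f → ∃ u : ℝ → E1, WM p 0 (Ioi 0) u ∧ Sol ι A (Ioi 0) f u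
  un : ∀ u : ℝ → E1, WM p 0 (Ioi 0) u → Sol ι A (Ioi 0) (fun _ => 0) u →
      ∀ᵐ t ∂(volume.restrict (Ioi 0)), u t = 0

theorem mp_shift (a b : ℝ) : MeasurePreserving (fun t : ℝ => t + a) (volume.restrict (Ioi b))
    (volume.restrict (Ioi (b + a))) := by
  have := (measurePreserving_add_right (volume : Measure ℝ) a).restrict_preimage
    (s := Ioi (b + a)) measurableSet_Ioi
  have e : (fun t : ℝ => t + a) ⁻¹' Ioi (b + a) = Ioi b := by ext t; simp
  rwa [e] at this

theorem one_sub_pos' {p : ℝ} (hp : 1 < p) : (0 : ℝ) < 1 - 1 / p := by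
  rw [sub_pos, div_lt_one (by linarith)]; exact hp

theorem MRh.causal (hp : 1 < p) (H : MRh p ι A) {a : ℝ} (ha : 0 < a) (hf : WM p 0 (Ioi 0) f)
    (hu : WM p 0 (Ioi 0) u) (hS : Sol ι A (Ioi 0) f u)
    (hf0 : ∀ᵐ t ∂(volume.restrict (Ioo 0 a)), f t = 0) :
    ∀ᵐ t ∂(volume.restrict (Ioo 0 a)), u t = 0 := by
  have hg : WM p 0 (Ioi 0) (fun t => f (t + a)) := by
    rw [wm0_iff]
    have h1 : WM p 0 (Ioi (0 + a)) f := hf.mono (Ioi_subset_Ioi (by linarith))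
    exact (wm0_iff.1 h1).comp_measurePreserving (mp_shift a 0)
  obtain ⟨v, hv, hvS⟩ := H.ex _ hg
  have hsh := mp_shift (-a) a
  rw [add_neg_cancel] at hsh
  have hw : WM p 0 (Ioi 0) ((Ioi a).indicator (fun t => v (t + -a))) := by
    refine WM.indicator measurableSet_Ioi (Ioi_subset_Ioi ha.le) ?_
    rw [wm0_iff]
    exact (wm0_iff.1 hv).comp_measurePreserving hsh
  have hvS' := hsh.quasiMeasurePreserving.ae hvS
  rw [ae_restrict_iff' measurableSet_Ioi] at hvS'
  have hf0' : ∀ᵐ t, t ∈ Ioc 0 a → f t = 0 := by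
    rw [← ae_restrict_iff' measurableSet_Ioc, ← Measure.restrict_congr_set Ioo_ae_eq_Ioc]; exact hf0
  have hz : ∀ t, 0 < t → t ≤ a →
      ∫ r in (0 : ℝ)..t, (f r - A ((Ioi a).indicator (fun t => v (t + -a)) r)) = 0 := by
    intro t ht hta
    refine intervalIntegral.integral_zero_ae ?_
    filter_upwards [hf0'] with r hr hr'
    rw [uIoc_of_le ht.le] at hr'
    have h2 : r ∉ Ioi a := by simp; exact hr'.2.trans hta
    rw [hr ⟨hr'.1, hr'.2.trans hta⟩, indicator_of_notMem h2]; simp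
  have hSw : Sol ι A (Ioi 0) f ((Ioi a).indicator (fun t => v (t + -a))) := by
    unfold Sol
    rw [ae_restrict_iff' measurableSet_Ioi]
    filter_upwards [hvS'] with t ht ht0
    have ht0 : 0 < t := ht0
    rcases le_or_gt t a with hta | hta
    · rw [hz t ht0 hta]
      have h2 : t ∉ Ioi a := by simpa using hta
      rw [indicator_of_notMem h2]; simp
    · have i := hf.sub (hw.clm A)
      have i1 : ∀ t, 0 < t → IntervalIntegrable
        (fun r => f r - A ((Ioi a).indicator (fun t => v (t + -a)) r)) volume 0 t :=
        fun t ht => ii_of_Ioo ht.le (i.intOn hp (one_sub_pos' hp) Ini.Ioi ht)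
      have h3 := intervalIntegral.integral_add_adjacent_intervals (i1 a ha)
        ((i1 a ha).symm.trans (i1 t ht0))
      rw [← h3, hz a ha le_rfl, zero_add, indicator_of_mem (show t ∈ Ioi a from hta), ht hta]
      have h4 := intervalIntegral.integral_comp_add_right (a := a) (b := t)
        (fun r => f (r + a) - A (v r)) (-a)
      rw [add_neg_cancel] at h4
      rw [← h4]
      refine intervalIntegral.integral_congr_ae (Eventually.of_forall fun r hr => ?_)
      rw [uIoc_of_le hta.le] at hr
      rw [indicator_of_mem (show r ∈ Ioi a from hr.1)]
      simp
  have h5 := Sol.sub hp (one_sub_pos' hp) Ini.Ioi hf hu hf hw hS hSw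
  have h6 := H.un _ (hu.sub hw) (by simpa using h5)
  filter_upwards [ae_restrict_of_ae_restrict_of_subset (s := Ioo 0 a) Ioo_subset_Ioi_self h6,
    ae_restrict_mem measurableSet_Ioo] with t h7 ht
  rw [sub_eq_zero] at h7
  rw [h7, indicator_of_notMem]
  simpa using ht.2.le

theorem Sol.mulφ {φ φ' : ℝ → ℝ} (hs : Ini s) (hφ' : ∀ t ∈ s, IntegrableOn φ' (Ioo 0 t))
    (hφ : ∀ t ∈ insert 0 s, φ t = φ 0 + ∫ r in (0 : ℝ)..t, φ' r)
    (hi : ∀ t ∈ s, IntegrableOn (fun r => f r - A (u r)) (Ioo 0 t))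
    (h : Sol ι A s f u) :
    Sol ι A s (fun t => φ' t • ι (u t) + φ t • f t) (fun t => φ t • u t) := by
  filter_upwards [h, ae_restrict_mem hs.isOpen.measurableSet] with t ht hts
  have h1 := (ibp (hs.pos hts).le (hφ' t hts) (fun r hr => hφ r (by
    rcases hr.1.eq_or_lt with h0 | h0
    · left; exact h0.symm
    · right; exact hs.down t hts ⟨h0, hr.2⟩)) (hi t hts)).2.2
  rw [map_smul, ht, h1]
  refine prim_congr hs ?_ hts
  filter_upwards [h] with r hr
  rw [← hr, map_smul, smul_sub]; abel

theorem MRh.locun (hp : 1 < p) (H : MRh p ι A) {N : ℝ} (hN : 0 < N) (hu : WM p 0 (Ioo 0 N) u)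
    (hS : Sol ι A (Ioo 0 N) (fun _ => 0) u) :
    ∀ᵐ t ∂(volume.restrict (Ioo 0 N)), u t = 0 := by
  have hα := one_sub_pos' hp
  -- it suffices to treat (0, N - δ)
  suffices key : ∀ δ : ℝ, 0 < δ → δ < N → ∀ᵐ t ∂(volume.restrict (Ioo 0 (N - δ))), u t = 0 by
    have h1 : ∀ n : ℕ, ∀ᵐ t, t ∈ Ioo 0 (N - N / (n + 2)) → u t = 0 := by
      intro n
      rw [← ae_restrict_iff' measurableSet_Ioo]
      refine key _ (by positivity) (div_lt_self hN ?_)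
      have : (0 : ℝ) ≤ n := n.cast_nonneg
      linarith
    rw [ae_restrict_iff' measurableSet_Ioo]
    filter_upwards [ae_all_iff.2 h1] with t ht htN
    have : 0 < N - t := by linarith [htN.2]
    obtain ⟨n, hn⟩ := exists_nat_gt (N / (N - t))
    refine ht n ⟨htN.1, ?_⟩
    have h2 : N / (n + 2) < N - t := by
      rw [div_lt_iff₀ (by positivity)]
      rw [div_lt_iff₀ this] at hn
      nlinarith
    linarith
  intro δ hδ hδN
  set φ' : ℝ → ℝ := (Ioi (N - δ)).indicator (fun _ => - (1 / δ)) with hφ'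
  set φ : ℝ → ℝ := fun t => 1 - (max 0 (t - (N - δ))) / δ with hφ
  have hφ'i : ∀ t, 0 < t → IntegrableOn φ' (Ioo 0 t) := by
    intro t ht
    exact (integrable_const (μ := volume.restrict (Ioo 0 t)) (-(1 / δ))).indicator measurableSet_Ioi
  have hφ0 : φ 0 = 1 := by
    simp only [hφ]; rw [max_eq_left (by linarith)]; simp
  have hφe : ∀ t, 0 ≤ t → φ t = φ 0 + ∫ r in (0 : ℝ)..t, φ' r := by
    intro t ht
    rw [hφ0]
    rw [intervalIntegral.integral_of_le ht, hφ', integral_indicator measurableSet_Ioi,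
      Measure.restrict_restrict measurableSet_Ioi]
    simp only [integral_const, smul_eq_mul, hφ]
    rcases le_total t (N - δ) with h | h
    · have : Ioi (N - δ) ∩ Ioc 0 t = ∅ := by
        ext r; simp; intro h1 _; linarith
      rw [this, max_eq_left (by linarith)]; simp
    · have : Ioi (N - δ) ∩ Ioc 0 t = Ioc (N - δ) t := by
        ext r; simp; intro h1 h2; linarith
      rw [this, max_eq_right (by linarith)]
      simp only [measureReal_restrict_apply_univ, Real.volume_real_Ioc_of_le h]; ring
  have hφN : φ N = 0 := by
    simp only [hφ]; rw [max_eq_right (by linarith)]; field_simp; ring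
  have hφb : ∀ t, 0 ≤ t → t ≤ N → |φ t| ≤ 1 := by
    intro t ht htN
    have h1 : max 0 (t - (N - δ)) / δ ≤ 1 := by
      rw [div_le_one hδ]; exact max_le hδ.le (by linarith)
    have h2 : 0 ≤ max 0 (t - (N - δ)) / δ := div_nonneg (le_max_left _ _) hδ.le
    rw [abs_le]; simp only [hφ]; constructor <;> linarith
  have hsub : Ioo 0 N ⊆ Ioi (0 : ℝ) := Ioo_subset_Ioi_self
  have hs := Ini.Ioo hN
  have hum := hu.aesm measurableSet_Ioo hsub
  have hφm : AEStronglyMeasurable φ (volume.restrict (Ioo 0 N)) := by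
    apply Continuous.aestronglyMeasurable; fun_prop
  have hφ'm : AEStronglyMeasurable φ' (volume.restrict (Ioo 0 N)) := by
    exact aestronglyMeasurable_const.indicator measurableSet_Ioi
  have hv1 : WM p 0 (Ioo 0 N) (fun t => φ t • u t) := by
    refine hu.of_bound 1 (hφm.smul hum) ?_
    filter_upwards [ae_restrict_mem measurableSet_Ioo] with t ht
    rw [norm_smul]; gcongr; exact hφb t ht.1.le ht.2.le
  have hh1 : WM p 0 (Ioo 0 N) (fun t => φ' t • ι (u t)) := by
    refine (hu.clm ι).of_bound (1 / δ) (hφ'm.smul (ι.continuous.comp_aestronglyMeasurable hum)) ?_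
    refine Eventually.of_forall fun t => ?_
    rw [norm_smul]; gcongr
    simp only [hφ']
    by_cases ht : t ∈ Ioi (N - δ)
    · rw [indicator_of_mem ht]; simp [abs_of_pos hδ]
    · rw [indicator_of_notMem ht]; simp; positivity
  have hiA : IntegrableOn (fun t => (0 : E0) - A (u t)) (Ioo 0 N) :=
    ((WM.holder hp hα hN).choose_spec.2 _ (WM.zero.sub (hu.clm A))).1
  have hv := hv1.indicator measurableSet_Ioo hsub
  have hh := hh1.indicator measurableSet_Ioo hsub
  have hS1 : Sol ι A (Ioo 0 N) (fun t => φ' t • ι (u t)) (fun t => φ t • u t) := by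
    have := hS.mulφ (φ := φ) (φ' := φ') hs (fun t ht => hφ'i t ht.1) (fun t ht => hφe t (by
      rcases ht with rfl | ht
      · exact le_rfl
      · exact ht.1.le)) (fun t ht => hiA.mono_set (Ioo_subset_Ioo_right ht.2.le))
    simpa using this
  have hS2 : Sol ι A (Ioi 0) ((Ioo 0 N).indicator fun t => φ' t • ι (u t))
      ((Ioo 0 N).indicator fun t => φ t • u t) := by
    have hS3 := hS1.congr hs ((indicator_ae (s := Ioo 0 N) measurableSet_Ioo).mono fun t ht => ht.symm)
      ((indicator_ae (s := Ioo 0 N) measurableSet_Ioo).mono fun t ht => ht.symm)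
    unfold Sol at hS3 ⊢
    rw [ae_restrict_iff' measurableSet_Ioo] at hS3
    rw [ae_restrict_iff' measurableSet_Ioi]
    filter_upwards [hS3] with t ht ht0
    rcases lt_or_ge t N with h | h
    · exact ht ⟨ht0, h⟩
    · have hn : t ∉ Ioo 0 N := fun h' => absurd h'.2 (not_lt.2 h)
      rw [indicator_of_notMem hn, map_zero, ii_Ioo (le_of_lt ht0)]
      have e1 := (ibp hN.le (hφ'i N hN) (fun r hr => hφe r hr.1) hiA).2.2
      rw [hφN, zero_smul, ii_Ioo hN.le] at e1
      rw [e1]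
      have e2 : ∫ r in Ioo 0 t, (((Ioo 0 N).indicator fun t => φ' t • ι (u t)) r -
          A (((Ioo 0 N).indicator fun t => φ t • u t) r)) =
          ∫ r in Ioo 0 t, (Ioo 0 N).indicator
            (fun r => φ' r • ι (u r) - A (φ r • u r)) r := by
        congr 1; ext r
        by_cases hr : r ∈ Ioo 0 N <;> simp [hr]
      rw [e2, integral_indicator measurableSet_Ioo, Measure.restrict_restrict measurableSet_Ioo,
        inter_eq_self_of_subset_left (Ioo_subset_Ioo_right h)]
      refine integral_congr_ae ?_
      filter_upwards [hS] with r hr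
      rw [← hr, map_smul]; simp [sub_eq_add_neg]
  have h8 := H.causal hp (a := N - δ) (by linarith) hh hv hS2 (by
    filter_upwards [ae_restrict_mem measurableSet_Ioo] with t ht
    rw [indicator_of_mem (show t ∈ Ioo 0 N from ⟨ht.1, by linarith [ht.2]⟩)]
    have : t ∉ Ioi (N - δ) := by simpa using ht.2.le
    simp [hφ', this])
  filter_upwards [h8, ae_restrict_mem measurableSet_Ioo] with t h9 ht
  rw [indicator_of_mem (show t ∈ Ioo 0 N from ⟨ht.1, by linarith [ht.2]⟩)] at h9
  have : φ t = 1 := by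
    simp only [hφ]; rw [max_eq_left (by linarith [ht.2])]; simp
  simpa [this] using h9

theorem MRh.locbound (hp : 1 < p) (H : MRh p ι A) :
    ∃ C : ℝ, 0 ≤ C ∧ ∀ N : ℝ, 0 < N → ∀ (f : ℝ → E0) (u : ℝ → E1), WM p 0 (Ioo 0 N) f →
      WM p 0 (Ioo 0 N) u → Sol ι A (Ioo 0 N) f u →
      WN p 0 (Ioo 0 N) u ≤ C * WN p 0 (Ioo 0 N) f := by
  obtain ⟨C, hC, h⟩ := closed_graph hp H.ex H.un
  refine ⟨C, hC, fun N hN f u hf hu hS => ?_⟩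
  have hsub : Ioo 0 N ⊆ Ioi (0 : ℝ) := Ioo_subset_Ioi_self
  have hF := hf.indicator measurableSet_Ioo hsub
  obtain ⟨v, hv, hvS⟩ := H.ex _ hF
  have h1 := h _ v hF hv hvS
  rw [WN_indicator measurableSet_Ioo hsub] at h1
  have h2 : Sol ι A (Ioo 0 N) f v := (hvS.mono hsub).congr (Ini.Ioo hN)
    (indicator_ae measurableSet_Ioo) (Eventually.of_forall fun _ => rfl)
  have h3 := Sol.sub hp (one_sub_pos' hp) (Ini.Ioo hN) hf hu hf (hv.mono hsub) hS h2
  have h4 := H.locun hp hN (hu.sub (hv.mono hsub)) (by simpa using h3)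
  rw [WN_congr (g := v) (h4.mono fun t ht => sub_eq_zero.1 ht)]
  exact (WN_mono hsub hv).trans h1

/-- integrating a solution -/
theorem Sol.prim (hs : Ini s) (hu : ∀ t ∈ s, IntegrableOn u (Ioo 0 t))
    (hf : ∀ t ∈ s, IntegrableOn f (Ioo 0 t)) (h : Sol ι A s f u) {t : ℝ} (ht : t ∈ s) :
    ι (∫ r in (0 : ℝ)..t, u r) =
      ∫ r in (0 : ℝ)..t, ((∫ q in (0 : ℝ)..r, f q) - A (∫ q in (0 : ℝ)..r, u q)) := by
  have i1 := fun t ht => ii_of_Ioo (le_of_lt (hs.pos (a := t) ht)) (hu t ht)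
  have i2 := fun t ht => ii_of_Ioo (le_of_lt (hs.pos (a := t) ht)) (hf t ht)
  rw [← ι.intervalIntegral_comp_comm (i1 t ht)]
  refine prim_congr hs ?_ ht
  filter_upwards [h, ae_restrict_mem hs.isOpen.measurableSet] with r hr hrs
  rw [hr, ← A.intervalIntegral_comp_comm (i1 r hrs), intervalIntegral.integral_sub (i2 r hrs)]
  exact ii_of_Ioo (hs.pos hrs).le (A.integrable_comp (hu r hrs))

theorem ae_zero_of_prim {u : ℝ → E} (hs : Ini s) (hu : ∀ t ∈ s, IntegrableOn u (Ioo 0 t))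
    (h : ∀ᵐ t ∂(volume.restrict s), ∫ r in (0 : ℝ)..t, u r = 0) :
    ∀ᵐ t ∂(volume.restrict s), u t = 0 := by
  rw [ae_restrict_iff' hs.isOpen.measurableSet]
  refine hs.isOpen.ae_eq_zero_of_integral_contDiff_smul_eq_zero (locint_of hs hu) ?_
  intro φ h1 h2 h3
  have h4 := weak_of_int hs (u := fun _ => (0 : E)) (x := 0) hu
    (h.mono fun t ht => by rw [ht, add_zero]) φ h1 h2 h3
  simp only [smul_zero, integral_zero] at h4
  rw [← setIntegral_eq_integral_of_forall_compl_eq_zero (s := s), ← neg_eq_zero, ← h4]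
  intro t ht
  rw [image_eq_zero_of_notMem_tsupport (fun h' => ht (h3 h')), zero_smul]

theorem wm_of_cont {u : ℝ → E} {N : ℝ} (hu : ContinuousOn u (Icc 0 N)) :
    WM p 0 (Ioo 0 N) u := by
  rw [wm0_iff]
  obtain ⟨C, hC⟩ := isCompact_Icc.exists_bound_of_continuousOn hu
  refine MemLp.of_bound ((hu.mono Ioo_subset_Icc_self).aestronglyMeasurable measurableSet_Ioo) C ?_
  filter_upwards [ae_restrict_mem measurableSet_Ioo] with t ht
  exact hC t (Ioo_subset_Icc_self ht)

theorem MRh.wlocun (hp : 1 < p) (hα : α < 1 - 1 / p) (H : MRh p ι A) {N : ℝ} (hN : 0 < N)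
    (hu : WM p α (Ioo 0 N) u) (hS : Sol ι A (Ioo 0 N) (fun _ => 0) u) :
    ∀ᵐ t ∂(volume.restrict (Ioo 0 N)), u t = 0 := by
  have hs := Ini.Ioo hN
  have hi : IntegrableOn u (Ioo 0 N) := ((WM.holder hp hα hN).choose_spec.2 _ hu).1
  have hi' : ∀ t ∈ Ioo 0 N, IntegrableOn u (Ioo 0 t) :=
    fun t ht => hi.mono_set (Ioo_subset_Ioo_right ht.2.le)
  refine ae_zero_of_prim hs hi' ?_
  refine H.locun hp hN (wm_of_cont (cont_prim hN.le hi)) ?_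
  filter_upwards [ae_restrict_mem measurableSet_Ioo] with t ht
  have := hS.prim hs hi' (fun _ _ => integrableOn_zero) ht
  rw [this]; simp

end PartFour

section PartFive

open Filter Topology

variable {E E' : Type*} [NormedAddCommGroup E] [NormedSpace ℝ E] [CompleteSpace E]
  [NormedAddCommGroup E'] [NormedSpace ℝ E']
variable {E0 E1 : Type*} [NormedAddCommGroup E0] [NormedSpace ℝ E0] [CompleteSpace E0]
  [NormedAddCommGroup E1] [NormedSpace ℝ E1] [CompleteSpace E1]

variable {p α : ℝ} {s : Set ℝ}
variable {ι A : E1 →L[ℝ] E0} {f g : ℝ → E0} {u v : ℝ → E1}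

theorem tonelli_pow {c : ℝ} (hc : 0 < c) {Φ : ℝ → ENNReal}
    (hΦ : AEMeasurable Φ (volume.restrict (Ioi 0))) :
    ∫⁻ τ in Ioi (0 : ℝ), ENNReal.ofReal (τ ^ (-c - 1)) * ∫⁻ t in Ioo 0 τ, Φ t =
      ENNReal.ofReal (1 / c) * ∫⁻ t in Ioi (0 : ℝ), ENNReal.ofReal (t ^ (-c)) * Φ t := by
  set m := volume.restrict (Ioi (0 : ℝ)) with hm
  have e1 : ∀ τ ∈ Ioi (0 : ℝ), ENNReal.ofReal (τ ^ (-c - 1)) * ∫⁻ t in Ioo 0 τ, Φ t =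
      ∫⁻ t, ENNReal.ofReal (τ ^ (-c - 1)) * ((Iio τ).indicator Φ t) ∂m := by
    intro τ hτ
    rw [lintegral_const_mul' _ _ (by simp), lintegral_indicator measurableSet_Iio, hm,
      Measure.restrict_restrict measurableSet_Iio, inter_comm, Ioi_inter_Iio]
  rw [setLIntegral_congr_fun measurableSet_Ioi e1, ← hm, lintegral_lintegral_swap]
  · have e2 : ∀ t ∈ Ioi (0 : ℝ), ∫⁻ τ, ENNReal.ofReal (τ ^ (-c - 1)) * ((Iio τ).indicator Φ t) ∂m =
        ENNReal.ofReal (1 / c) * (ENNReal.ofReal (t ^ (-c)) * Φ t) := by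
      intro t ht
      have ht : 0 < t := ht
      have e3 : ∀ τ, ENNReal.ofReal (τ ^ (-c - 1)) * ((Iio τ).indicator Φ t) =
          (Ioi t).indicator (fun τ => ENNReal.ofReal (τ ^ (-c - 1)) * Φ t) τ := by
        intro τ
        by_cases h : t < τ
        · rw [indicator_of_mem (show t ∈ Iio τ from h), indicator_of_mem (show τ ∈ Ioi t from h)]
        · rw [indicator_of_notMem (show t ∉ Iio τ from h),
            indicator_of_notMem (show τ ∉ Ioi t from h), mul_zero]
      simp_rw [e3]
      rw [lintegral_indicator measurableSet_Ioi, hm, Measure.restrict_restrict measurableSet_Ioi,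
        inter_eq_self_of_subset_left (Ioi_subset_Ioi ht.le),
        lintegral_mul_const _ (by fun_prop), ← mul_assoc]
      congr 1
      rw [← ofReal_integral_eq_lintegral_ofReal, integral_Ioi_rpow_of_lt (by linarith) ht,
        ← ENNReal.ofReal_mul (by positivity)]
      · congr 1
        rw [show -c - 1 + 1 = -c by ring, neg_div_neg_eq]; ring
      · exact integrableOn_Ioi_rpow_of_lt (by linarith) ht
      · filter_upwards [ae_restrict_mem measurableSet_Ioi] with r hr
        have : 0 < r := lt_trans ht hr
        simp only [Pi.zero_apply]; positivity
    rw [hm, setLIntegral_congr_fun measurableSet_Ioi e2, lintegral_const_mul' _ _ (by simp)]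
  · have e4 : (Function.uncurry fun (τ t : ℝ) => ENNReal.ofReal (τ ^ (-c - 1)) * (Iio τ).indicator Φ t)
        = fun q : ℝ × ℝ => ENNReal.ofReal (q.1 ^ (-c - 1)) *
          ({q : ℝ × ℝ | q.2 < q.1}.indicator (fun q => Φ q.2) q) := by
      ext ⟨τ, t⟩
      simp only [Function.uncurry_apply_pair]
      congr 1
    rw [e4]
    refine AEMeasurable.mul (by fun_prop) ?_
    refine AEMeasurable.indicator ?_ (measurableSet_lt measurable_snd measurable_fst)
    exact hΦ.comp_snd

theorem hardy (hp : 1 < p) (hα : α < 1 - 1 / p) : ∃ c : ℝ, 0 ≤ c ∧ ∀ f : ℝ → E,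
    WM p α (Ioi 0) f → WM p (α - 1) (Ioi 0) (fun t => ∫ r in (0 : ℝ)..t, f r) ∧
      WN p (α - 1) (Ioi 0) (fun t => ∫ r in (0 : ℝ)..t, f r) ≤ c * WN p α (Ioi 0) f := by
  have hp0 : 0 < p := by linarith
  set b : ℝ := (α + (1 - 1 / p)) / 2 with hb
  have hb1 : b < 1 - 1 / p := by linarith
  have hb2 : 0 < (b - α) * p := mul_pos (by linarith) hp0
  obtain ⟨c, hc, h⟩ := holder_lint hp hb1
  refine ⟨(c * (1 / ((b - α) * p))) ^ (1 / p), by positivity, fun f hf => ?_⟩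
  have hm := hf.aesm measurableSet_Ioi subset_rfl
  have hi : ∀ t ∈ Ioi (0 : ℝ), IntegrableOn f (Ioo 0 t) :=
    fun t ht => hf.intOn hp hα Ini.Ioi ht
  refine WM_of_lintegral hp measurableSet_Ioi subset_rfl ?_ (mul_nonneg (by positivity) WN_nonneg) ?_
  · exact ((locint_prim Ini.Ioi hi).mono (subset_insert _ _)).aestronglyMeasurable measurableSet_Ioi
  calc ∫⁻ t in Ioi (0 : ℝ), ENNReal.ofReal (t ^ ((α - 1) * p)) * ‖∫ r in (0 : ℝ)..t, f r‖ₑ ^ p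
      ≤ ∫⁻ t in Ioi (0 : ℝ), ENNReal.ofReal c * (ENNReal.ofReal (t ^ (- ((b - α) * p) - 1)) *
        ∫⁻ r in Ioo 0 t, ENNReal.ofReal (r ^ (b * p)) * ‖f r‖ₑ ^ p) := by
        refine setLIntegral_mono' measurableSet_Ioi fun t ht => ?_
        have ht : 0 < t := ht
        have h1 : ‖∫ r in (0 : ℝ)..t, f r‖ₑ ^ p ≤ (∫⁻ r in Ioo 0 t, ‖f r‖ₑ) ^ p := by
          gcongr
          rw [ii_Ioo ht.le]
          exact enorm_integral_le_lintegral_enorm _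
        have h2 := h1.trans (h t ht (fun r => ‖f r‖ₑ)
          (hm.mono_measure (Measure.restrict_mono Ioo_subset_Ioi_self le_rfl)).enorm)
        calc _ ≤ ENNReal.ofReal (t ^ ((α - 1) * p)) * (ENNReal.ofReal (c * t ^ ((1 - 1 / p - b) * p)) *
                ∫⁻ r in Ioo 0 t, ENNReal.ofReal (r ^ (b * p)) * ‖f r‖ₑ ^ p) := by gcongr
          _ = _ := by
              rw [← mul_assoc, ← mul_assoc, ← ENNReal.ofReal_mul (by positivity),
                ← ENNReal.ofReal_mul hc]
              congr 2
              rw [mul_left_comm, ← Real.rpow_add ht]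
              congr 2
              field_simp
              ring
    _ = ENNReal.ofReal c * (ENNReal.ofReal (1 / ((b - α) * p)) *
        ∫⁻ t in Ioi (0 : ℝ), ENNReal.ofReal (t ^ (-((b - α) * p))) *
          (ENNReal.ofReal (t ^ (b * p)) * ‖f t‖ₑ ^ p)) := by
        rw [lintegral_const_mul' _ _ (by simp), tonelli_pow hb2]
        exact AEMeasurable.mul (by fun_prop) (hm.enorm.pow_const p)
    _ = ENNReal.ofReal c * (ENNReal.ofReal (1 / ((b - α) * p)) *
          ENNReal.ofReal (WN p α (Ioi 0) f ^ p)) := by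
        rw [WN_pow_eq hp measurableSet_Ioi subset_rfl hf]
        congr 2
        refine setLIntegral_congr_fun measurableSet_Ioi fun t ht => ?_
        have ht : 0 < t := ht
        rw [← mul_assoc, ← ENNReal.ofReal_mul (by positivity), ← Real.rpow_add ht]
        congr 3; ring
    _ ≤ _ := by
        rw [← ENNReal.ofReal_mul (by positivity), ← ENNReal.ofReal_mul hc]
        refine ENNReal.ofReal_le_ofReal (le_of_eq ?_)
        rw [Real.mul_rpow (by positivity) WN_nonneg, ← Real.rpow_mul (by positivity),
          one_div_mul_cancel hp0.ne', Real.rpow_one, mul_assoc]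

theorem decr_weight (hp : 1 < p) {β : ℝ} (hβ : β < 0) {D : ℝ} (hD : 0 ≤ D) {k : ℝ → E}
    {h : ℝ → E'} (hk : AEStronglyMeasurable k (volume.restrict (Ioi 0)))
    (hh : WM p β (Ioi 0) h)
    (hb : ∀ N : ℝ, 0 < N → WM p 0 (Ioo 0 N) k ∧ WM p 0 (Ioo 0 N) h ∧
      WN p 0 (Ioo 0 N) k ≤ D * WN p 0 (Ioo 0 N) h) :
    WM p β (Ioi 0) k ∧ WN p β (Ioi 0) k ≤ D * WN p β (Ioi 0) h := by
  have hp0 : 0 < p := by linarith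
  have hhm := hh.aesm measurableSet_Ioi subset_rfl
  refine WM_of_lintegral hp measurableSet_Ioi subset_rfl hk (mul_nonneg hD WN_nonneg) ?_
  rw [Real.mul_rpow hD WN_nonneg, ENNReal.ofReal_mul (by positivity),
    WN_pow_eq hp measurableSet_Ioi subset_rfl hh]
  have hc : 0 < -(β * p) := by nlinarith
  have t1 := tonelli_pow hc (hk.enorm.pow_const p)
  have t2 := tonelli_pow hc (hhm.enorm.pow_const p)
  simp only [neg_neg] at t1 t2
  have hne : ENNReal.ofReal (1 / -(β * p)) ≠ 0 := by
    simp only [ne_eq, ENNReal.ofReal_eq_zero, not_le]; positivity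
  rw [← ENNReal.mul_le_mul_iff_right hne ENNReal.ofReal_ne_top, ← t1, mul_left_comm, ← t2,
    ← lintegral_const_mul' _ _ ENNReal.ofReal_ne_top]
  refine setLIntegral_mono' measurableSet_Ioi fun N hN => ?_
  obtain ⟨a1, a2, a3⟩ := hb N hN
  have b1 := WN_pow_eq hp measurableSet_Ioo (fun t ht => ht.1) a1
  have b2 := WN_pow_eq hp measurableSet_Ioo (fun t ht => ht.1) a2
  simp only [zero_mul, Real.rpow_zero, ENNReal.ofReal_one, one_mul] at b1 b2
  rw [← b1, ← b2, mul_left_comm, ← ENNReal.ofReal_mul (p := D ^ p) (by positivity),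
    ← Real.mul_rpow hD WN_nonneg]
  gcongr
  exact WN_nonneg

theorem WM_Ioi_of_local (hp : 1 < p) {M : ℝ} (hM : 0 ≤ M) {k : ℝ → E}
    (hk : AEStronglyMeasurable k (volume.restrict (Ioi 0)))
    (hb : ∀ N : ℝ, 0 < N → WM p α (Ioo 0 N) k ∧ WN p α (Ioo 0 N) k ≤ M) :
    WM p α (Ioi 0) k ∧ WN p α (Ioi 0) k ≤ M := by
  have hp0 : 0 < p := by linarith
  refine WM_of_lintegral hp measurableSet_Ioi subset_rfl hk hM ?_
  have e : Ioi (0 : ℝ) = ⋃ n : ℕ, Ioo 0 ((n : ℝ) + 1) := by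
    ext t; simp only [mem_Ioi, mem_iUnion, mem_Ioo]
    constructor
    · intro ht; obtain ⟨n, hn⟩ := exists_nat_gt t; exact ⟨n, ht, by linarith⟩
    · rintro ⟨n, h, _⟩; exact h
  rw [e, setLIntegral_iUnion_of_directed]
  · refine iSup_le fun n => ?_
    obtain ⟨a1, a2⟩ := hb (n + 1) (by positivity)
    rw [← WN_pow_eq hp measurableSet_Ioo (fun t ht => ht.1) a1]
    gcongr
    exact WN_nonneg
  · refine Monotone.directed_le fun m n hmn => Ioo_subset_Ioo_right ?_
    have : (m : ℝ) ≤ n := by exact_mod_cast hmn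
    linarith

theorem WN_shift_weight (hs : MeasurableSet s) (hs0 : s ⊆ Ioi 0) {β : ℝ} {k : ℝ → E} :
    (WM p β s (fun t => t ^ α • k t) ↔ WM p (β + α) s k) ∧
      WN p β s (fun t => t ^ α • k t) = WN p (β + α) s k := by
  have e : (fun t : ℝ => t ^ β • (t ^ α • k t)) =ᵐ[volume.restrict s] fun t => t ^ (β + α) • k t := by
    filter_upwards [ae_restrict_mem hs] with t ht
    have : 0 < t := hs0 ht
    rw [smul_smul, ← Real.rpow_add this]
  unfold WM WN
  rw [memLp_congr_ae e, eLpNorm_congr_ae e]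
  simp

theorem MRh.weighted_aux (hp : 1 < p) (hα0 : 0 ≤ α) (hα : α < 1 - 1 / p) (H : MRh p ι A) :
    ∃ C : ℝ, 0 ≤ C ∧ ∀ (f : ℝ → E0) (u : ℝ → E1), WM p 0 (Ioi 0) f → WM p α (Ioi 0) f →
      WM p 0 (Ioi 0) u → Sol ι A (Ioi 0) f u →
      WM p α (Ioi 0) u ∧ WN p α (Ioi 0) u ≤ C * WN p α (Ioi 0) f := by
  obtain ⟨C, hC, hloc⟩ := H.locbound hp
  obtain ⟨c, hc, hh⟩ := hardy (E := E0) hp hα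
  have h0 := one_sub_pos' hp
  have hp1 : 0 < 1 / p := by positivity
  refine ⟨C * (α * ((1 + ‖A‖ * C) * c) + 1), by positivity, fun f u hf0 hf hu hS => ?_⟩
  set h : ℝ → E0 := fun t => ∫ r in (0 : ℝ)..t, f r with hhd
  set U : ℝ → E1 := fun t => ∫ r in (0 : ℝ)..t, u r with hUd
  have hfi : ∀ t ∈ Ioi (0 : ℝ), IntegrableOn f (Ioo 0 t) := fun t ht => hf0.intOn hp h0 Ini.Ioi ht
  have hui : ∀ t ∈ Ioi (0 : ℝ), IntegrableOn u (Ioo 0 t) := fun t ht => hu.intOn hp h0 Ini.Ioi ht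
  have hum := hu.aesm measurableSet_Ioi subset_rfl
  obtain ⟨hh1, hh2⟩ := hh f hf
  have hιu : ∀ᵐ t ∂(volume.restrict (Ioi 0)), ι (u t) = h t - A (U t) := by
    filter_upwards [hS, ae_restrict_mem measurableSet_Ioi] with t ht ht0
    have ht0' : (0 : ℝ) ≤ t := le_of_lt ht0
    rw [ht, intervalIntegral.integral_sub (ii_of_Ioo ht0' (hfi t ht0))
      (ii_of_Ioo ht0' (A.integrable_comp (hui t ht0))),
      A.intervalIntegral_comp_comm (ii_of_Ioo ht0' (hui t ht0))]
  have hw1 : WM p (α - 1) (Ioi 0) (fun t => ι (u t)) ∧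
      WN p (α - 1) (Ioi 0) (fun t => ι (u t)) ≤ (1 + ‖A‖ * C) * WN p (α - 1) (Ioi 0) h := by
    refine decr_weight hp (by linarith) (by positivity)
      (ι.continuous.comp_aestronglyMeasurable hum) hh1 fun N hN => ?_
    have hsub : Ioo 0 N ⊆ Ioi (0 : ℝ) := Ioo_subset_Ioi_self
    have k1 : WM p 0 (Ioo 0 N) h := wm_of_cont (cont_prim hN.le (hfi N hN))
    have k2 : WM p 0 (Ioo 0 N) U := wm_of_cont (cont_prim hN.le (hui N hN))
    refine ⟨(hu.mono hsub).clm ι, k1, ?_⟩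
    have k3 := hloc N hN h U k1 k2 (by
      filter_upwards [ae_restrict_mem measurableSet_Ioo] with t ht
      exact hS.prim Ini.Ioi hui hfi ht.1)
    rw [WN_congr (ae_restrict_of_ae_restrict_of_subset hsub hιu)]
    refine (WN_sub_le hp k1 (k2.clm A)).trans ?_
    have := (WN_clm_le A k2).trans (mul_le_mul_of_nonneg_left k3 (norm_nonneg A))
    linarith
  -- multiply by t^α
  have hφ' : ∀ t ∈ Ioi (0 : ℝ), IntegrableOn (fun r : ℝ => α * r ^ (α - 1)) (Ioo 0 t) := by
    intro t ht
    rcases hα0.eq_or_lt with h | h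
    · rw [← h]; simp
    · exact (((intervalIntegral.integrableOn_Ioo_rpow_iff ht).2 (by linarith))).const_mul α
  have hφ : ∀ t ∈ insert 0 (Ioi (0 : ℝ)), t ^ α = 0 ^ α + ∫ r in (0 : ℝ)..t, α * r ^ (α - 1) := by
    intro t ht
    rcases hα0.eq_or_lt with h | h
    · rw [← h]; simp
    · rw [intervalIntegral.integral_const_mul, integral_rpow (Or.inl (by linarith))]
      rw [sub_add_cancel, Real.zero_rpow h.ne']
      field_simp; ring
  have hS2 := hS.mulφ (φ := fun t => t ^ α) Ini.Ioi hφ' hφ (fun t ht =>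
    (hfi t ht).sub (A.integrable_comp (hui t ht)))
  have q1 : WM p 0 (Ioi 0) (fun t : ℝ => t ^ α • f t) := by
    rw [(WN_shift_weight measurableSet_Ioi subset_rfl).1, zero_add]; exact hf
  have q2 : WM p 0 (Ioi 0) (fun t : ℝ => t ^ (α - 1) • ι (u t)) := by
    rw [(WN_shift_weight measurableSet_Ioi subset_rfl).1, zero_add]; exact hw1.1
  have q3 : WM p 0 (Ioi 0) (fun t : ℝ => (α * t ^ (α - 1)) • ι (u t)) := by
    have := q2.clm (α • ContinuousLinearMap.id ℝ E0)
    simpa [smul_smul, mul_comm] using this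
  have q4 : WN p 0 (Ioi 0) (fun t : ℝ => (α * t ^ (α - 1)) • ι (u t)) ≤
      α * ((1 + ‖A‖ * C) * (c * WN p α (Ioi 0) f)) := by
    refine (WN_le_of_bound q2 α hα0 (Eventually.of_forall fun t => ?_)).trans ?_
    · rw [mul_smul, norm_smul, Real.norm_of_nonneg hα0]
    · rw [(WN_shift_weight measurableSet_Ioi subset_rfl).2, zero_add]
      gcongr
      exact hw1.2.trans (by gcongr)
  have q5 := q3.add q1
  have q6 : WN p 0 (Ioi 0) (fun t : ℝ => (α * t ^ (α - 1)) • ι (u t) + t ^ α • f t) ≤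
      (α * ((1 + ‖A‖ * C) * c) + 1) * WN p α (Ioi 0) f := by
    refine (WN_add_le hp q3 q1).trans ?_
    rw [(WN_shift_weight (k := f) measurableSet_Ioi subset_rfl).2, zero_add]
    linarith
  refine WM_Ioi_of_local hp (mul_nonneg (by positivity) WN_nonneg) hum fun N hN => ?_
  have hsub : Ioo 0 N ⊆ Ioi (0 : ℝ) := Ioo_subset_Ioi_self
  have r1 : WM p 0 (Ioo 0 N) (fun t : ℝ => t ^ α • u t) := by
    refine (hu.mono hsub).of_bound (N ^ α) ?_ ?_
    · exact (meas_pow α).aestronglyMeasurable.smul ((hu.mono hsub).aesm measurableSet_Ioo hsub)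
    · filter_upwards [ae_restrict_mem measurableSet_Ioo] with t ht
      rw [norm_smul, Real.norm_of_nonneg (Real.rpow_nonneg ht.1.le _)]
      gcongr
      · exact ht.1.le
      · exact ht.2.le
  have r2 := hloc N hN _ _ (q5.mono hsub) r1 (hS2.mono hsub)
  rw [(WN_shift_weight (k := u) measurableSet_Ioo hsub).2, zero_add] at r2
  rw [(WN_shift_weight measurableSet_Ioo hsub).1, zero_add] at r1
  refine ⟨r1, r2.trans ?_⟩
  rw [mul_assoc]
  gcongr
  exact (WN_mono hsub q5).trans q6

theorem WN_dct (hp : 1 < p) {κ : Type*} {l : Filter κ} [l.IsCountablyGenerated]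
    {F : κ → ℝ → E} {g : ℝ → E'} (hs : MeasurableSet s) (hs0 : s ⊆ Ioi 0)
    (hF : ∀ᶠ n in l, AEStronglyMeasurable (F n) (volume.restrict s)) (hg : WM p α s g)
    (hb : ∀ᶠ n in l, ∀ᵐ t ∂(volume.restrict s), ‖F n t‖ ≤ ‖g t‖)
    (h : ∀ᵐ t ∂(volume.restrict s), Tendsto (fun n => F n t) l (𝓝 0)) :
    Tendsto (fun n => WN p α s (F n)) l (𝓝 0) := by
  have hp0 : 0 < p := by linarith
  have h1 : Tendsto (fun n => ∫⁻ t in s, ENNReal.ofReal (t ^ (α * p)) * ‖F n t‖ₑ ^ p) l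
      (𝓝 (∫⁻ t in s, 0)) := by
    refine tendsto_lintegral_filter_of_dominated_convergence'
      (fun t => ENNReal.ofReal (t ^ (α * p)) * ‖g t‖ₑ ^ p) ?_ ?_ ?_ ?_
    · filter_upwards [hF] with n hn
      exact AEMeasurable.mul (by fun_prop) (hn.enorm.pow_const p)
    · filter_upwards [hb] with n hn
      filter_upwards [hn] with t ht
      gcongr
      exact enorm_le_iff_norm_le.2 ht
    · rw [← WN_pow_eq hp hs hs0 hg]; simp
    · filter_upwards [h] with t ht
      have h2 : Tendsto (fun n => ‖F n t‖ₑ ^ p) l (𝓝 0) := by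
        have := (ENNReal.continuous_rpow_const (y := p)).tendsto (0 : ENNReal)
        rw [ENNReal.zero_rpow_of_pos hp0] at this
        refine this.comp ?_
        have := ht.enorm
        simpa using this
      have := ENNReal.Tendsto.const_mul (a := ENNReal.ofReal (t ^ (α * p))) h2 (Or.inr (by simp))
      simpa using this
  rw [lintegral_zero] at h1
  have h3 : Tendsto (fun n => (∫⁻ t in s, ENNReal.ofReal (t ^ (α * p)) * ‖F n t‖ₑ ^ p) ^ (1 / p)) l
      (𝓝 0) := by
    have := (ENNReal.continuous_rpow_const (y := 1 / p)).tendsto (0 : ENNReal)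
    rw [ENNReal.zero_rpow_of_pos (by positivity)] at this
    exact this.comp h1
  have h4 := (ENNReal.tendsto_toReal (ENNReal.zero_ne_top)).comp h3
  refine h4.congr fun n => ?_
  simp only [Function.comp_apply]
  rw [← eLpNorm_pow_eq hp hs hs0, ← ENNReal.rpow_mul, mul_one_div_cancel hp0.ne', ENNReal.rpow_one]
  rfl

theorem WN_complete (hp : 1 < p) (hs : MeasurableSet s) (hs0 : s ⊆ Ioi 0) {F : ℕ → ℝ → E}
    (hF : ∀ n, WM p α s (F n)) {b : ℕ → ℝ} (hb : Tendsto b atTop (𝓝 0))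
    (h : ∀ n m, WN p α s (fun t => F n t - F m t) ≤ b n + b m) :
    ∃ G : ℝ → E, WM p α s G ∧ Tendsto (fun n => WN p α s (fun t => F n t - G t)) atTop (𝓝 0) := by
  haveI : Fact (1 ≤ ENNReal.ofReal p) := ⟨one_le_ofReal hp⟩
  let Z : ℕ → Lp E (ENNReal.ofReal p) (volume.restrict s) := fun n => MemLp.toLp _ (hF n)
  have hd : ∀ n (W : ℝ → E) (hW : WM p α s W),
      ‖Z n - MemLp.toLp _ hW‖ = WN p α s (fun t => F n t - W t) := by
    intro n W hW
    have e1 : Z n - MemLp.toLp _ hW = MemLp.toLp _ (MemLp.sub (hF n) hW) :=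
      (MemLp.toLp_sub _ _).symm
    rw [e1, Lp.norm_toLp]
    unfold WN
    congr 2; ext t; simp [smul_sub]
  have hc : CauchySeq Z := by
    rw [Metric.cauchySeq_iff]
    intro ε hε
    obtain ⟨N, hN⟩ := eventually_atTop.1 (hb.eventually (gt_mem_nhds (half_pos hε)))
    refine ⟨N, fun m hm n hn => ?_⟩
    rw [dist_eq_norm, hd m _ (hF n)]
    have := h m n
    linarith [hN m hm, hN n hn]
  obtain ⟨z, hz⟩ := cauchySeq_tendsto_of_complete hc
  have hae : (fun t : ℝ => t ^ α • (t ^ (-α) • z t)) =ᵐ[volume.restrict s] z := by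
    filter_upwards [ae_restrict_mem hs] with t ht
    have : 0 < t := hs0 ht
    rw [smul_smul, ← Real.rpow_add this]; simp
  have hG : WM p α s (fun t => t ^ (-α) • z t) := (memLp_congr_ae hae).2 (Lp.memLp z)
  refine ⟨_, hG, ?_⟩
  have e : MemLp.toLp _ hG = z := by
    have e2 := (MemLp.toLp_eq_toLp_iff hG (Lp.memLp z)).2 hae
    rwa [Lp.toLp_coeFn] at e2
  have := tendsto_iff_norm_sub_tendsto_zero.1 hz
  refine this.congr fun n => ?_
  rw [← hd n _ hG, e]

theorem MRh.weighted (hp : 1 < p) (hα0 : 0 ≤ α) (hα : α < 1 - 1 / p) (H : MRh p ι A) :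
    ∃ C : ℝ, 0 ≤ C ∧ ∀ f : ℝ → E0, WM p α (Ioi 0) f → ∃ u : ℝ → E1,
      WM p α (Ioi 0) u ∧ Sol ι A (Ioi 0) f u ∧ WN p α (Ioi 0) u ≤ C * WN p α (Ioi 0) f := by
  obtain ⟨C, hC, hb⟩ := H.weighted_aux hp hα0 hα
  have h0 := one_sub_pos' hp
  refine ⟨C, hC, fun f hf => ?_⟩
  have hfm := hf.aesm measurableSet_Ioi subset_rfl
  let J : ℕ → Set ℝ := fun n => Ioo (1 / ((n : ℝ) + 1)) ((n : ℝ) + 1)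
  have hJ : ∀ n, J n ⊆ Ioi 0 := fun n t ht => lt_trans (by positivity) ht.1
  let fn : ℕ → ℝ → E0 := fun n => (J n).indicator f
  have f1 : ∀ n, WM p α (Ioi 0) (fn n) := fun n =>
    (hf.mono (hJ n)).indicator measurableSet_Ioo (hJ n)
  have f0 : ∀ n, WM p 0 (Ioi 0) (fn n) := by
    intro n
    refine WM.indicator measurableSet_Ioo (hJ n) ?_
    have e := (WN_shift_weight (p := p) (α := α) (β := 0) (k := f) (measurableSet_Ioo : MeasurableSet (J n))
      (hJ n)).1
    rw [zero_add] at e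
    refine (e.2 (hf.mono (hJ n))).of_bound ((1 / ((n : ℝ) + 1)) ^ (-α))
      (hfm.mono_measure (Measure.restrict_mono (hJ n) le_rfl)) ?_
    filter_upwards [ae_restrict_mem measurableSet_Ioo] with t ht
    have ht0 : 0 < t := hJ n ht
    rw [norm_smul, Real.norm_of_nonneg (by positivity), ← mul_assoc]
    refine le_mul_of_one_le_left (norm_nonneg _) ?_
    have : (1 / ((n : ℝ) + 1)) ^ α ≤ t ^ α := by
      gcongr; exact ht.1.le
    calc (1 : ℝ) = (1 / ((n : ℝ) + 1)) ^ (-α) * (1 / ((n : ℝ) + 1)) ^ α := by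
          rw [← Real.rpow_add (by positivity)]; simp
      _ ≤ _ := by gcongr
  have hlim : Tendsto (fun n => WN p α (Ioi 0) (fun t => fn n t - f t)) atTop (𝓝 0) := by
    refine WN_dct hp measurableSet_Ioi subset_rfl (g := f) (Eventually.of_forall fun n => ?_) hf
      (Eventually.of_forall fun n => Eventually.of_forall fun t => ?_) ?_
    · exact (hfm.indicator measurableSet_Ioo).sub hfm
    · by_cases ht : t ∈ J n <;> simp [fn, ht]
    · filter_upwards [ae_restrict_mem measurableSet_Ioi] with t ht
      have ht : 0 < t := ht
      refine tendsto_const_nhds.congr' ?_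
      obtain ⟨N, hN⟩ := exists_nat_gt (max t (1 / t))
      filter_upwards [eventually_ge_atTop N] with n hn
      have hn' : (N : ℝ) ≤ n := by exact_mod_cast hn
      have h1 : t < (n : ℝ) + 1 := by linarith [le_max_left t (1 / t)]
      have h2 : 1 / t < (n : ℝ) + 1 := by linarith [le_max_right t (1 / t)]
      have : t ∈ J n := ⟨(one_div_lt ht (by positivity)).1 h2, h1⟩
      simp [fn, this]
  choose un u0 uS using fun n => H.ex (fn n) (f0 n)
  have ub := fun n => hb (fn n) (un n) (f0 n) (f1 n) (u0 n) (uS n)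
  have ud := fun n m => hb _ _ ((f0 n).sub (f0 m)) ((f1 n).sub (f1 m)) ((u0 n).sub (u0 m))
    (Sol.sub hp h0 Ini.Ioi (f0 n) (u0 n) (f0 m) (u0 m) (uS n) (uS m))
  obtain ⟨u, hu, hul⟩ := WN_complete hp measurableSet_Ioi subset_rfl (fun n => (ub n).1)
    (b := fun n => C * WN p α (Ioi 0) (fun t => fn n t - f t)) (by simpa using hlim.const_mul C) (by
      intro n m
      refine (ud n m).2.trans ?_
      rw [← mul_add]
      gcongr
      have e : (fun t => fn n t - fn m t) = fun t => (fn n t - f t) - (fn m t - f t) := by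
        ext t; abel
      rw [e]
      exact WN_sub_le hp ((f1 n).sub hf) ((f1 m).sub hf))
  refine ⟨u, hu, sol_limit hp hα Ini.Ioi f1 (fun n => (ub n).1) hf hu uS hlim hul, ?_⟩
  have b1 : ∀ n, WN p α (Ioi 0) u ≤ C * (WN p α (Ioi 0) f + WN p α (Ioi 0) (fun t => fn n t - f t))
      + WN p α (Ioi 0) (fun t => un n t - u t) := by
    intro n
    have e1 : u = fun t => un n t - (un n t - u t) := by ext t; abel
    have e2 : fn n = fun t => f t + (fn n t - f t) := by ext t; abel
    calc WN p α (Ioi 0) u ≤ WN p α (Ioi 0) (un n) + WN p α (Ioi 0) (fun t => un n t - u t) := by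
          conv_lhs => rw [e1]
          exact WN_sub_le hp (ub n).1 ((ub n).1.sub hu)
      _ ≤ C * WN p α (Ioi 0) (fn n) + _ := by gcongr; exact (ub n).2
      _ ≤ _ := by
        gcongr
        conv_lhs => rw [e2]
        exact WN_add_le hp hf ((f1 n).sub hf)
  have l := ((hlim.const_add (WN p α (Ioi 0) f)).const_mul C).add hul
  simp only [add_zero] at l
  exact ge_of_tendsto' l b1

end PartFive

section PartSix

open Filter Topology

variable {E E' : Type*} [NormedAddCommGroup E] [NormedSpace ℝ E] [CompleteSpace E]
  [NormedAddCommGroup E'] [NormedSpace ℝ E']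
variable {E0 E1 : Type*} [NormedAddCommGroup E0] [NormedSpace ℝ E0] [CompleteSpace E0]
  [NormedAddCommGroup E1] [NormedSpace ℝ E1] [CompleteSpace E1]

variable {p α : ℝ} {s : Set ℝ}
variable {ι A : E1 →L[ℝ] E0} {f g : ℝ → E0} {u v : ℝ → E1} {u' v' : ℝ → E0} {x y : E0}

structure TRep (p α : ℝ) (s : Set ℝ) (ι : E1 →L[ℝ] E0) (x : E0) (u : ℝ → E1) (u' : ℝ → E0) :
    Prop where
  wm : WM p α s u
  wm' : WM p α s u'
  eq : ∀ᵐ t ∂(volume.restrict s), ι (u t) = x + ∫ r in (0 : ℝ)..t, u' r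

def en (p α : ℝ) (s : Set ℝ) (u : ℝ → E1) (u' : ℝ → E0) : ℝ :=
  (WN p α s u ^ p + WN p α s u' ^ p) ^ (1 / p)

def InT (p α : ℝ) (ι : E1 →L[ℝ] E0) (x : E0) : Prop := ∃ u u', TRep p α (Ioi 0) ι x u u'

def tn (p α : ℝ) (ι : E1 →L[ℝ] E0) (x : E0) : ℝ :=
  sInf {r : ℝ | ∃ u u', TRep p α (Ioi 0) ι x u u' ∧ r = en p α (Ioi 0) u u'}

theorem en_nonneg : 0 ≤ en p α s u u' :=
  Real.rpow_nonneg (add_nonneg (Real.rpow_nonneg WN_nonneg _) (Real.rpow_nonneg WN_nonneg _)) _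

theorem lp2 (hp : 1 < p) {a b c d : ℝ} (ha : 0 ≤ a) (hb : 0 ≤ b) (hc : 0 ≤ c) (hd : 0 ≤ d) :
    ((a + c) ^ p + (b + d) ^ p) ^ (1 / p) ≤ (a ^ p + b ^ p) ^ (1 / p) + (c ^ p + d ^ p) ^ (1 / p) := by
  have := Real.Lp_add_le_of_nonneg (s := Finset.univ) (f := ![a, b]) (g := ![c, d]) hp.le
    (by intro i _; fin_cases i <;> simpa) (by intro i _; fin_cases i <;> simpa)
  simpa [Fin.sum_univ_two] using this

theorem en_le (hp : 1 < p) : en p α s u u' ≤ WN p α s u + WN p α s u' := by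
  have hp0 : 0 < p := by linarith
  have := lp2 hp (a := WN p α s u) (b := 0) (c := 0) (d := WN p α s u') WN_nonneg le_rfl le_rfl WN_nonneg
  rw [Real.zero_rpow hp0.ne', add_zero, zero_add, add_zero, zero_add,
    ← Real.rpow_mul WN_nonneg, ← Real.rpow_mul WN_nonneg, mul_one_div_cancel hp0.ne',
    Real.rpow_one, Real.rpow_one] at this
  exact this

theorem le_en (hp : 1 < p) : WN p α s u ≤ en p α s u u' := by
  have hp0 : 0 < p := by linarith
  calc WN p α s u = (WN p α s u ^ p) ^ (1 / p) := by
        rw [← Real.rpow_mul WN_nonneg, mul_one_div_cancel hp0.ne', Real.rpow_one]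
    _ ≤ _ := by
        unfold en
        have := Real.rpow_nonneg (x := WN p α s u') WN_nonneg p
        have := Real.rpow_nonneg (x := WN p α s u) WN_nonneg p
        gcongr
        linarith

theorem le_en' (hp : 1 < p) : WN p α s u' ≤ en p α s u u' := by
  have hp0 : 0 < p := by linarith
  calc WN p α s u' = (WN p α s u' ^ p) ^ (1 / p) := by
        rw [← Real.rpow_mul WN_nonneg, mul_one_div_cancel hp0.ne', Real.rpow_one]
    _ ≤ _ := by
        unfold en
        have := Real.rpow_nonneg (x := WN p α s u') WN_nonneg p
        have := Real.rpow_nonneg (x := WN p α s u) WN_nonneg p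
        gcongr
        linarith

theorem en_mono_of (hp : 1 < p) {a b : ℝ} (ha : WN p α s u ≤ a) (hb : WN p α s u' ≤ b) :
    en p α s u u' ≤ (a ^ p + b ^ p) ^ (1 / p) := by
  have hp0 : 0 < p := by linarith
  have ha0 : 0 ≤ a := WN_nonneg.trans ha
  have hb0 : 0 ≤ b := WN_nonneg.trans hb
  have h1 := WN_nonneg (p := p) (α := α) (s := s) (f := u)
  have h2 := WN_nonneg (p := p) (α := α) (s := s) (f := u')
  unfold en
  gcongr

theorem en_add (hp : 1 < p) (hu : WM p α s u) (hu' : WM p α s u') (hv : WM p α s v)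
    (hv' : WM p α s v') :
    en p α s (fun t => u t + v t) (fun t => u' t + v' t) ≤ en p α s u u' + en p α s v v' :=
  (en_mono_of hp (WN_add_le hp hu hv) (WN_add_le hp hu' hv')).trans
    (lp2 hp WN_nonneg WN_nonneg WN_nonneg WN_nonneg)

theorem en_neg : en p α s (fun t => - u t) (fun t => - u' t) = en p α s u u' := by
  unfold en; rw [WN_neg, WN_neg]

theorem TRep.mono {s' : Set ℝ} (h : s' ⊆ s) (H : TRep p α s ι x u u') : TRep p α s' ι x u u' :=
  ⟨H.wm.mono h, H.wm'.mono h, ae_restrict_of_ae_restrict_of_subset h H.eq⟩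

theorem TRep.add (hp : 1 < p) (hα : α < 1 - 1 / p) (hs : Ini s) (H : TRep p α s ι x u u')
    (H' : TRep p α s ι y v v') :
    TRep p α s ι (x + y) (fun t => u t + v t) (fun t => u' t + v' t) := by
  refine ⟨H.wm.add H'.wm, H.wm'.add H'.wm', ?_⟩
  filter_upwards [H.eq, H'.eq, ae_restrict_mem hs.isOpen.measurableSet] with t h1 h2 ht
  rw [map_add, h1, h2, intervalIntegral.integral_add
    (ii_of_Ioo (hs.pos ht).le (H.wm'.intOn hp hα hs ht))
    (ii_of_Ioo (hs.pos ht).le (H'.wm'.intOn hp hα hs ht))]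
  abel

theorem TRep.neg (H : TRep p α s ι x u u') :
    TRep p α s ι (-x) (fun t => - u t) (fun t => - u' t) := by
  refine ⟨H.wm.neg, H.wm'.neg, ?_⟩
  filter_upwards [H.eq] with t h1
  rw [map_neg, h1, intervalIntegral.integral_neg]; abel

theorem TRep.sub (hp : 1 < p) (hα : α < 1 - 1 / p) (hs : Ini s) (H : TRep p α s ι x u u')
    (H' : TRep p α s ι y v v') :
    TRep p α s ι (x - y) (fun t => u t - v t) (fun t => u' t - v' t) := by
  simpa [sub_eq_add_neg] using H.add hp hα hs H'.neg

theorem TRep.congr (hs : Ini s) (hu : ∀ᵐ t ∂(volume.restrict s), u t = v t)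
    (hu' : ∀ᵐ t ∂(volume.restrict s), u' t = v' t) (H : TRep p α s ι x u u') :
    TRep p α s ι x v v' := by
  refine ⟨H.wm.congr hu, H.wm'.congr hu', ?_⟩
  filter_upwards [H.eq, hu, ae_restrict_mem hs.isOpen.measurableSet] with t h1 h2 ht
  rw [← h2, h1, prim_congr hs hu' ht]

theorem rep_zero : TRep p α s ι 0 (fun _ => 0) (fun _ => 0) :=
  ⟨WM.zero, WM.zero, Eventually.of_forall fun t => by simp⟩

theorem tn_bdd : BddBelow {r : ℝ | ∃ u u', TRep p α (Ioi 0) ι x u u' ∧ r = en p α (Ioi 0) u u'} :=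
  ⟨0, by rintro r ⟨u, u', _, rfl⟩; exact en_nonneg⟩

theorem tn_nonneg : 0 ≤ tn p α ι x :=
  Real.sInf_nonneg (by rintro r ⟨u, u', _, rfl⟩; exact en_nonneg)

theorem TRep.tn_le (H : TRep p α (Ioi 0) ι x u u') : tn p α ι x ≤ en p α (Ioi 0) u u' :=
  csInf_le tn_bdd ⟨u, u', H, rfl⟩

theorem tn_zero (hp : 1 < p) : tn p α ι 0 = 0 := by
  refine le_antisymm ((rep_zero.tn_le).trans ?_) tn_nonneg
  refine (en_le hp).trans ?_
  rw [WN_zero, WN_zero, add_zero]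

theorem InT.exists_eps (h : InT p α ι x) {ε : ℝ} (hε : 0 < ε) :
    ∃ u u', TRep p α (Ioi 0) ι x u u' ∧ en p α (Ioi 0) u u' < tn p α ι x + ε := by
  obtain ⟨u, u', h⟩ := h
  obtain ⟨r, ⟨v, v', h1, rfl⟩, h2⟩ := exists_lt_of_csInf_lt
    (s := {r : ℝ | ∃ u u', TRep p α (Ioi 0) ι x u u' ∧ r = en p α (Ioi 0) u u'})
    ⟨_, u, u', h, rfl⟩ (lt_add_of_pos_right _ hε)
  exact ⟨v, v', h1, h2⟩

theorem InT.add (hp : 1 < p) (hα : α < 1 - 1 / p) (h : InT p α ι x) (h' : InT p α ι y) :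
    InT p α ι (x + y) := by
  obtain ⟨u, u', h⟩ := h
  obtain ⟨v, v', h'⟩ := h'
  exact ⟨_, _, h.add hp hα Ini.Ioi h'⟩

theorem InT.neg (h : InT p α ι x) : InT p α ι (-x) := by
  obtain ⟨u, u', h⟩ := h
  exact ⟨_, _, h.neg⟩

theorem InT.sub (hp : 1 < p) (hα : α < 1 - 1 / p) (h : InT p α ι x) (h' : InT p α ι y) :
    InT p α ι (x - y) := by
  rw [sub_eq_add_neg]; exact h.add hp hα h'.neg

theorem tn_add (hp : 1 < p) (hα : α < 1 - 1 / p) (h : InT p α ι x) (h' : InT p α ι y) :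
    tn p α ι (x + y) ≤ tn p α ι x + tn p α ι y := by
  refine le_of_forall_pos_le_add fun ε hε => ?_
  obtain ⟨u, u', h1, h2⟩ := h.exists_eps (half_pos hε)
  obtain ⟨v, v', h3, h4⟩ := h'.exists_eps (half_pos hε)
  have := (h1.add hp hα Ini.Ioi h3).tn_le.trans (en_add hp h1.wm h1.wm' h3.wm h3.wm')
  linarith

theorem tn_neg : tn p α ι (-x) = tn p α ι x := by
  unfold tn
  congr 1
  ext r
  constructor
  · rintro ⟨u, u', h, rfl⟩
    exact ⟨_, _, by simpa using h.neg, en_neg.symm⟩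
  · rintro ⟨u, u', h, rfl⟩
    exact ⟨_, _, h.neg, en_neg.symm⟩

theorem tn_comm : tn p α ι (x - y) = tn p α ι (y - x) := by
  rw [← tn_neg, neg_sub]

theorem tn_tri (hp : 1 < p) (hα : α < 1 - 1 / p) {z : E0} (h : InT p α ι x) (h' : InT p α ι y)
    (h'' : InT p α ι z) : tn p α ι (x - z) ≤ tn p α ι (x - y) + tn p α ι (y - z) := by
  have := tn_add hp hα (h.sub hp hα h') (h'.sub hp hα h'')
  simpa using this

theorem norm_le_tn (hp : 1 < p) (hα : α < 1 - 1 / p) (ι : E1 →L[ℝ] E0) : ∃ c : ℝ, 0 ≤ c ∧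
    ∀ x, InT p α ι x → ‖x‖ ≤ c * tn p α ι x := by
  obtain ⟨c0, hc0, h0⟩ := WM.holder (E := E0) hp hα one_pos
  obtain ⟨c1, hc1, h1⟩ := WM.holder (E := E1) hp hα one_pos
  have key : ∀ x u u', TRep p α (Ioi 0) ι x u u' → ‖x‖ ≤ (‖ι‖ * c1 + c0) * en p α (Ioi 0) u u' := by
    intro x u u' H
    have hsub : Ioo 0 1 ⊆ Ioi (0 : ℝ) := Ioo_subset_Ioi_self
    obtain ⟨i0, b0⟩ := h0 u' (H.wm'.mono hsub)
    obtain ⟨i1, b1⟩ := h1 u (H.wm.mono hsub)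
    have e : ∀ᵐ t ∂(volume.restrict (Ioo (0 : ℝ) 1)), ‖x‖ - ∫ r in Ioo (0 : ℝ) 1, ‖u' r‖ ≤ ‖ι‖ * ‖u t‖ := by
      filter_upwards [ae_restrict_of_ae_restrict_of_subset hsub H.eq,
        ae_restrict_mem measurableSet_Ioo] with t ht ht'
      have e1 : ‖∫ r in (0 : ℝ)..t, u' r‖ ≤ ∫ r in Ioo (0 : ℝ) 1, ‖u' r‖ := by
        rw [ii_Ioo ht'.1.le]
        refine (norm_integral_le_integral_norm _).trans ?_
        exact setIntegral_mono_set i0.norm (Eventually.of_forall fun _ => norm_nonneg _)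
          (Ioo_subset_Ioo_right ht'.2.le).eventuallyLE
      have e2 : x = ι (u t) - ∫ r in (0 : ℝ)..t, u' r := by rw [ht]; abel
      have e3 : ‖x‖ ≤ ‖ι (u t)‖ + ‖∫ r in (0 : ℝ)..t, u' r‖ := by
        conv_lhs => rw [e2]
        exact norm_sub_le _ _
      have := ι.le_opNorm (u t)
      linarith
    have e4 := integral_mono_ae (integrable_const _) (i1.norm.const_mul ‖ι‖) e
    rw [integral_const, integral_const_mul] at e4
    simp only [measureReal_restrict_apply_univ, Real.volume_real_Ioo_of_le zero_le_one, sub_zero,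
      one_smul] at e4
    have a1 : WN p α (Ioo 0 1) u ≤ en p α (Ioi 0) u u' := (WN_mono hsub H.wm).trans (le_en hp)
    have a2 : WN p α (Ioo 0 1) u' ≤ en p α (Ioi 0) u u' := (WN_mono hsub H.wm').trans (le_en' hp)
    have b3 : ‖ι‖ * ∫ r in Ioo (0 : ℝ) 1, ‖u r‖ ≤ ‖ι‖ * (c1 * en p α (Ioi 0) u u') := by
      gcongr; exact b1.trans (by gcongr)
    have b4 := b0.trans (mul_le_mul_of_nonneg_left a2 hc0)
    linarith
  refine ⟨‖ι‖ * c1 + c0, by positivity, fun x hx => ?_⟩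
  have hc : 0 ≤ ‖ι‖ * c1 + c0 := by positivity
  refine le_of_forall_pos_le_add fun ε hε => ?_
  obtain ⟨u, u', h1, h2⟩ := hx.exists_eps (ε := ε / (‖ι‖ * c1 + c0 + 1)) (by positivity)
  refine (key x u u' h1).trans ((mul_le_mul_of_nonneg_left h2.le hc).trans ?_)
  rw [mul_add]
  gcongr
  rw [mul_div_assoc', div_le_iff₀ (by positivity)]
  nlinarith

theorem InT.exists_two (hp : 1 < p) (hα : α < 1 - 1 / p) (h : InT p α ι x) :
    ∃ u u', TRep p α (Ioi 0) ι x u u' ∧ en p α (Ioi 0) u u' ≤ 2 * tn p α ι x := by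
  rcases (tn_nonneg (p := p) (α := α) (ι := ι) (x := x)).eq_or_lt with h0 | h0
  · obtain ⟨c, hc, hn⟩ := norm_le_tn hp hα ι
    have := hn x h
    rw [← h0, mul_zero] at this
    have hx : x = 0 := norm_le_zero_iff.1 this
    subst hx
    refine ⟨_, _, rep_zero, ?_⟩
    refine (en_le hp).trans ?_
    rw [WN_zero, WN_zero, ← h0]; simp
  · obtain ⟨u, u', h1, h2⟩ := h.exists_eps h0
    exact ⟨u, u', h1, by linarith⟩

theorem WM.shift (hα0 : 0 ≤ α) {k : ℝ → E} (hk : WM p α (Ioi 0) k) {h : ℝ} (hh : 0 ≤ h) :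
    WM p α (Ioi 0) (fun t => k (t + h)) ∧ WN p α (Ioi 0) (fun t => k (t + h)) ≤ WN p α (Ioi 0) k := by
  have hsub : Ioi (0 + h) ⊆ Ioi (0 : ℝ) := Ioi_subset_Ioi (by linarith)
  have hk1 := hk.mono hsub
  have h1 := MemLp.comp_measurePreserving hk1 (mp_shift h 0)
  have hm := (hk1.aesm measurableSet_Ioi hsub).comp_measurePreserving (mp_shift h 0)
  have hb : ∀ᵐ t ∂(volume.restrict (Ioi (0 : ℝ))), ‖t ^ α • k (t + h)‖ ≤
      ‖((fun t : ℝ => t ^ α • k t) ∘ fun t => t + h) t‖ := by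
    filter_upwards [ae_restrict_mem measurableSet_Ioi] with t ht
    have ht : 0 < t := ht
    simp only [Function.comp_apply, norm_smul]
    rw [Real.norm_of_nonneg (by positivity), Real.norm_of_nonneg (by positivity)]
    gcongr
    linarith
  have hw : WM p α (Ioi 0) (fun t => k (t + h)) :=
    MemLp.mono h1 ((meas_pow α).aestronglyMeasurable.smul hm) hb
  refine ⟨hw, ENNReal.toReal_mono hk.2.ne ?_⟩
  refine (eLpNorm_mono_ae hb).trans ?_
  rw [eLpNorm_comp_measurePreserving hk1.1 (mp_shift h 0)]
  exact eLpNorm_mono_measure _ (Measure.restrict_mono hsub le_rfl)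

theorem lp_shift {P : ENNReal} [Fact (1 ≤ P)] (hP : P ≠ ⊤) {G : ℝ → E} (hG : MemLp G P volume) :
    Tendsto (fun h : ℝ => (eLpNorm (fun t => G (t + h) - G t) P volume).toReal) (𝓝 0) (𝓝 0) := by
  let T : C(ℝ, C(ℝ, ℝ)) := ContinuousMap.curry ⟨fun q : ℝ × ℝ => q.2 + q.1, by fun_prop⟩
  have hm : ∀ h, MeasurePreserving (T h) volume volume := fun h =>
    measurePreserving_add_right (volume : Measure ℝ) h
  have := Filter.Tendsto.compMeasurePreservingLp (μ := (volume : Measure ℝ)) (ν := volume)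
    (l := 𝓝 (0 : ℝ)) (f := fun _ => hG.toLp G)
    (g := T) (g₀ := T 0) tendsto_const_nhds (T.continuous.tendsto 0) hm (hm 0) hP
  rw [tendsto_iff_norm_sub_tendsto_zero] at this
  refine this.congr fun h => ?_
  rw [Lp.toLp_compMeasurePreserving, Lp.toLp_compMeasurePreserving, ← MemLp.toLp_sub, Lp.norm_toLp]
  congr 2
  ext t
  simp [T]

theorem WN_shift_cont (hp : 1 < p) (hα0 : 0 ≤ α) {k : ℝ → E} (hk : WM p α (Ioi 0) k) :
    Tendsto (fun h : ℝ => WN p α (Ioi 0) (fun t => k (t + h) - k t)) (𝓝[≥] 0) (𝓝 0) := by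
  haveI : Fact (1 ≤ ENNReal.ofReal p) := ⟨one_le_ofReal hp⟩
  have hkm := hk.aesm measurableSet_Ioi subset_rfl
  set G : ℝ → E := (Ioi 0).indicator (fun t : ℝ => t ^ α • k t) with hG
  have hGm : MemLp G (ENNReal.ofReal p) volume := by
    rw [hG, memLp_indicator_iff_restrict measurableSet_Ioi]; exact hk
  have l1 : Tendsto (fun h : ℝ => (eLpNorm (fun t => G (t + h) - G t) (ENNReal.ofReal p)
      volume).toReal) (𝓝[≥] 0) (𝓝 0) :=
    (lp_shift (by simp) hGm).mono_left nhdsWithin_le_nhds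
  have l2 : Tendsto (fun h : ℝ => WN p α (Ioi 0) (fun t => ((t / (t + h)) ^ α - 1) • k t))
      (𝓝[≥] 0) (𝓝 0) := by
    refine WN_dct hp measurableSet_Ioi subset_rfl (g := k) ?_ hk ?_ ?_
    · refine Eventually.of_forall fun h => ?_
      refine AEStronglyMeasurable.smul ?_ hkm
      exact (Measurable.aestronglyMeasurable (by fun_prop))
    · filter_upwards [self_mem_nhdsWithin] with h hh
      have hh : 0 ≤ h := hh
      filter_upwards [ae_restrict_mem measurableSet_Ioi] with t ht
      have ht : 0 < t := ht
      rw [norm_smul]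
      refine mul_le_of_le_one_left (norm_nonneg _) ?_
      have h1 : (t / (t + h)) ^ α ≤ 1 := Real.rpow_le_one (by positivity)
        ((div_le_one (by positivity)).2 (by linarith)) hα0
      have h2 : 0 ≤ (t / (t + h)) ^ α := by positivity
      rw [Real.norm_eq_abs, abs_le]; constructor <;> linarith
    · filter_upwards [ae_restrict_mem measurableSet_Ioi] with t ht
      have ht : 0 < t := ht
      have c1 : ContinuousAt (fun h : ℝ => ((t / (t + h)) ^ α - 1) • k t) 0 := by
        refine ContinuousAt.smul (ContinuousAt.sub ?_ continuousAt_const) continuousAt_const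
        refine ContinuousAt.rpow_const (continuousAt_const.div (by fun_prop) (by simp; exact ht.ne')) ?_
        left; simp [ht.ne']
      have c2 := c1.tendsto
      simp only [add_zero, div_self ht.ne', Real.one_rpow, sub_self, zero_smul] at c2
      exact c2.mono_left nhdsWithin_le_nhds
  refine squeeze_zero' (Eventually.of_forall fun _ => WN_nonneg) ?_ (by simpa using l1.add l2)
  filter_upwards [self_mem_nhdsWithin] with h hh
  have hh : 0 ≤ h := hh
  have hk1 := (hk.shift hα0 hh).1
  have hGG : MemLp (fun t => G (t + h) - G t) (ENNReal.ofReal p) volume :=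
    MemLp.sub (hGm.comp_measurePreserving (measurePreserving_add_right volume h)) hGm
  have w2 : WM p α (Ioi 0) (fun t => ((t / (t + h)) ^ α - 1) • k t) := by
    refine hk.of_bound 1 ?_ ?_
    · refine AEStronglyMeasurable.smul ?_ hkm
      exact (Measurable.aestronglyMeasurable (by fun_prop))
    · filter_upwards [ae_restrict_mem measurableSet_Ioi] with t ht
      have ht : 0 < t := ht
      rw [norm_smul]
      gcongr
      have h1 : (t / (t + h)) ^ α ≤ 1 := Real.rpow_le_one (by positivity)
        ((div_le_one (by positivity)).2 (by linarith)) hα0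
      have h2 : 0 ≤ (t / (t + h)) ^ α := by positivity
      rw [Real.norm_eq_abs, abs_le]; constructor <;> linarith
  have w1 := (hk1.sub hk).sub w2
  have e : (fun t => k (t + h) - k t) = fun t => ((k (t + h) - k t) - ((t / (t + h)) ^ α - 1) • k t)
      + ((t / (t + h)) ^ α - 1) • k t := by ext t; abel
  conv_lhs => rw [e]
  refine (WN_add_le hp w1 w2).trans ?_
  gcongr
  unfold WN
  refine ENNReal.toReal_mono hGG.2.ne ?_
  refine le_trans ?_ (eLpNorm_mono_measure _ (Measure.restrict_le_self (s := Ioi 0)))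
  refine eLpNorm_mono_ae ?_
  filter_upwards [ae_restrict_mem measurableSet_Ioi] with t ht
  have ht : 0 < t := ht
  have hth : 0 < t + h := by linarith
  have h1 : (t / (t + h)) ^ α ≤ 1 := Real.rpow_le_one (by positivity)
    ((div_le_one (by positivity)).2 (by linarith)) hα0
  have h2 : 0 ≤ (t / (t + h)) ^ α := by positivity
  have h3 : t ^ α • ((k (t + h) - k t) - ((t / (t + h)) ^ α - 1) • k t) =
      (t / (t + h)) ^ α • (G (t + h) - G t) := by
    rw [hG, indicator_of_mem (show t + h ∈ Ioi 0 from hth), indicator_of_mem (show t ∈ Ioi 0 from ht),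
      smul_sub ((t / (t + h)) ^ α), smul_smul, smul_smul, Real.div_rpow ht.le hth.le,
      div_mul_cancel₀ _ (by positivity), sub_smul, one_smul]
    rw [show k (t + h) - k t - ((t ^ α / (t + h) ^ α) • k t - k t) =
      k (t + h) - (t ^ α / (t + h) ^ α) • k t by abel, smul_sub, smul_smul]
    congr 2; ring
  rw [h3, norm_smul, Real.norm_of_nonneg h2]
  exact mul_le_of_le_one_left (norm_nonneg _) h1

theorem TRep.shift (hp : 1 < p) (hα0 : 0 ≤ α) (hα : α < 1 - 1 / p) (H : TRep p α (Ioi 0) ι x u u')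
    {h : ℝ} (hh : 0 ≤ h) :
    TRep p α (Ioi 0) ι (x + ∫ r in (0 : ℝ)..h, u' r) (fun t => u (t + h)) (fun t => u' (t + h)) := by
  refine ⟨(H.wm.shift hα0 hh).1, (H.wm'.shift hα0 hh).1, ?_⟩
  have hsub : Ioi (0 + h) ⊆ Ioi (0 : ℝ) := Ioi_subset_Ioi (by linarith)
  have h1 := (mp_shift h 0).quasiMeasurePreserving.ae
    (ae_restrict_of_ae_restrict_of_subset hsub H.eq)
  filter_upwards [h1, ae_restrict_mem measurableSet_Ioi] with t ht ht0
  have ht0 : 0 < t := ht0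
  rw [ht, add_assoc, intervalIntegral.integral_comp_add_right, zero_add]
  congr 1
  have i : ∀ t, 0 ≤ t → IntervalIntegrable u' volume 0 t := by
    intro t ht
    rcases ht.eq_or_lt with rfl | ht
    · exact IntervalIntegrable.refl
    · exact ii_of_Ioo ht.le (H.wm'.intOn hp hα Ini.Ioi ht)
  exact (intervalIntegral.integral_add_adjacent_intervals (i h hh)
    ((i h hh).symm.trans (i (t + h) (by linarith)))).symm

theorem TRep.inT_at (hp : 1 < p) (hα0 : 0 ≤ α) (hα : α < 1 - 1 / p) (H : TRep p α (Ioi 0) ι x u u')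
    {h : ℝ} (hh : 0 ≤ h) : InT p α ι (x + ∫ r in (0 : ℝ)..h, u' r) :=
  ⟨_, _, H.shift hp hα0 hα hh⟩

theorem TRep.tn_at (hp : 1 < p) (hα0 : 0 ≤ α) (hα : α < 1 - 1 / p) (H : TRep p α (Ioi 0) ι x u u')
    {h : ℝ} (hh : 0 ≤ h) :
    tn p α ι (x + ∫ r in (0 : ℝ)..h, u' r) ≤ en p α (Ioi 0) u u' :=
  ((H.shift hp hα0 hα hh).tn_le).trans
    (en_mono_of hp (H.wm.shift hα0 hh).2 (H.wm'.shift hα0 hh).2)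

theorem TRep.cont (hp : 1 < p) (hα0 : 0 ≤ α) (hα : α < 1 - 1 / p) (H : TRep p α (Ioi 0) ι x u u')
    {ε : ℝ} (hε : 0 < ε) : ∃ δ > 0, ∀ a b : ℝ, 0 ≤ a → 0 ≤ b → |b - a| < δ →
      tn p α ι ((x + ∫ r in (0 : ℝ)..b, u' r) - (x + ∫ r in (0 : ℝ)..a, u' r)) < ε := by
  have l := (WN_shift_cont hp hα0 H.wm).add (WN_shift_cont hp hα0 H.wm')
  rw [add_zero] at l
  have l1 := l.eventually (gt_mem_nhds hε)
  rw [eventually_nhdsWithin_iff, Metric.eventually_nhds_iff] at l1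
  obtain ⟨δ, hδ, h⟩ := l1
  have key : ∀ a b : ℝ, 0 ≤ a → a ≤ b → |b - a| < δ →
      tn p α ι ((x + ∫ r in (0 : ℝ)..b, u' r) - (x + ∫ r in (0 : ℝ)..a, u' r)) < ε := by
    intro a b ha hab hd
    have hb : 0 ≤ b := ha.trans hab
    have h1 := (H.shift hp hα0 hα hb).sub hp hα Ini.Ioi (H.shift hp hα0 hα ha)
    refine (h1.tn_le.trans (en_le hp)).trans_lt (lt_of_le_of_lt ?_
      (h (y := b - a) (by simpa [Real.dist_eq] using hd) (by simpa using hab)))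
    have hba : 0 ≤ b - a := by linarith
    have s1 := (((H.wm.shift hα0 hba).1.sub H.wm).shift hα0 ha).2
    have s2 := (((H.wm'.shift hα0 hba).1.sub H.wm').shift hα0 ha).2
    simp only [add_assoc, add_sub_cancel] at s1 s2
    exact add_le_add s1 s2
  refine ⟨δ, hδ, fun a b ha hb hd => ?_⟩
  rcases le_total a b with hab | hab
  · exact key a b ha hab hd
  · rw [tn_comm]; exact key b a hb hab (by rwa [abs_sub_comm])

theorem MRh.linear (hp : 1 < p) (hα0 : 0 ≤ α) (hα : α < 1 - 1 / p) (H : MRh p ι A) :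
    ∃ C : ℝ, 1 ≤ C ∧ ∀ x, InT p α ι x → ∀ f : ℝ → E0, WM p α (Ioi 0) f → ∃ z : ℝ → E1,
      TRep p α (Ioi 0) ι x z (fun t => f t - A (z t)) ∧
      en p α (Ioi 0) z (fun t => f t - A (z t)) ≤ C * (tn p α ι x + WN p α (Ioi 0) f) := by
  obtain ⟨C, hC, h⟩ := H.weighted hp hα0 hα
  have hA := norm_nonneg A
  refine ⟨1 + (1 + ‖A‖) * (2 + C * (1 + 2 + 2 * ‖A‖)), by
    have : 0 ≤ (1 + ‖A‖) * (2 + C * (1 + 2 + 2 * ‖A‖)) := by positivity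
    linarith, fun x hx f hf => ?_⟩
  obtain ⟨v, v', R, hR⟩ := hx.exists_two hp hα
  have hg := (hf.sub R.wm').sub (R.wm.clm A)
  obtain ⟨w, hw, hwS, hwb⟩ := h _ hg
  have hz := R.wm.add hw
  have hv1 := (le_en hp).trans hR
  have hv2 := (le_en' hp).trans hR
  have hgb : WN p α (Ioi 0) (fun t => f t - v' t - A (v t)) ≤
      WN p α (Ioi 0) f + 2 * tn p α ι x + ‖A‖ * (2 * tn p α ι x) := by
    refine (WN_sub_le hp (hf.sub R.wm') (R.wm.clm A)).trans ?_
    have a1 := WN_sub_le hp hf R.wm'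
    have a2 := (WN_clm_le A R.wm).trans (mul_le_mul_of_nonneg_left hv1 hA)
    linarith
  have ht := tn_nonneg (p := p) (α := α) (ι := ι) (x := x)
  have hf0 := WN_nonneg (p := p) (α := α) (s := Ioi 0) (f := f)
  have hgb2 : WN p α (Ioi 0) (fun t => f t - v' t - A (v t)) ≤
      (1 + 2 + 2 * ‖A‖) * (tn p α ι x + WN p α (Ioi 0) f) := by
    refine hgb.trans ?_
    nlinarith [mul_nonneg hA hf0]
  have hzb : WN p α (Ioi 0) (fun t => v t + w t) ≤
      (2 + C * (1 + 2 + 2 * ‖A‖)) * (tn p α ι x + WN p α (Ioi 0) f) := by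
    refine (WN_add_le hp R.wm hw).trans ?_
    have := hwb.trans (mul_le_mul_of_nonneg_left hgb2 hC)
    nlinarith
  refine ⟨fun t => v t + w t, ⟨hz, hf.sub (hz.clm A), ?_⟩, ?_⟩
  · filter_upwards [R.eq, hwS, ae_restrict_mem measurableSet_Ioi] with t h1 h2 ht
    have ht' : (0 : ℝ) ≤ t := le_of_lt ht
    rw [map_add, h1, h2, add_assoc, ← intervalIntegral.integral_add
      (ii_of_Ioo ht' (R.wm'.intOn hp hα Ini.Ioi ht))
      (ii_of_Ioo ht' ((hg.sub (hw.clm A)).intOn hp hα Ini.Ioi ht))]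
    congr 2
    ext r; rw [map_add]; abel
  · refine (en_le hp).trans ?_
    have b1 := WN_sub_le hp hf (hz.clm A)
    have b2 := (WN_clm_le A hz).trans (mul_le_mul_of_nonneg_left hzb hA)
    nlinarith

theorem MRh.loclinear (hp : 1 < p) (hα0 : 0 ≤ α) (hα : α < 1 - 1 / p) (H : MRh p ι A) :
    ∃ C : ℝ, 1 ≤ C ∧ (∀ T : ℝ, 0 < T → ∀ x, InT p α ι x → ∀ f : ℝ → E0, WM p α (Ioo 0 T) f →
      ∃ z : ℝ → E1, TRep p α (Ioo 0 T) ι x z (fun t => f t - A (z t))) ∧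
    ∀ T : ℝ, 0 < T → ∀ x, InT p α ι x → ∀ (f : ℝ → E0) (u : ℝ → E1) (u' : ℝ → E0),
      WM p α (Ioo 0 T) f → TRep p α (Ioo 0 T) ι x u u' →
      (∀ᵐ t ∂(volume.restrict (Ioo 0 T)), u' t + A (u t) = f t) →
      ∃ (z : ℝ → E1) (z' : ℝ → E0), TRep p α (Ioi 0) ι x z z' ∧
      (∀ᵐ t ∂(volume.restrict (Ioo 0 T)), z t = u t) ∧
      (∀ᵐ t ∂(volume.restrict (Ioo 0 T)), z' t = u' t) ∧
      en p α (Ioi 0) z z' ≤ C * (tn p α ι x + WN p α (Ioo 0 T) f) := by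
  obtain ⟨C, hC, h⟩ := H.linear hp hα0 hα
  refine ⟨C, hC, fun T hT x hx f hf => ?_, fun T hT x hx f u u' hf R he => ?_⟩
  · have hsub : Ioo 0 T ⊆ Ioi (0 : ℝ) := Ioo_subset_Ioi_self
    obtain ⟨z, hz, hb⟩ := h x hx _ (hf.indicator measurableSet_Ioo hsub)
    refine ⟨z, (hz.mono hsub).congr (Ini.Ioo hT) (Eventually.of_forall fun _ => rfl) ?_⟩
    filter_upwards [indicator_ae (f := f) (s := Ioo 0 T) measurableSet_Ioo] with t ht
    rw [ht]
  · have hsub : Ioo 0 T ⊆ Ioi (0 : ℝ) := Ioo_subset_Ioi_self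
    have hs := Ini.Ioo hT
    obtain ⟨z, hz, hb⟩ := h x hx _ (hf.indicator measurableSet_Ioo hsub)
    rw [WN_indicator measurableSet_Ioo hsub] at hb
    have R2 := (hz.mono hsub).sub hp hα hs R
    have hzu : ∀ᵐ t ∂(volume.restrict (Ioo 0 T)), z t - u t = 0 := by
      refine H.wlocun hp hα hT R2.wm ?_
      filter_upwards [R2.eq, ae_restrict_mem measurableSet_Ioo] with t ht hts
      rw [ht, sub_self, zero_add]
      refine prim_congr hs ?_ hts
      filter_upwards [he, indicator_ae (f := f) (s := Ioo 0 T) measurableSet_Ioo] with r h1 h2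
      rw [h2, ← h1, map_sub]; abel
    have hzu' : ∀ᵐ t ∂(volume.restrict (Ioo 0 T)), z t = u t := hzu.mono fun t ht => sub_eq_zero.1 ht
    refine ⟨z, _, hz, hzu', ?_, hb⟩
    filter_upwards [he, hzu', indicator_ae (f := f) (s := Ioo 0 T) measurableSet_Ioo] with t h1 h2 h3
    rw [h3, h2, ← h1]; abel

end PartSix

section PartSeven

open Filter Topology

variable {E E' E'' : Type*} [NormedAddCommGroup E] [NormedSpace ℝ E]
  [NormedAddCommGroup E'] [NormedSpace ℝ E'] [NormedAddCommGroup E''] [NormedSpace ℝ E'']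
variable {E0 E1 : Type*} [NormedAddCommGroup E0] [NormedSpace ℝ E0] [CompleteSpace E0]
  [NormedAddCommGroup E1] [NormedSpace ℝ E1] [CompleteSpace E1]

variable {p α : ℝ} {s : Set ℝ}

theorem WM.norm (hs : MeasurableSet s) (hs0 : s ⊆ Ioi 0) {v : ℝ → E} (hv : WM p α s v) :
    WM p α s (fun t => ‖v t‖) :=
  WM.of_bound hv 1 (hv.aesm hs hs0).norm (Eventually.of_forall fun t => by simp)

theorem WN_norm {v : ℝ → E} (hv : WM p α s v) :
    WN p α s (fun t => ‖v t‖) ≤ WN p α s v := by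
  have := WN_le_of_bound (f := fun t => ‖v t‖) hv 1 zero_le_one
    (Eventually.of_forall fun t => by simp)
  linarith

theorem two_bound (hp : 1 < p) (hs : MeasurableSet s) (hs0 : s ⊆ Ioi 0) {f : ℝ → E} {u : ℝ → E'}
    {v : ℝ → E''} (hu : WM p α s u) (hv : WM p α s v) {a b : ℝ} (ha : 0 ≤ a) (hb : 0 ≤ b)
    (h : ∀ᵐ t ∂(volume.restrict s), ‖f t‖ ≤ a * ‖u t‖ + b * ‖v t‖) :
    WN p α s f ≤ a * WN p α s u + b * WN p α s v ∧
    (AEStronglyMeasurable f (volume.restrict s) → WM p α s f) := by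
  have h1 : WM p α s (fun t => a * ‖u t‖) :=
    WM.of_bound hu a ((hu.aesm hs hs0).norm.const_mul a) (Eventually.of_forall fun t => by
      rw [norm_mul, norm_norm, Real.norm_of_nonneg ha])
  have h2 : WM p α s (fun t => b * ‖v t‖) :=
    WM.of_bound hv b ((hv.aesm hs hs0).norm.const_mul b) (Eventually.of_forall fun t => by
      rw [norm_mul, norm_norm, Real.norm_of_nonneg hb])
  have n1 : WN p α s (fun t => a * ‖u t‖) ≤ a * WN p α s u :=
    WN_le_of_bound hu a ha (Eventually.of_forall fun t => by
      rw [norm_mul, norm_norm, Real.norm_of_nonneg ha])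
  have n2 : WN p α s (fun t => b * ‖v t‖) ≤ b * WN p α s v :=
    WN_le_of_bound hv b hb (Eventually.of_forall fun t => by
      rw [norm_mul, norm_norm, Real.norm_of_nonneg hb])
  have hk : ∀ᵐ t ∂(volume.restrict s), ‖f t‖ ≤ 1 * ‖a * ‖u t‖ + b * ‖v t‖‖ := by
    filter_upwards [h] with t ht
    rw [one_mul]
    exact ht.trans (le_abs_self _)
  refine ⟨?_, fun hf => WM.of_bound (h1.add h2) 1 hf hk⟩
  have := WN_le_of_bound (h1.add h2) 1 zero_le_one hk
  have := WN_add_le hp h1 h2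
  linarith

theorem WM_one {T : ℝ} (hα0 : 0 ≤ α) : WM p α (Ioo 0 T) (fun _ => (1 : ℝ)) := by
  unfold WM
  refine MemLp.of_bound ?_ (T ^ α) ?_
  · exact ((meas_pow α).smul measurable_const).aestronglyMeasurable
  · filter_upwards [ae_restrict_mem measurableSet_Ioo] with t ht
    rw [smul_eq_mul, mul_one, Real.norm_of_nonneg (Real.rpow_nonneg ht.1.le _)]
    exact Real.rpow_le_rpow ht.1.le ht.2.le hα0

theorem WN_small [CompleteSpace E] (hp : 1 < p) {k : ℝ → E} (hk : WM p α (Ioo 0 1) k) :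
    Tendsto (fun T : ℝ => WN p α (Ioo 0 T) k) (𝓝[>] 0) (𝓝 0) := by
  have h0 : Ioo (0 : ℝ) 1 ⊆ Ioi 0 := Ioo_subset_Ioi_self
  have h1 : ∀ᶠ T : ℝ in 𝓝[>] 0, T ∈ Ioo (0 : ℝ) 1 := Ioo_mem_nhdsGT one_pos
  have := WN_dct (α := α) (l := 𝓝[>] (0 : ℝ)) (F := fun T : ℝ => (Ioo 0 T).indicator k) hp
    measurableSet_Ioo h0
    (Eventually.of_forall fun T => (hk.aesm measurableSet_Ioo h0).indicator measurableSet_Ioo) hk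
    (Eventually.of_forall fun T => Eventually.of_forall fun t => norm_indicator_le_norm_self _ _) ?_
  · refine this.congr' ?_
    filter_upwards [h1] with T hT
    exact WN_indicator measurableSet_Ioo (Ioo_subset_Ioo_right hT.2.le)
  · filter_upwards [ae_restrict_mem measurableSet_Ioo] with t ht
    have : ∀ᶠ T : ℝ in 𝓝[>] 0, T ∈ Ioo (0 : ℝ) t := Ioo_mem_nhdsGT ht.1
    refine tendsto_const_nhds.congr' ?_
    filter_upwards [this] with T hT
    rw [indicator_of_notMem]
    exact fun h => absurd h.2 (not_lt.2 hT.2.le)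

variable {ι A0 : E1 →L[ℝ] E0} {f g : ℝ → E0} {u v : ℝ → E1} {u' v' : ℝ → E0} {x y : E0}

theorem prim_congr_Icc {T : ℝ} (h : ∀ᵐ t ∂(volume.restrict (Ioo 0 T)), f t = g t)
    {t : ℝ} (ht : t ∈ Icc 0 T) : ∫ r in (0 : ℝ)..t, f r = ∫ r in (0 : ℝ)..t, g r := by
  rw [ii_Ioo ht.1, ii_Ioo ht.1]
  exact integral_congr_ae (ae_restrict_of_ae_restrict_of_subset (Ioo_subset_Ioo_right ht.2) h)

def LinP (p α : ℝ) (ι A : E1 →L[ℝ] E0) (C : ℝ) : Prop :=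
    ∀ T : ℝ, 0 < T → ∀ x, InT p α ι x → ∀ (f : ℝ → E0) (u : ℝ → E1) (u' : ℝ → E0),
      WM p α (Ioo 0 T) f → TRep p α (Ioo 0 T) ι x u u' →
      (∀ᵐ t ∂(volume.restrict (Ioo 0 T)), u' t + A (u t) = f t) →
      ∃ (z : ℝ → E1) (z' : ℝ → E0), TRep p α (Ioi 0) ι x z z' ∧
      (∀ᵐ t ∂(volume.restrict (Ioo 0 T)), z t = u t) ∧
      (∀ᵐ t ∂(volume.restrict (Ioo 0 T)), z' t = u' t) ∧
      en p α (Ioi 0) z z' ≤ C * (tn p α ι x + WN p α (Ioo 0 T) f)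

theorem LinP.ext {C T : ℝ} (hp : 1 < p) (H : LinP p α ι A0 C) (hT : 0 < T) (hx : InT p α ι x)
    (R : TRep p α (Ioo 0 T) ι x u u') : ∃ (z : ℝ → E1) (z' : ℝ → E0),
      TRep p α (Ioi 0) ι x z z' ∧
      (∀ t ∈ Icc 0 T, x + ∫ r in (0 : ℝ)..t, z' r = x + ∫ r in (0 : ℝ)..t, u' r) ∧
      en p α (Ioo 0 T) u u' ≤ en p α (Ioi 0) z z' ∧
      en p α (Ioi 0) z z' ≤ C * (tn p α ι x + WN p α (Ioo 0 T) (fun t => u' t + A0 (u t))) := by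
  obtain ⟨z, z', h1, h2, h3, h4⟩ := H T hT x hx _ u u' (R.wm'.add (R.wm.clm A0)) R
    (Eventually.of_forall fun _ => rfl)
  refine ⟨z, z', h1, fun t ht => by rw [prim_congr_Icc h3 ht], ?_, h4⟩
  have a1 : WN p α (Ioo 0 T) u ≤ WN p α (Ioi 0) z := by
    rw [← WN_congr h2]; exact WN_mono Ioo_subset_Ioi_self h1.wm
  have a2 : WN p α (Ioo 0 T) u' ≤ WN p α (Ioi 0) z' := by
    rw [← WN_congr h3]; exact WN_mono Ioo_subset_Ioi_self h1.wm'
  exact en_mono_of hp a1 a2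

theorem LinP.inT {C T : ℝ} (hp : 1 < p) (hα0 : 0 ≤ α) (hα : α < 1 - 1 / p) (H : LinP p α ι A0 C)
    (hT : 0 < T) (hx : InT p α ι x)
    (R : TRep p α (Ioo 0 T) ι x u u') {t : ℝ} (ht : t ∈ Icc 0 T) :
    InT p α ι (x + ∫ r in (0 : ℝ)..t, u' r) := by
  obtain ⟨z, z', h1, h2, h3, h4⟩ := H.ext hp hT hx R
  rw [← h2 t ht]; exact h1.inT_at hp hα0 hα ht.1

theorem LinP.cont {C T : ℝ} (hp : 1 < p) (hα0 : 0 ≤ α) (hα : α < 1 - 1 / p) (H : LinP p α ι A0 C)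
    (hT : 0 < T) (hx : InT p α ι x)
    (R : TRep p α (Ioo 0 T) ι x u u') {ε : ℝ} (hε : 0 < ε) :
    ∃ δ > 0, ∀ a ∈ Icc 0 T, ∀ b ∈ Icc 0 T, |b - a| < δ →
      tn p α ι ((x + ∫ r in (0 : ℝ)..b, u' r) - (x + ∫ r in (0 : ℝ)..a, u' r)) < ε := by
  obtain ⟨z, z', h1, h2, h3, h4⟩ := H.ext hp hT hx R
  obtain ⟨δ, hδ, h⟩ := h1.cont hp hα0 hα hε
  refine ⟨δ, hδ, fun a ha b hb hab => ?_⟩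
  rw [← h2 a ha, ← h2 b hb]; exact h a b ha.1 hb.1 hab

theorem LinP.diff {C T : ℝ} (hp : 1 < p) (hα0 : 0 ≤ α) (hα : α < 1 - 1 / p) (H : LinP p α ι A0 C)
    (hT : 0 < T) (hx : InT p α ι x) (hy : InT p α ι y)
    (R : TRep p α (Ioo 0 T) ι x u u') (R' : TRep p α (Ioo 0 T) ι y v v')
    (hf : ∀ᵐ t ∂(volume.restrict (Ioo 0 T)), u' t + A0 (u t) = f t)
    (hg : ∀ᵐ t ∂(volume.restrict (Ioo 0 T)), v' t + A0 (v t) = g t) :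
    en p α (Ioo 0 T) (fun t => u t - v t) (fun t => u' t - v' t) ≤
      C * (tn p α ι (x - y) + WN p α (Ioo 0 T) (fun t => f t - g t)) ∧
    ∀ t ∈ Icc 0 T, tn p α ι ((x + ∫ r in (0 : ℝ)..t, u' r) - (y + ∫ r in (0 : ℝ)..t, v' r)) ≤
      C * (tn p α ι (x - y) + WN p α (Ioo 0 T) (fun t => f t - g t)) := by
  have hs := Ini.Ioo hT
  obtain ⟨z, z', h1, h2, h3, h4⟩ := H.ext hp hT (hx.sub hp hα hy) (R.sub hp hα hs R')
  have e : WN p α (Ioo 0 T) (fun t => u' t - v' t + A0 (u t - v t)) =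
      WN p α (Ioo 0 T) (fun t => f t - g t) := by
    apply WN_congr
    filter_upwards [hf, hg] with t h h'
    rw [← h, ← h', map_sub]; abel
  rw [e] at h4
  refine ⟨h3.trans h4, fun t ht => ?_⟩
  have i1 : IntegrableOn u' (Ioo 0 T) := by
    obtain ⟨c, _, h⟩ := WM.holder (E := E0) hp hα hT
    exact (h _ R.wm').1
  have i2 : IntegrableOn v' (Ioo 0 T) := by
    obtain ⟨c, _, h⟩ := WM.holder (E := E0) hp hα hT
    exact (h _ R'.wm').1
  have : (x + ∫ r in (0 : ℝ)..t, u' r) - (y + ∫ r in (0 : ℝ)..t, v' r) =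
      (x - y) + ∫ r in (0 : ℝ)..t, (u' r - v' r) := by
    rw [intervalIntegral.integral_sub
      (ii_of_Ioo ht.1 (i1.mono_set (Ioo_subset_Ioo_right ht.2)))
      (ii_of_Ioo ht.1 (i2.mono_set (Ioo_subset_Ioo_right ht.2)))]
    abel
  rw [this, ← h2 t ht]
  exact (h1.tn_at hp hα0 hα ht.1).trans h4

/-- The constants and smallness conditions. -/
structure QD (p α : ℝ) (ι : E1 →L[ℝ] E0) (A : E0 → E1 →L[ℝ] E0) (F : E0 → E0) (u0 : E0)
    (C L η T : ℝ) (us : ℝ → E1) (us' : ℝ → E0) : Prop where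
  hp : 1 < p
  hα0 : 0 ≤ α
  hα : α < 1 - 1 / p
  lin : LinP p α ι (A u0) C
  hC : 1 ≤ C
  hL : 0 ≤ L
  hη : 0 < η
  hu0 : InT p α ι u0
  lip : ∀ y z, InT p α ι y → InT p α ι z → tn p α ι (y - u0) ≤ η → tn p α ι (z - u0) ≤ η →
    ‖A y - A z‖ ≤ L * tn p α ι (y - z) ∧ ‖F y - F z‖ ≤ L * tn p α ι (y - z)
  small : L * η * C ≤ 1 / 16
  hT : 0 < T
  Rs : TRep p α (Ioo 0 T) ι u0 us us'
  es : ∀ᵐ t ∂(volume.restrict (Ioo 0 T)), us' t + A u0 (us t) = 0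
  bs : ∀ t ∈ Icc 0 T, tn p α ι ((u0 + ∫ r in (0 : ℝ)..t, us' r) - u0) ≤ η / 4
  ns : WN p α (Ioo 0 T) us ≤ η / 4
  k1 : C * (WN p α (Ioo 0 T) (fun _ => (1 : ℝ)) * (‖F u0‖ + L * η)) ≤ η / 16
  k2 : L * C * WN p α (Ioo 0 T) (fun _ => (1 : ℝ)) ≤ 1 / 4

variable {A : E0 → E1 →L[ℝ] E0} {F : E0 → E0} {u0 : E0} {C L η T T' : ℝ} {us : ℝ → E1}
  {us' : ℝ → E0}

/-- The nonlinearity. -/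
def GN (A : E0 → E1 →L[ℝ] E0) (F : E0 → E0) (u0 x : E0) (u : ℝ → E1) (u' : ℝ → E0) (t : ℝ) : E0 :=
  (A u0 - A (x + ∫ r in (0 : ℝ)..t, u' r)) (u t) + F (x + ∫ r in (0 : ℝ)..t, u' r)

theorem QD.tn0 (D : QD p α ι A F u0 C L η T us us') : tn p α ι (u0 - u0) ≤ η := by
  rw [sub_self, tn_zero D.hp]; exact D.hη.le

theorem QD.gn_bound (D : QD p α ι A F u0 C L η T us us') (hT' : 0 < T') (hTT : T' ≤ T)
    (hx : InT p α ι x) (R : TRep p α (Ioo 0 T') ι x u u')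
    (hb : ∀ t ∈ Icc 0 T', tn p α ι ((x + ∫ r in (0 : ℝ)..t, u' r) - u0) ≤ η) :
    WN p α (Ioo 0 T') (GN A F u0 x u u') ≤ L * η * WN p α (Ioo 0 T') u +
      WN p α (Ioo 0 T) (fun _ => (1 : ℝ)) * (‖F u0‖ + L * η) ∧
    (AEStronglyMeasurable (GN A F u0 x u u') (volume.restrict (Ioo 0 T')) →
      WM p α (Ioo 0 T') (GN A F u0 x u u')) := by
  have hs0 : Ioo (0 : ℝ) T' ⊆ Ioi 0 := Ioo_subset_Ioi_self
  have hLη := mul_nonneg D.hL D.hη.le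
  have hb0 : 0 ≤ ‖F u0‖ + L * η := by positivity
  have := two_bound (f := GN A F u0 x u u') D.hp measurableSet_Ioo hs0 R.wm
    (WM_one (T := T') (p := p) D.hα0) hLη hb0 ?_
  · refine ⟨this.1.trans ?_, this.2⟩
    have := WN_mono (Ioo_subset_Ioo_right hTT) (WM_one (T := T) (p := p) D.hα0)
    nlinarith
  · filter_upwards [ae_restrict_mem measurableSet_Ioo] with t ht
    have ht' := Ioo_subset_Icc_self ht
    have hin := D.lin.inT D.hp D.hα0 D.hα hT' hx R ht'
    have h1 := D.lip _ _ hin D.hu0 (hb t ht') D.tn0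
    have h2 := mul_le_mul_of_nonneg_left (hb t ht') D.hL
    unfold GN
    rw [norm_one, mul_one]
    refine (norm_add_le _ _).trans (add_le_add ?_ ?_)
    · refine (ContinuousLinearMap.le_opNorm _ _).trans ?_
      refine mul_le_mul_of_nonneg_right ?_ (norm_nonneg _)
      rw [norm_sub_rev]
      exact h1.1.trans h2
    · have := norm_le_norm_add_norm_sub' (F (x + ∫ r in (0 : ℝ)..t, u' r)) (F u0)
      exact this.trans (add_le_add le_rfl (h1.2.trans h2))

theorem QD.bounds (D : QD p α ι A F u0 C L η T us us') (hT' : 0 < T') (hTT : T' ≤ T)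
    (hx : InT p α ι x) (R : TRep p α (Ioo 0 T') ι x u u')
    (hxe : C * tn p α ι (x - u0) ≤ η / 8)
    (hf : ∀ᵐ t ∂(volume.restrict (Ioo 0 T')), u' t + A u0 (u t) = f t) :
    (∀ t ∈ Icc 0 T', tn p α ι ((x + ∫ r in (0 : ℝ)..t, u' r) - u0) ≤
      η / 4 + η / 8 + C * WN p α (Ioo 0 T') f) ∧
    WN p α (Ioo 0 T') u ≤ η / 4 + η / 8 + C * WN p α (Ioo 0 T') f := by
  have hsub : Ioo (0 : ℝ) T' ⊆ Ioo 0 T := Ioo_subset_Ioo_right hTT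
  have Rs := D.Rs.mono hsub
  have es := ae_restrict_of_ae_restrict_of_subset hsub D.es
  obtain ⟨h1, h2⟩ := D.lin.diff (g := fun _ => 0) D.hp D.hα0 D.hα hT' hx D.hu0 R Rs hf es
  simp only [sub_zero] at h1 h2
  constructor
  · intro t ht
    have ht2 : t ∈ Icc 0 T := ⟨ht.1, ht.2.trans hTT⟩
    have := tn_tri D.hp D.hα (D.lin.inT D.hp D.hα0 D.hα hT' hx R ht)
      (D.lin.inT D.hp D.hα0 D.hα hT' D.hu0 Rs ht) D.hu0
    have := h2 t ht
    have := D.bs t ht2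
    linarith
  · have a1 := (le_en D.hp).trans h1
    have a2 := WN_add_le D.hp (R.wm.sub Rs.wm) Rs.wm
    simp only [sub_add_cancel] at a2
    have a3 := WN_mono hsub D.Rs.wm
    have := D.ns
    linarith

/-- Bootstrap on one interval. -/
theorem QD.boot (D : QD p α ι A F u0 C L η T us us') (hT' : 0 < T') (hTT : T' ≤ T)
    (hx : InT p α ι x) (R : TRep p α (Ioo 0 T') ι x u u')
    (hxe : C * tn p α ι (x - u0) ≤ η / 8)
    (hf : ∀ᵐ t ∂(volume.restrict (Ioo 0 T')), u' t + A u0 (u t) = GN A F u0 x u u' t)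
    (hb : ∀ t ∈ Icc 0 T', tn p α ι ((x + ∫ r in (0 : ℝ)..t, u' r) - u0) ≤ η) :
    (∀ t ∈ Icc 0 T', tn p α ι ((x + ∫ r in (0 : ℝ)..t, u' r) - u0) ≤ η / 2) ∧
    WN p α (Ioo 0 T') u ≤ η / 2 := by
  have h1 := (D.gn_bound hT' hTT hx R hb).1
  obtain ⟨h2, h3⟩ := D.bounds hT' hTT hx R hxe hf
  have hC0 : 0 ≤ C := by linarith [D.hC]
  have h4 := mul_le_mul_of_nonneg_left h1 hC0
  have hu0 := WN_nonneg (p := p) (α := α) (s := Ioo 0 T') (f := u)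
  have h5 := mul_le_mul_of_nonneg_right D.small hu0
  have h6 := D.k1
  have hη := D.hη
  have h7 : C * WN p α (Ioo 0 T') (GN A F u0 x u u') ≤ 1 / 16 * WN p α (Ioo 0 T') u + η / 16 := by
    nlinarith
  have h8 : WN p α (Ioo 0 T') u ≤ η / 2 := by linarith
  exact ⟨fun t ht => (h2 t ht).trans (by linarith), h8⟩

theorem QD.contr (D : QD p α ι A F u0 C L η T us us')
    (hx : InT p α ι x) (hy : InT p α ι y)
    (R : TRep p α (Ioo 0 T) ι x u u') (R' : TRep p α (Ioo 0 T) ι y v v')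
    (hf : ∀ᵐ t ∂(volume.restrict (Ioo 0 T)), u' t + A u0 (u t) = f t)
    (hg : ∀ᵐ t ∂(volume.restrict (Ioo 0 T)), v' t + A u0 (v t) = g t)
    (hb : ∀ t ∈ Icc 0 T, tn p α ι ((x + ∫ r in (0 : ℝ)..t, u' r) - u0) ≤ η)
    (hb' : ∀ t ∈ Icc 0 T, tn p α ι ((y + ∫ r in (0 : ℝ)..t, v' r) - u0) ≤ η)
    (hv : WN p α (Ioo 0 T) v ≤ η) :
    WN p α (Ioo 0 T) (fun t => GN A F u0 x u u' t - GN A F u0 y v v' t) ≤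
      1 / 2 * (tn p α ι (x - y) + WN p α (Ioo 0 T) (fun t => f t - g t)) := by
  have hs0 : Ioo (0 : ℝ) T ⊆ Ioi 0 := Ioo_subset_Ioi_self
  have hLη := mul_nonneg D.hL D.hη.le
  obtain ⟨h1, h2⟩ := D.lin.diff D.hp D.hα0 D.hα D.hT hx hy R R' hf hg
  set N := tn p α ι (x - y) + WN p α (Ioo 0 T) (fun t => f t - g t) with hN
  have hN0 : 0 ≤ N := add_nonneg tn_nonneg WN_nonneg
  have hC0 : 0 ≤ C := by linarith [D.hC]
  have hw1 := WM_one (T := T) (p := p) D.hα0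
  have hvn := R'.wm.norm measurableSet_Ioo hs0
  have hLC : 0 ≤ L * (C * N) := mul_nonneg D.hL (mul_nonneg hC0 hN0)
  have key := two_bound (f := fun t => GN A F u0 x u u' t - GN A F u0 y v v' t) D.hp
    measurableSet_Ioo hs0 (R.wm.sub R'.wm) (hvn.add hw1) hLη hLC ?_
  · refine key.1.trans ?_
    have a1 := (le_en D.hp).trans h1
    have a2 := WN_add_le D.hp hvn hw1
    have a3 := WN_norm R'.wm
    have a4 := D.small
    have a5 := D.k2
    have b1 := mul_le_mul_of_nonneg_left a1 hLη
    have b2 : WN p α (Ioo 0 T) (fun t => ‖v t‖ + 1) ≤ η + WN p α (Ioo 0 T) (fun _ => (1 : ℝ)) := by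
      linarith
    have b3 := mul_le_mul_of_nonneg_left b2 hLC
    have c1 := mul_le_mul_of_nonneg_right a4 hN0
    have c2 := mul_le_mul_of_nonneg_right a5 hN0
    nlinarith
  · filter_upwards [ae_restrict_mem measurableSet_Ioo] with t ht
    have ht' := Ioo_subset_Icc_self ht
    have i1 := D.lin.inT D.hp D.hα0 D.hα D.hT hx R ht'
    have i2 := D.lin.inT D.hp D.hα0 D.hα D.hT hy R' ht'
    have l1 := (D.lip _ _ i1 D.hu0 (hb t ht') D.tn0).1
    have l1' := mul_le_mul_of_nonneg_left (hb t ht') D.hL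
    have l2 := D.lip _ _ i1 i2 (hb t ht') (hb' t ht')
    have l3 := mul_le_mul_of_nonneg_left (h2 t ht') D.hL
    unfold GN
    set w1 := x + ∫ r in (0 : ℝ)..t, u' r
    set w2 := y + ∫ r in (0 : ℝ)..t, v' r
    have e : (A u0 - A w1) (u t) + F w1 - ((A u0 - A w2) (v t) + F w2) =
        (A u0 - A w1) (u t - v t) + (-((A w1 - A w2) (v t)) + (F w1 - F w2)) := by
      simp only [ContinuousLinearMap.sub_apply, map_sub]; abel
    rw [e]
    refine (norm_add_le _ _).trans (add_le_add ?_ ?_)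
    · refine (ContinuousLinearMap.le_opNorm _ _).trans ?_
      refine mul_le_mul_of_nonneg_right ?_ (norm_nonneg _)
      rw [norm_sub_rev]
      exact l1.trans l1'
    · refine (norm_add_le _ _).trans ?_
      rw [Real.norm_of_nonneg (by positivity : 0 ≤ ‖v t‖ + 1), mul_add, mul_one, norm_neg]
      refine add_le_add ((ContinuousLinearMap.le_opNorm _ _).trans
        (mul_le_mul_of_nonneg_right (l2.1.trans l3) (norm_nonneg _))) (l2.2.trans l3)

theorem QD.tn_cont (D : QD p α ι A F u0 C L η T us us')
    (hx : InT p α ι x) (R : TRep p α (Ioo 0 T) ι x u u') :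
    ContinuousOn (fun t => tn p α ι ((x + ∫ r in (0 : ℝ)..t, u' r) - u0)) (Icc 0 T) := by
  rw [Metric.continuousOn_iff]
  intro b hb ε hε
  obtain ⟨δ, hδ, h⟩ := D.lin.cont D.hp D.hα0 D.hα D.hT hx R hε
  refine ⟨δ, hδ, fun a ha hab => ?_⟩
  have i1 := D.lin.inT D.hp D.hα0 D.hα D.hT hx R ha
  have i2 := D.lin.inT D.hp D.hα0 D.hα D.hT hx R hb
  have h1 := h b hb a ha hab
  have h2 := tn_tri D.hp D.hα i1 i2 D.hu0
  have h3 := tn_tri D.hp D.hα i2 i1 D.hu0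
  rw [tn_comm (x := x + ∫ r in (0 : ℝ)..b, u' r) (y := x + ∫ r in (0 : ℝ)..a, u' r)] at h3
  rw [Real.dist_eq, abs_lt]
  constructor <;> linarith

/-- Every solution obeys the bounds. -/
theorem QD.sol_bounds (D : QD p α ι A F u0 C L η T us us')
    (hx : InT p α ι x) (R : TRep p α (Ioo 0 T) ι x u u')
    (hxe : C * tn p α ι (x - u0) ≤ η / 8)
    (hf : ∀ᵐ t ∂(volume.restrict (Ioo 0 T)), u' t + A u0 (u t) = GN A F u0 x u u' t) :
    (∀ t ∈ Icc 0 T, tn p α ι ((x + ∫ r in (0 : ℝ)..t, u' r) - u0) ≤ η) ∧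
    WN p α (Ioo 0 T) u ≤ η := by
  have hη := D.hη
  have hT := D.hT
  set φ : ℝ → ℝ := fun t => tn p α ι ((x + ∫ r in (0 : ℝ)..t, u' r) - u0) with hφ
  have hc : ContinuousOn φ (Icc 0 T) := D.tn_cont hx R
  have h0 : φ 0 ≤ η / 8 := by
    simp only [hφ, intervalIntegral.integral_same, add_zero]
    nlinarith [D.hC, tn_nonneg (p := p) (α := α) (ι := ι) (x := x - u0)]
  have hb : ∀ t ∈ Icc 0 T, φ t ≤ η := by
    by_contra! hcon
    obtain ⟨t0, ht0, ht0'⟩ := hcon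
    have hK : IsCompact (Icc 0 T ∩ φ ⁻¹' Ici η) :=
      isCompact_Icc.of_isClosed_subset (hc.preimage_isClosed_of_isClosed isClosed_Icc isClosed_Ici)
        inter_subset_left
    obtain ⟨t1, ht1, hmin⟩ := hK.exists_isLeast ⟨t0, ht0, ht0'.le⟩
    have ht1p : 0 < t1 := by
      rcases ht1.1.1.eq_or_lt with h | h
      · exfalso
        have : η ≤ φ t1 := ht1.2
        rw [← h] at this; linarith
      · exact h
    have hbb : ∀ t ∈ Icc 0 t1, φ t ≤ η := by
      intro t ht
      rcases ht.2.eq_or_lt with h | h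
      · subst h
        have hsub : Icc 0 t ⊆ Icc 0 T := Icc_subset_Icc_right ht1.1.2
        obtain ⟨r, hr, hr'⟩ := intermediate_value_Icc ht1p.le (hc.mono hsub)
          (show η ∈ Icc (φ 0) (φ t) from ⟨by linarith, ht1.2⟩)
        have := hmin ⟨hsub hr, hr'.ge⟩
        have : r = t := le_antisymm hr.2 this
        rw [← this, hr']
      · by_contra! hh
        have := hmin ⟨⟨ht.1, ht.2.trans ht1.1.2⟩, hh.le⟩
        linarith
    have hsub : Ioo (0 : ℝ) t1 ⊆ Ioo 0 T := Ioo_subset_Ioo_right ht1.1.2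
    have := (D.boot ht1p ht1.1.2 hx (R.mono hsub) hxe
      (ae_restrict_of_ae_restrict_of_subset hsub hf) hbb).1 t1 ⟨ht1p.le, le_rfl⟩
    have h2 : η ≤ φ t1 := ht1.2
    have h3 : φ t1 ≤ η / 2 := this
    linarith
  exact ⟨hb, (D.boot hT le_rfl hx R hxe hf hb).2.trans (by linarith)⟩

theorem QD.sol_lip (D : QD p α ι A F u0 C L η T us us')
    (hx : InT p α ι x) (hy : InT p α ι y)
    (R : TRep p α (Ioo 0 T) ι x u u') (R' : TRep p α (Ioo 0 T) ι y v v')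
    (hxe : C * tn p α ι (x - u0) ≤ η / 8) (hye : C * tn p α ι (y - u0) ≤ η / 8)
    (hf : ∀ᵐ t ∂(volume.restrict (Ioo 0 T)), u' t + A u0 (u t) = GN A F u0 x u u' t)
    (hg : ∀ᵐ t ∂(volume.restrict (Ioo 0 T)), v' t + A u0 (v t) = GN A F u0 y v v' t) :
    en p α (Ioo 0 T) (fun t => u t - v t) (fun t => u' t - v' t) ≤
      2 * C * tn p α ι (x - y) := by
  obtain ⟨b1, b2⟩ := D.sol_bounds hx R hxe hf
  obtain ⟨c1, c2⟩ := D.sol_bounds hy R' hye hg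
  have h1 := D.contr hx hy R R' hf hg b1 c1 c2
  have h2 := (D.lin.diff D.hp D.hα0 D.hα D.hT hx hy R R' hf hg).1
  have : WN p α (Ioo 0 T) (fun t => GN A F u0 x u u' t - GN A F u0 y v v' t) ≤ tn p α ι (x - y) := by
    linarith
  nlinarith [D.hC]

theorem QD.gn_meas (D : QD p α ι A F u0 C L η T us us')
    (hx : InT p α ι x) (R : TRep p α (Ioo 0 T) ι x u u')
    (hb : ∀ t ∈ Icc 0 T, tn p α ι ((x + ∫ r in (0 : ℝ)..t, u' r) - u0) ≤ η) :
    AEStronglyMeasurable (GN A F u0 x u u') (volume.restrict (Ioo 0 T)) := by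
  have key : ∀ ε > 0, ∃ δ > 0, ∀ a ∈ Icc 0 T, ∀ b ∈ Icc 0 T, |b - a| < δ →
      L * tn p α ι ((x + ∫ r in (0 : ℝ)..b, u' r) - (x + ∫ r in (0 : ℝ)..a, u' r)) < ε := by
    intro ε hε
    have hL1 : 0 < L + 1 := by linarith [D.hL]
    obtain ⟨δ, hδ, h⟩ := D.lin.cont D.hp D.hα0 D.hα D.hT hx R (div_pos hε hL1)
    refine ⟨δ, hδ, fun a ha b hb hab => ?_⟩
    have h1 := h a ha b hb hab
    rw [lt_div_iff₀ hL1] at h1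
    nlinarith [tn_nonneg (p := p) (α := α) (ι := ι)
      (x := (x + ∫ r in (0 : ℝ)..b, u' r) - (x + ∫ r in (0 : ℝ)..a, u' r))]
  have cA : ContinuousOn (fun t => A (x + ∫ r in (0 : ℝ)..t, u' r)) (Icc 0 T) := by
    rw [Metric.continuousOn_iff]
    intro b hbm ε hε
    obtain ⟨δ, hδ, h⟩ := key ε hε
    refine ⟨δ, hδ, fun a ha hab => ?_⟩
    have i1 := D.lin.inT D.hp D.hα0 D.hα D.hT hx R ha
    have i2 := D.lin.inT D.hp D.hα0 D.hα D.hT hx R hbm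
    rw [dist_eq_norm]
    exact (D.lip _ _ i1 i2 (hb a ha) (hb b hbm)).1.trans_lt (h b hbm a ha hab)
  have cF : ContinuousOn (fun t => F (x + ∫ r in (0 : ℝ)..t, u' r)) (Icc 0 T) := by
    rw [Metric.continuousOn_iff]
    intro b hbm ε hε
    obtain ⟨δ, hδ, h⟩ := key ε hε
    refine ⟨δ, hδ, fun a ha hab => ?_⟩
    have i1 := D.lin.inT D.hp D.hα0 D.hα D.hT hx R ha
    have i2 := D.lin.inT D.hp D.hα0 D.hα D.hT hx R hbm
    rw [dist_eq_norm]
    exact (D.lip _ _ i1 i2 (hb a ha) (hb b hbm)).2.trans_lt (h b hbm a ha hab)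
  have mA := ((continuousOn_const (c := A u0)).sub (cA.mono Ioo_subset_Icc_self)).aestronglyMeasurable
    (μ := volume) measurableSet_Ioo
  have mF := (cF.mono Ioo_subset_Icc_self).aestronglyMeasurable (μ := volume) measurableSet_Ioo
  have mu := R.wm.aesm measurableSet_Ioo Ioo_subset_Ioi_self
  exact ((ContinuousLinearMap.id ℝ (E1 →L[ℝ] E0)).aestronglyMeasurable_comp₂ mA mu).add mF

theorem fixpt (hp : 1 < p) (hs : MeasurableSet s) (hs0 : s ⊆ Ioi 0) {r : ℝ} (hr : 0 ≤ r)
    (Φ : (ℝ → E0) → ℝ → E0)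
    (h1 : ∀ f, WM p α s f → WN p α s f ≤ r → WM p α s (Φ f) ∧ WN p α s (Φ f) ≤ r)
    (h2 : ∀ f g, WM p α s f → WN p α s f ≤ r → WM p α s g → WN p α s g ≤ r →
      WN p α s (fun t => Φ f t - Φ g t) ≤ 1 / 2 * WN p α s (fun t => f t - g t)) :
    ∃ f, WM p α s f ∧ WN p α s f ≤ r ∧ ∀ᵐ t ∂(volume.restrict s), Φ f t = f t := by
  let a : ℕ → ℝ → E0 := fun n => Φ^[n] (fun _ => 0)
  have ha : ∀ n, a (n + 1) = Φ (a n) := fun n => Function.iterate_succ_apply' _ _ _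
  have hS : ∀ n, WM p α s (a n) ∧ WN p α s (a n) ≤ r := by
    intro n
    induction n with
    | zero => exact ⟨WM.zero, by simpa [a, WN_zero] using hr⟩
    | succ n ih => rw [ha]; exact h1 _ ih.1 ih.2
  have hcomm : ∀ n m, WN p α s (fun t => a n t - a m t) = WN p α s (fun t => a m t - a n t) := by
    intro n m
    rw [← WN_neg]; congr 1; ext t; abel
  have hd : ∀ n k, WN p α s (fun t => a n t - a (n + k) t) ≤ 2 * r * (1 / 2) ^ n := by
    intro n
    induction n with
    | zero =>
      intro k
      have := WN_sub_le hp (hS 0).1 (hS (0 + k)).1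
      have := (hS 0).2
      have := (hS (0 + k)).2
      simp only [pow_zero, mul_one]
      linarith
    | succ n ih =>
      intro k
      have e : n + 1 + k = n + k + 1 := by omega
      rw [e, ha, ha]
      refine (h2 _ _ (hS n).1 (hS n).2 (hS _).1 (hS _).2).trans ?_
      have := ih k
      rw [pow_succ]; linarith
  have hb : Tendsto (fun n : ℕ => 2 * r * (1 / 2) ^ n) atTop (𝓝 0) := by
    have := (tendsto_pow_atTop_nhds_zero_of_lt_one (r := (1 / 2 : ℝ)) (by norm_num)
      (by norm_num)).const_mul (2 * r)
    simpa using this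
  have hb0 : ∀ n : ℕ, 0 ≤ 2 * r * (1 / 2 : ℝ) ^ n := fun n => by positivity
  obtain ⟨f, hf, hl⟩ := WN_complete hp hs hs0 (fun n => (hS n).1) hb (fun n m => by
    rcases le_total n m with h | h
    · obtain ⟨k, rfl⟩ := Nat.exists_eq_add_of_le h
      have := hd n k; have := hb0 (n + k); linarith
    · obtain ⟨k, rfl⟩ := Nat.exists_eq_add_of_le h
      rw [hcomm]
      have := hd m k; have := hb0 (m + k); linarith)
  have hl2 : ∀ n, WN p α s (fun t => f t - a n t) = WN p α s (fun t => a n t - f t) := by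
    intro n
    rw [← WN_neg]; congr 1; ext t; abel
  have hfr : WN p α s f ≤ r := by
    refine ge_of_tendsto' (f := fun n => r + WN p α s (fun t => a n t - f t)) (x := atTop)
      (by simpa using hl.const_add r) fun n => ?_
    have := WN_add_le hp (hf.sub (hS n).1) (hS n).1
    simp only [sub_add_cancel] at this
    rw [hl2] at this
    have := (hS n).2
    linarith
  refine ⟨f, hf, hfr, ?_⟩
  have hΦ := h1 f hf hfr
  have hz : WN p α s (fun t => Φ f t - f t) ≤ 0 := by
    refine ge_of_tendsto' (f := fun n => 1 / 2 * WN p α s (fun t => a n t - f t) +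
      WN p α s (fun t => a (n + 1) t - f t)) (x := atTop) ?_ fun n => ?_
    · have := (hl.const_mul (1 / 2)).add (hl.comp (tendsto_add_atTop_nat 1))
      rw [mul_zero, add_zero] at this
      exact this
    · have h3 := WN_add_le hp (hΦ.1.sub (hS (n + 1)).1) ((hS (n + 1)).1.sub hf)
      simp only [sub_add_sub_cancel] at h3
      have h4 := h2 f (a n) hf hfr (hS n).1 (hS n).2
      rw [← ha, hl2] at h4
      linarith
  filter_upwards [WN_eq_zero hp hs hs0 (hΦ.1.sub hf) (le_antisymm hz WN_nonneg)] with t ht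
  exact sub_eq_zero.1 ht

theorem QD.exist (D : QD p α ι A F u0 C L η T us us')
    (hE : ∀ f : ℝ → E0, WM p α (Ioo 0 T) f →
      ∃ z : ℝ → E1, TRep p α (Ioo 0 T) ι x z (fun t => f t - A u0 (z t)))
    (hx : InT p α ι x) (hxe : C * tn p α ι (x - u0) ≤ η / 8) :
    ∃ u u', TRep p α (Ioo 0 T) ι x u u' ∧
      ∀ᵐ t ∂(volume.restrict (Ioo 0 T)), u' t + A u0 (u t) = GN A F u0 x u u' t := by
  have hs0 : Ioo (0 : ℝ) T ⊆ Ioi 0 := Ioo_subset_Ioi_self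
  have hC0 : 0 < C := by linarith [D.hC]
  have hη := D.hη
  have hE' : ∀ f : ℝ → E0, ∃ z : ℝ → E1, WM p α (Ioo 0 T) f →
      TRep p α (Ioo 0 T) ι x z (fun t => f t - A u0 (z t)) := by
    intro f
    by_cases h : WM p α (Ioo 0 T) f
    · obtain ⟨z, hz⟩ := hE f h; exact ⟨z, fun _ => hz⟩
    · exact ⟨fun _ => 0, fun h' => absurd h' h⟩
  choose Z hZ using hE'
  have he : ∀ f : ℝ → E0, ∀ᵐ t ∂(volume.restrict (Ioo 0 T)),
      (f t - A u0 (Z f t)) + A u0 (Z f t) = f t := fun f => Eventually.of_forall fun t => by abel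
  set r := η / (8 * C) with hr
  have hCr : C * r = η / 8 := by rw [hr]; field_simp
  have hr0 : 0 ≤ r := by positivity
  have hbd : ∀ f, WM p α (Ioo 0 T) f → WN p α (Ioo 0 T) f ≤ r →
      (∀ t ∈ Icc 0 T, tn p α ι ((x + ∫ r in (0 : ℝ)..t, (f r - A u0 (Z f r))) - u0) ≤ η) ∧
      WN p α (Ioo 0 T) (Z f) ≤ η := by
    intro f hf hfr
    obtain ⟨a1, a2⟩ := D.bounds D.hT le_rfl hx (hZ f hf) hxe (he f)
    have := mul_le_mul_of_nonneg_left hfr hC0.le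
    exact ⟨fun t ht => (a1 t ht).trans (by linarith), a2.trans (by linarith)⟩
  obtain ⟨f, hf, hfr, hfix⟩ := fixpt (α := α) D.hp measurableSet_Ioo hs0 hr0
    (fun f => GN A F u0 x (Z f) (fun t => f t - A u0 (Z f t)))
    (fun f hf hfr => by
      obtain ⟨b1, b2⟩ := hbd f hf hfr
      obtain ⟨g1, g2⟩ := D.gn_bound D.hT le_rfl hx (hZ f hf) b1
      refine ⟨g2 (D.gn_meas hx (hZ f hf) b1), ?_⟩
      refine le_of_mul_le_mul_left ?_ hC0
      rw [hCr]
      have h4 := mul_le_mul_of_nonneg_left g1 hC0.le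
      have h5 := mul_le_mul_of_nonneg_right D.small (WN_nonneg (p := p) (α := α)
        (s := Ioo 0 T) (f := Z f))
      have h6 := D.k1
      nlinarith)
    (fun f g hf hfr hg hgr => by
      obtain ⟨b1, b2⟩ := hbd f hf hfr
      obtain ⟨c1, c2⟩ := hbd g hg hgr
      have := D.contr hx hx (hZ f hf) (hZ g hg) (he f) (he g) b1 c1 c2
      rwa [sub_self, tn_zero D.hp, zero_add] at this)
  refine ⟨Z f, _, hZ f hf, ?_⟩
  filter_upwards [hfix] with t ht
  rw [ht]; abel

theorem QD.sol_iff (R : TRep p α (Ioo 0 T) ι x u u') :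
    (∀ᵐ t ∂(volume.restrict (Ioo 0 T)), u' t + A u0 (u t) = GN A F u0 x u u' t) ↔
    ∀ᵐ t ∂(volume.restrict (Ioo 0 T)), u' t + A (ι (u t)) (u t) = F (ι (u t)) := by
  constructor
  · intro h
    filter_upwards [h, R.eq] with t h1 h2
    unfold GN at h1
    rw [← h2, ContinuousLinearMap.sub_apply] at h1
    rw [eq_sub_of_add_eq h1]; abel
  · intro h
    filter_upwards [h, R.eq] with t h1 h2
    unfold GN
    rw [← h2, ContinuousLinearMap.sub_apply, ← h1]; abel

theorem quasi_main (hp : 1 < p) (hα0 : 0 ≤ α) (hα : α < 1 - 1 / p) (H : MRh p ι (A u0))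
    (V : Set E0) (hV : ∀ x ∈ V, InT p α ι x)
    (hVo : ∀ x ∈ V, ∃ r > (0 : ℝ), ∀ y, InT p α ι y → tn p α ι (y - x) < r → y ∈ V)
    (hLip : ∀ x ∈ V, ∃ ε > (0 : ℝ), ∃ L > (0 : ℝ), ∀ y ∈ V, ∀ z ∈ V,
      tn p α ι (y - x) ≤ ε → tn p α ι (z - x) ≤ ε →
      ‖A y - A z‖ ≤ L * tn p α ι (y - z) ∧ ‖F y - F z‖ ≤ L * tn p α ι (y - z)) (hu0 : u0 ∈ V) :
    ∃ T > (0 : ℝ), ∃ ε > (0 : ℝ),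
      (∀ y, InT p α ι y → tn p α ι (y - u0) ≤ ε → y ∈ V) ∧
      (∀ x, InT p α ι x → tn p α ι (x - u0) ≤ ε → ∃ u u', TRep p α (Ioo 0 T) ι x u u' ∧
        (∀ᵐ t ∂(volume.restrict (Ioo 0 T)), u' t + A (ι (u t)) (u t) = F (ι (u t))) ∧
        (∀ t ∈ Icc 0 T, x + ∫ r in (0 : ℝ)..t, u' r ∈ V) ∧
        ∀ ε > 0, ∃ δ > 0, ∀ a ∈ Icc 0 T, ∀ b ∈ Icc 0 T, |b - a| < δ →
          tn p α ι ((x + ∫ r in (0 : ℝ)..b, u' r) - (x + ∫ r in (0 : ℝ)..a, u' r)) < ε) ∧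
      ∃ c > (0 : ℝ), ∀ x y, InT p α ι x → tn p α ι (x - u0) ≤ ε → InT p α ι y →
        tn p α ι (y - u0) ≤ ε → ∀ u u' v v', TRep p α (Ioo 0 T) ι x u u' →
        (∀ᵐ t ∂(volume.restrict (Ioo 0 T)), u' t + A (ι (u t)) (u t) = F (ι (u t))) →
        TRep p α (Ioo 0 T) ι y v v' →
        (∀ᵐ t ∂(volume.restrict (Ioo 0 T)), v' t + A (ι (v t)) (v t) = F (ι (v t))) →
        en p α (Ioo 0 T) (fun t => u t - v t) (fun t => u' t - v' t) ≤ c * tn p α ι (x - y) := by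
  obtain ⟨C, hC, hEx, hlin⟩ := H.loclinear hp hα0 hα
  obtain ⟨r0, hr0, hball⟩ := hVo u0 hu0
  obtain ⟨e0, he0, L, hL, hlip⟩ := hLip u0 hu0
  have hC0 : 0 < C := by linarith
  have hi0 := hV u0 hu0
  obtain ⟨η, hη, hη1, hη2, hη3⟩ : ∃ η > 0, η < r0 ∧ η ≤ e0 ∧ η ≤ 1 / (16 * (L * C)) := by
    refine ⟨min (r0 / 2) (min e0 (1 / (16 * (L * C)))), by positivity, ?_, ?_, ?_⟩
    · exact (min_le_left _ _).trans_lt (by linarith)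
    · exact (min_le_right _ _).trans (min_le_left _ _)
    · exact (min_le_right _ _).trans (min_le_right _ _)
  have hsm : L * η * C ≤ 1 / 16 := by
    rw [le_div_iff₀ (by positivity)] at hη3
    linarith
  have hinV : ∀ y, InT p α ι y → tn p α ι (y - u0) ≤ η → y ∈ V :=
    fun y hy h => hball y hy (h.trans_lt hη1)
  -- reference solution
  obtain ⟨us, Rs⟩ := hEx 1 one_pos u0 hi0 (fun _ => 0) WM.zero
  have hlin' : LinP p α ι (A u0) C := hlin
  obtain ⟨δ, hδ, hδ'⟩ := hlin'.cont hp hα0 hα one_pos hi0 Rs (ε := η / 4) (by linarith)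
  have k1 : ∀ᶠ T : ℝ in 𝓝[>] 0, C * (WN p α (Ioo 0 T) (fun _ => (1 : ℝ)) * (‖F u0‖ + L * η)) <
      η / 16 := by
    have := ((WN_small hp (WM_one (T := 1) (p := p) hα0)).mul_const (‖F u0‖ + L * η)).const_mul C
    rw [zero_mul, mul_zero] at this
    exact this.eventually_lt_const (by linarith)
  have k2 : ∀ᶠ T : ℝ in 𝓝[>] 0, L * C * WN p α (Ioo 0 T) (fun _ => (1 : ℝ)) < 1 / 4 := by
    have := (WN_small hp (WM_one (T := 1) (p := p) hα0)).const_mul (L * C)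
    rw [mul_zero] at this
    exact this.eventually_lt_const (by norm_num)
  have k3 : ∀ᶠ T : ℝ in 𝓝[>] 0, WN p α (Ioo 0 T) us < η / 4 :=
    (WN_small hp Rs.wm).eventually_lt_const (by linarith)
  have k4 : ∀ᶠ T : ℝ in 𝓝[>] 0, T ∈ Ioo (0 : ℝ) 1 := Ioo_mem_nhdsGT one_pos
  have k5 : ∀ᶠ T : ℝ in 𝓝[>] 0, T ∈ Ioo (0 : ℝ) δ := Ioo_mem_nhdsGT hδ
  obtain ⟨T, ⟨⟨⟨hk1, hk2⟩, hk3⟩, hk4⟩, hk5⟩ := ((((k1.and k2).and k3).and k4).and k5).exists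
  have D : QD p α ι A F u0 C L η T us (fun t => 0 - A u0 (us t)) :=
    { hp := hp, hα0 := hα0, hα := hα, lin := hlin', hC := hC, hL := hL.le, hη := hη, hu0 := hi0
      lip := fun y z hy hz h1 h2 => hlip y (hinV y hy h1) z (hinV z hz h2) (h1.trans hη2) (h2.trans hη2)
      small := hsm
      hT := hk4.1
      Rs := Rs.mono (Ioo_subset_Ioo_right hk4.2.le)
      es := Eventually.of_forall fun t => by abel
      bs := fun t ht => by
        have := hδ' 0 ⟨le_rfl, zero_le_one⟩ t ⟨ht.1, ht.2.trans hk4.2.le⟩ (by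
          rw [sub_zero, abs_of_nonneg ht.1]; exact ht.2.trans_lt hk5.2)
        rw [intervalIntegral.integral_same, add_zero] at this
        exact this.le
      ns := hk3.le
      k1 := hk1.le
      k2 := hk2.le }
  have hε : ∀ x, tn p α ι (x - u0) ≤ η / (8 * C) → C * tn p α ι (x - u0) ≤ η / 8 := by
    intro x hx
    rw [le_div_iff₀ (by positivity)] at hx
    linarith
  refine ⟨T, hk4.1, η / (8 * C), by positivity, fun y hy h => ?_, fun x hx hxe => ?_,
    2 * C, by positivity, fun x y hx hxe hy hye u u' v v' R hu R' hv => ?_⟩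
  · refine hinV y hy ?_
    have h1 := hε y h
    nlinarith [tn_nonneg (p := p) (α := α) (ι := ι) (x := y - u0)]
  · obtain ⟨u, u', R, h⟩ := D.exist (fun f hf => hEx T hk4.1 x hx f hf) hx (hε x hxe)
    obtain ⟨b1, b2⟩ := D.sol_bounds hx R (hε x hxe) h
    exact ⟨u, u', R, (QD.sol_iff R).1 h,
      fun t ht => hinV _ (hlin'.inT hp hα0 hα hk4.1 hx R ht) (b1 t ht),
      fun ε hε => hlin'.cont hp hα0 hα hk4.1 hx R hε⟩
  · exact D.sol_lip hx hy R R' (hε x hxe) (hε y hye) ((QD.sol_iff R).2 hu) ((QD.sol_iff R').2 hv)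

end PartSeven

section PartEight

open Filter Topology

variable {p μ : ℝ} {s : Set ℝ} {ι : X₁ →L[ℂ] X₀} {u : ℝ → X₁} {u' : ℝ → X₀} {x : X₀}

theorem trace_unique {E : Type*} [NormedAddCommGroup E] (hs : Ini s) {w1 w2 : ℝ → E}
    (h1 : ContinuousWithinAt w1 s 0) (h2 : ContinuousWithinAt w2 s 0)
    (h : ∀ᵐ t ∂(volume.restrict s), w1 t = w2 t) : w1 0 = w2 0 := by
  by_contra hne
  have hd := (h1.sub h2).eventually_ne (sub_ne_zero.2 hne)
  rw [eventually_nhdsWithin_iff, Metric.eventually_nhds_iff] at hd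
  obtain ⟨ε, hε, hd⟩ := hd
  obtain ⟨b, hb⟩ := hs.nonempty
  have hb0 : 0 < b := hs.pos hb
  have hm : 0 < min b ε := lt_min hb0 hε
  have hsub : Ioo 0 (min b ε) ⊆ s := fun t ht =>
    hs.down b hb ⟨ht.1, (ht.2.trans_le (min_le_left _ _)).le⟩
  have h3 := ae_restrict_of_ae_restrict_of_subset hsub h
  have hne : (ae (volume.restrict (Ioo 0 (min b ε)))).NeBot := by
    rw [ae_neBot]
    intro h0
    rw [Measure.restrict_eq_zero, Real.volume_Ioo, sub_zero, ENNReal.ofReal_eq_zero] at h0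
    linarith
  obtain ⟨t, ht1, ht2⟩ := (h3.and (ae_restrict_mem measurableSet_Ioo)).exists
  refine hd (y := t) ?_ (hsub ht2) (by rw [Pi.sub_apply, ht1, sub_self])
  rw [Real.dist_eq, sub_zero, abs_of_pos ht2.1]
  exact ht2.2.trans_le (min_le_right _ _)

theorem cwa_prim (hs : Ini s) {g : ℝ → X₀} (hg : ∀ t ∈ s, IntegrableOn g (Ioo 0 t)) (x : X₀) :
    ContinuousOn (fun t => x + ∫ r in (0 : ℝ)..t, g r) (insert 0 s) :=
  continuousOn_const.add (locint_prim hs hg)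

theorem memE_rep (hp : 1 < p) (hμ : 1 / p < μ) (hs : Ini s) (h : MemE p μ s ι u u') :
    ∃ x, TRep p (1 - μ) s (ι.restrictScalars ℝ) x u u' := by
  obtain ⟨a1, a2, a3, b1, b2, b3⟩ := h
  have hm := hs.isOpen.measurableSet
  rw [memWLp_iff hp hm hs.pos] at a1 a3
  have hα : 1 - μ < 1 - 1 / p := by linarith
  obtain ⟨x, hx⟩ := int_of_weak hs b1 (fun t ht => a3.intOn hp hα hs ht) b3
  exact ⟨x, a1, a3, hx⟩

theorem rep_of (hp : 1 < p) (hμ : 1 / p < μ) (hs : Ini s) (h : MemE p μ s ι u u') {w : ℝ → X₀}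
    (hw : ContinuousWithinAt w s 0) (hwu : ∀ᵐ t ∂(volume.restrict s), w t = ι (u t)) (hw0 : w 0 = x) :
    TRep p (1 - μ) s (ι.restrictScalars ℝ) x u u' := by
  obtain ⟨x', R⟩ := memE_rep hp hμ hs h
  have hα : 1 - μ < 1 - 1 / p := by linarith
  have hc := cwa_prim hs (fun t ht => R.wm'.intOn hp hα hs ht) x'
  have := trace_unique hs hw ((hc 0 (mem_insert _ _)).mono (subset_insert _ _)) (by
    filter_upwards [hwu, R.eq] with t h1 h2
    rw [h1]; exact h2)
  rw [intervalIntegral.integral_same, add_zero, hw0] at this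
  rw [this]; exact R

theorem rep_of_trace (hp : 1 < p) (hμ : 1 / p < μ) (hs : Ini s) (h : MemE p μ s ι u u')
    (ht : HasTrace s (fun t => ι (u t)) x) : TRep p (1 - μ) s (ι.restrictScalars ℝ) x u u' := by
  obtain ⟨w, h1, h2, h3⟩ := ht
  exact rep_of hp hμ hs h ((h1 0 (mem_insert _ _)).mono (subset_insert _ _)) h2 h3

theorem TRep.memE (hp : 1 < p) (hμ : 1 / p < μ) (hs : Ini s)
    (R : TRep p (1 - μ) s (ι.restrictScalars ℝ) x u u') :
    MemE p μ s ι u u' ∧ HasTrace s (fun t => ι (u t)) x := by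
  have hm := hs.isOpen.measurableSet
  have hα : 1 - μ < 1 - 1 / p := by linarith
  have hi := R.wm.clm (ι.restrictScalars ℝ)
  have hg : ∀ t ∈ s, IntegrableOn u' (Ioo 0 t) := fun t ht => R.wm'.intOn hp hα hs ht
  refine ⟨⟨(memWLp_iff hp hm hs.pos).2 R.wm, (memWLp_iff hp hm hs.pos).2 hi,
    (memWLp_iff hp hm hs.pos).2 R.wm', locint_of hs (fun t ht => hi.intOn hp hα hs ht),
    locint_of hs hg, weak_of_int hs hg R.eq⟩, _, cwa_prim hs hg x, ?_, by simp⟩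
  filter_upwards [R.eq] with t ht
  exact ht.symm

theorem inTrace_iff (hp : 1 < p) (hμ : 1 / p < μ) :
    InTrace p μ ι x ↔ InT p (1 - μ) (ι.restrictScalars ℝ) x := by
  constructor
  · rintro ⟨u, u', h1, h2⟩
    exact ⟨u, u', rep_of_trace hp hμ Ini.Ioi h1 h2⟩
  · rintro ⟨u, u', R⟩
    exact ⟨u, u', R.memE hp hμ Ini.Ioi⟩

theorem eNorm_eq (hp : 1 < p) (hs : Ini s) (hu : WM p (1 - μ) s u) (hu' : WM p (1 - μ) s u') :
    eNorm p μ s u u' = en p (1 - μ) s u u' := by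
  have hm := hs.isOpen.measurableSet
  unfold eNorm en
  rw [wLpNorm_eq hp hm hs.pos hu, wLpNorm_eq hp hm hs.pos hu']

theorem traceNorm_eq (hp : 1 < p) (hμ : 1 / p < μ) :
    traceNorm p μ ι x = tn p (1 - μ) (ι.restrictScalars ℝ) x := by
  unfold traceNorm tn
  congr 1
  ext r
  constructor
  · rintro ⟨u, u', h1, h2, rfl⟩
    have R := rep_of_trace hp hμ Ini.Ioi h1 h2
    exact ⟨u, u', R, eNorm_eq hp Ini.Ioi R.wm R.wm'⟩
  · rintro ⟨u, u', R, rfl⟩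
    obtain ⟨h1, h2⟩ := R.memE hp hμ Ini.Ioi
    exact ⟨u, u', h1, h2, (eNorm_eq hp Ini.Ioi R.wm R.wm').symm⟩

theorem MRw.mrh {A : X₁ →L[ℂ] X₀} (hp : 1 < p) (h : MRw p 1 ι A) :
    MRh p (ι.restrictScalars ℝ) (A.restrictScalars ℝ) := by
  have hm := measurableSet_Ioi (a := (0 : ℝ))
  have h1p : 1 / p < 1 := by rw [div_lt_one (by linarith)]; exact hp
  have e : (1 : ℝ) - 1 = 0 := sub_self 1
  constructor
  · intro f hf
    have hf' : MemWLp p 1 (Ioi 0) f := by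
      rw [memWLp_iff hp hm subset_rfl, e]; exact hf
    obtain ⟨u, u', h1, h2, h3⟩ := (h f hf').1
    have R := rep_of_trace hp h1p Ini.Ioi h1 h3
    rw [e] at R
    refine ⟨u, R.wm, ?_⟩
    filter_upwards [R.eq, ae_restrict_mem hm] with t ht hts
    rw [ht, zero_add]
    refine prim_congr Ini.Ioi ?_ hts
    filter_upwards [h2] with r hr
    rw [← hr]; simp
  · intro u hu hS
    have hf' : MemWLp p 1 (Ioi 0) (fun _ => (0 : X₀)) := by
      rw [memWLp_iff hp hm subset_rfl, e]; exact WM.zero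
    have R : TRep p (1 - 1) (Ioi 0) (ι.restrictScalars ℝ) 0 u (fun t => 0 - A (u t)) := by
      rw [e]
      refine ⟨hu, WM.zero.sub (hu.clm (A.restrictScalars ℝ)), ?_⟩
      filter_upwards [hS] with t ht
      rw [ht, zero_add]; rfl
    have R0 : TRep p (1 - 1) (Ioi 0) (ι.restrictScalars ℝ) 0 (fun _ => 0) (fun _ => 0) := rep_zero
    obtain ⟨a1, a2⟩ := R.memE hp h1p Ini.Ioi
    obtain ⟨b1, b2⟩ := R0.memE hp h1p Ini.Ioi
    exact (h _ hf').2 _ _ _ _ ⟨a1, Eventually.of_forall fun t => by simp, a2⟩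
      ⟨b1, Eventually.of_forall fun t => by simp, b2⟩

theorem IsQLSol.rep {T : ℝ} {A : X₀ → X₁ →L[ℂ] X₀} {F : X₀ → X₀} {V : Set X₀} (hp : 1 < p)
    (hμ : 1 / p < μ) (hT : 0 < T) (hV : ∀ x ∈ V, InTrace p μ ι x)
    (h : IsQLSol p μ T ι A F V x u u') :
    TRep p (1 - μ) (Ioo 0 T) (ι.restrictScalars ℝ) x u u' := by
  obtain ⟨h1, h2, w, h3, h4, h5, h6⟩ := h
  have hα : 1 - μ < 1 - 1 / p := by linarith
  obtain ⟨c, hc, hn⟩ := norm_le_tn hp hα (ι.restrictScalars ℝ)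
  refine rep_of hp hμ (Ini.Ioo hT) h1 ?_ h3 h4
  rw [Metric.continuousWithinAt_iff]
  intro ε hε
  obtain ⟨δ, hδ, h7⟩ := h6 0 ⟨le_rfl, hT.le⟩ (ε / (c + 1)) (by positivity)
  refine ⟨δ, hδ, fun t ht htd => ?_⟩
  have ht' := Ioo_subset_Icc_self ht
  have h8 := h7 t ht' htd
  rw [traceNorm_eq hp hμ, lt_div_iff₀ (by positivity)] at h8
  have h9 := hn _ (((inTrace_iff hp hμ).1 (hV _ (h5 t ht'))).sub hp hα
    ((inTrace_iff hp hμ).1 (hV _ (h5 0 ⟨le_rfl, hT.le⟩))))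
  rw [dist_eq_norm]
  nlinarith [tn_nonneg (p := p) (α := 1 - μ) (ι := ι.restrictScalars ℝ) (x := w t - w 0)]

end PartEight

/-- **Local well-posedness of quasilinear parabolic evolution equations in
weighted `L_p`-spaces; Köhne–Prüss–Wilke.** Let `1 < p < ∞`, `μ ∈ (1/p,1]`, let
`V ⊆ X_{γ,μ}` be open and nonempty, `(A,F) : V → B(X₁,X₀) × X₀` locally Lipschitz, and
`u₀ ∈ V` with `A(u₀) ∈ MR_p(X₀)`. Then there exist `T = T(u₀) > 0` and `ε = ε(u₀) > 0`
such that the closed ball `B̄_{X_{γ,μ}}(u₀,ε) ⊆ V`, and for every initial value `u₁` in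
this ball the problem `u̇ + A(u)u = F(u)`, `u(0) = u₁` has a unique solution
`u(·,u₁) ∈ E_{1,μ}(0,T) ∩ C([0,T];V)`; moreover there is `c = c(u₀) > 0` with
`‖u(·,u₁) − u(·,u₂)‖_{E_{1,μ}(0,T)} ≤ c ‖u₁ − u₂‖_{X_{γ,μ}}` for all `u₁, u₂` in the
ball. -/
theorem statement12 (p μ : ℝ) (hp : 1 < p) (hμ : 1 / p < μ) (hμ1 : μ ≤ 1)
    (ι : X₁ →L[ℂ] X₀) (hinj : Function.Injective ι) (hdense : DenseRange ι)
    (A : X₀ → X₁ →L[ℂ] X₀) (F : X₀ → X₀) (V : Set X₀)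
    (hVne : V.Nonempty) (hVopen : TraceOpen p μ ι V) (hLip : LocLip p μ ι A F V)
    (hgraph : ∀ v ∈ V, GraphNormEquiv ι (A v))
    (u₀ : X₀) (hu₀ : u₀ ∈ V) (hMR : MRw p 1 ι (A u₀)) :
    ∃ T > (0 : ℝ), ∃ ε > (0 : ℝ),
      (∀ y, InTrace p μ ι y → traceNorm p μ ι (y - u₀) ≤ ε → y ∈ V) ∧
      (∀ u₁, InTrace p μ ι u₁ → traceNorm p μ ι (u₁ - u₀) ≤ ε →
        ∃ u u', IsQLSol p μ T ι A F V u₁ u u') ∧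
      (∀ u₁, InTrace p μ ι u₁ → traceNorm p μ ι (u₁ - u₀) ≤ ε →
        ∀ u u' v v', IsQLSol p μ T ι A F V u₁ u u' → IsQLSol p μ T ι A F V u₁ v v' →
          ∀ᵐ t ∂(volume.restrict (Set.Ioo 0 T)), u t = v t) ∧
      ∃ c > (0 : ℝ), ∀ u₁ u₂, InTrace p μ ι u₁ → traceNorm p μ ι (u₁ - u₀) ≤ ε →
        InTrace p μ ι u₂ → traceNorm p μ ι (u₂ - u₀) ≤ ε →
        ∀ u u' v v', IsQLSol p μ T ι A F V u₁ u u' → IsQLSol p μ T ι A F V u₂ v v' →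
          eNorm p μ (Set.Ioo 0 T) (fun t => u t - v t) (fun t => u' t - v' t) ≤
            c * traceNorm p μ ι (u₁ - u₂) := by
  have hV := hVopen.1
  have hα : 1 - μ < 1 - 1 / p := by linarith
  have hα0 : 0 ≤ 1 - μ := by linarith
  have hVo := hVopen.2
  have hL : LocLip p μ ι A F V := hLip
  unfold LocLip at hL
  simp only [inTrace_iff hp hμ, traceNorm_eq hp hμ] at hVo hL ⊢
  obtain ⟨T, hT, ε, hε, h1, h2, c, hc, h3⟩ := quasi_main (F := F) hp hα0 hα
    (A := fun v => (A v).restrictScalars ℝ) (u0 := u₀) (MRw.mrh hp hMR) V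
    (fun x hx => (inTrace_iff hp hμ).1 (hV x hx)) hVo
    (fun x hx => by
      obtain ⟨ε, hε, L, hL0, h⟩ := hL x hx
      refine ⟨ε, hε, L, hL0, fun y hy z hz a b => ⟨?_, (h y hy z hz a b).2⟩⟩
      have := (h y hy z hz a b).1
      rw [← ContinuousLinearMap.norm_restrictScalars (𝕜' := ℝ)] at this
      exact this) hu₀
  refine ⟨T, hT, ε, hε, h1, fun x hx hxe => ?_, fun x hx hxe u u' v v' hu hv => ?_, c, hc,
    fun x y hx hxe hy hye u u' v v' hu hv => ?_⟩
  · obtain ⟨u, u', R, a1, a2, a3⟩ := h2 x hx hxe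
    refine ⟨u, u', (R.memE hp hμ (Ini.Ioo hT)).1, a1, fun t => x + ∫ r in (0 : ℝ)..t, u' r,
      ?_, by simp, a2, fun t ht e he => ?_⟩
    · filter_upwards [R.eq] with t ht
      exact ht.symm
    · obtain ⟨δ, hδ, h⟩ := a3 e he
      refine ⟨δ, hδ, fun t' ht' htt => ?_⟩
      rw [traceNorm_eq hp hμ]
      exact h t ht t' ht' htt
  · have R := hu.rep hp hμ hT hV
    have R' := hv.rep hp hμ hT hV
    have := h3 x x hx hxe hx hxe u u' v v' R hu.2.1 R' hv.2.1
    rw [sub_self, tn_zero hp, mul_zero] at this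
    filter_upwards [WN_eq_zero hp measurableSet_Ioo Ioo_subset_Ioi_self (R.wm.sub R'.wm)
      (le_antisymm ((le_en hp).trans this) WN_nonneg)] with t ht
    exact sub_eq_zero.1 ht
  · have R := hu.rep hp hμ hT hV
    have R' := hv.rep hp hμ hT hV
    rw [eNorm_eq hp (Ini.Ioo hT) (R.wm.sub R'.wm) (R.wm'.sub R'.wm')]
    exact h3 x y hx hxe hy hye u u' v v' R hu.2.1 R' hv.2.1
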